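/- arXiv:0801.2888 — 3 statements merged into one kernel-verified Lean document; each statement's English description precedes it below -/
import Mathlib

section
/- Let N ≥ 1, m ≥ 1 and p > N with p ≥ 2, and let f ∈ X_T be the mild solution of the Fermi-Dirac-Fokker-Planck equation on [0,T] with non-negative initial datum f₀ ∈ Υ. Then the L¹-norm of f is conserved: ‖f(t)‖_{L¹(ℝ^N)} = ‖f₀‖_{L¹(ℝ^N)} for all t ∈ [0,T]. -/
open MeasureTheory Real Filter
open scoped ENNReal NNReal Topology

noncomputable section


/-- ℝ^N as a Euclidean space. -/
abbrev Evec (N : ℕ) := EuclideanSpace ℝ (Fin N)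

/-- The weighted norm `‖(1+|v|^m) f‖_{L^p(ℝ^N)}` (as an extended nonnegative real). -/
noncomputable def wLpNorm (N : ℕ) (p : ℝ≥0∞) (m : ℝ) (f : Evec N → ℝ) : ℝ≥0∞ :=
  eLpNorm (fun v => (1 + ‖v‖ ^ m) * f v) p volume

/-- The weighted norm `‖(1+|v|^m) G‖_{L^p(ℝ^N)}` of a vector field `G`. -/
noncomputable def wLpNormV (N : ℕ) (p : ℝ≥0∞) (m : ℝ) (G : Evec N → Evec N) : ℝ≥0∞ :=
  eLpNorm (fun v => (1 + ‖v‖ ^ m) * ‖G v‖) p volume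

/-- Membership in `Υ = L^∞ ∩ L¹₁ ∩ L^p_m`. -/
def MemUpsilon (N : ℕ) (p m : ℝ) (f : Evec N → ℝ) : Prop :=
  AEStronglyMeasurable f volume ∧ eLpNorm f ⊤ volume < ⊤ ∧
    wLpNorm N 1 1 f < ⊤ ∧ wLpNorm N (ENNReal.ofReal p) m f < ⊤

/-- The norm of `Υ`: `max {‖f‖_∞, ‖f‖_{L¹₁}, ‖f‖_{L^p_m}}`. -/
noncomputable def UpsilonNorm (N : ℕ) (p m : ℝ) (f : Evec N → ℝ) : ℝ≥0∞ :=
  max (eLpNorm f ⊤ volume) (max (wLpNorm N 1 1 f) (wLpNorm N (ENNReal.ofReal p) m f))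

/-- The fundamental solution `𝓕(t,v,w)` of the linear Fokker-Planck equation
`∂_t f = Δ_v f + div_v(vf)`. -/
noncomputable def FPkernel (N : ℕ) (t : ℝ) (v w : Evec N) : ℝ :=
  exp ((N : ℝ) * t) * (2 * π * (exp (2 * t) - 1)) ^ (-(N : ℝ) / 2) *
    exp (-‖exp t • v - w‖ ^ 2 / (2 * (exp (2 * t) - 1)))

/-- Continuity of `t ↦ f(t)` from `[0,T]` into `Υ` (w.r.t. the `Υ` norm). -/
def ContinuousInUpsilon (N : ℕ) (p m T : ℝ) (f : ℝ → Evec N → ℝ) : Prop :=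
  ∀ t₀ ∈ Set.Icc (0 : ℝ) T, ∀ ε : ℝ, 0 < ε → ∃ δ : ℝ, 0 < δ ∧
    ∀ t ∈ Set.Icc (0 : ℝ) T, |t - t₀| < δ →
      UpsilonNorm N p m (fun v => f t v - f t₀ v) < ENNReal.ofReal ε

/-- A mild solution on `[0,T]` of the Fermi-Dirac-Fokker-Planck equation
`∂_t f = Δ_v f + div_v(v f (1-f))` with initial datum `f₀`:
a function `f ∈ C([0,T]; Υ)` with `f(0) = f₀` satisfying the Duhamel formula
`f(t,v) = ∫ 𝓕(t,v,w) f₀(w) dw + ∫₀ᵗ e^{-(t-s)} ∫ (∇_v𝓕(t-s,v,w)·w) f(s,w)² dw ds`. -/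
def IsMildSolution (N : ℕ) (p m T : ℝ) (f₀ : Evec N → ℝ) (f : ℝ → Evec N → ℝ) : Prop :=
  (∀ t ∈ Set.Icc (0 : ℝ) T, MemUpsilon N p m (f t)) ∧
  ContinuousInUpsilon N p m T f ∧
  f 0 =ᵐ[volume] f₀ ∧
  ∀ t ∈ Set.Ioc (0 : ℝ) T, ∀ᵐ v : Evec N ∂volume,
    f t v = (∫ w : Evec N, FPkernel N t v w * f₀ w) +
      ∫ s in Set.Ioc (0 : ℝ) t, exp (-(t - s)) *
        ∫ w : Evec N,
          (@inner ℝ _ _ (gradient (fun u => FPkernel N (t - s) u w) v) w) * (f s w) ^ 2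

/-- Membership in `X_T`: a mild solution on `[0,T]` with
`sup_{0<t<T} ν(t)^{1/2} (‖∇_v f(t)‖_{L^p_m} + ‖∇_v f(t)‖_{L¹₁}) < ∞`, `ν(t) = e^{2t}-1`. -/
def MemXT (N : ℕ) (p m T : ℝ) (f₀ : Evec N → ℝ) (f : ℝ → Evec N → ℝ) : Prop :=
  IsMildSolution N p m T f₀ f ∧
  ∃ C : ℝ≥0∞, C ≠ ⊤ ∧ ∀ t ∈ Set.Ioo (0 : ℝ) T,
    ENNReal.ofReal (Real.sqrt (exp (2 * t) - 1)) *
      (wLpNormV N (ENNReal.ofReal p) m (fun v => gradient (f t) v) +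
        wLpNormV N 1 1 (fun v => gradient (f t) v)) ≤ C

/-- A global mild solution: the restriction to `[0,T]` belongs to `X_T` for every `T > 0`. -/
def IsGlobalSolution (N : ℕ) (p m : ℝ) (f₀ : Evec N → ℝ) (f : ℝ → Evec N → ℝ) : Prop :=
  ∀ T : ℝ, 0 < T → MemXT N p m T f₀ f



def gH (N : ℕ) (a : ℝ) (z : Evec N) : ℝ := (2 * π * a) ^ (-(N : ℝ) / 2) * exp (-‖z‖ ^ 2 / (2 * a))
def gD (N : ℕ) (a : ℝ) (i : Fin N) (z : Evec N) : ℝ := -(z i / a) * gH N a z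
def gDD (N : ℕ) (a : ℝ) (i : Fin N) (z : Evec N) : ℝ := (z i ^ 2 / a ^ 2 - 1 / a) * gH N a z

lemma gH_pos {N : ℕ} {a : ℝ} (ha : 0 < a) (z : Evec N) : 0 < gH N a z := by
  unfold gH; positivity

lemma gH_contAt {N : ℕ} {q : ℝ × Evec N} (hq : 0 < q.1) :
    ContinuousAt (fun q : ℝ × Evec N => gH N q.1 q.2) q := by
  unfold gH
  have h2 : 2 * q.1 ≠ 0 := by positivity
  refine ContinuousAt.mul ?_ ?_
  · refine ContinuousAt.rpow_const (by fun_prop) (Or.inl (by positivity))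
  · refine ContinuousAt.rexp ?_
    exact ContinuousAt.div (by fun_prop) (by fun_prop) h2

lemma gD_contAt {N : ℕ} (i : Fin N) {q : ℝ × Evec N} (hq : 0 < q.1) :
    ContinuousAt (fun q : ℝ × Evec N => gD N q.1 i q.2) q := by
  unfold gD
  refine ContinuousAt.mul ?_ (gH_contAt hq)
  exact (ContinuousAt.div (by fun_prop) (by fun_prop) hq.ne').neg

lemma gDD_contAt {N : ℕ} (i : Fin N) {q : ℝ × Evec N} (hq : 0 < q.1) :
    ContinuousAt (fun q : ℝ × Evec N => gDD N q.1 i q.2) q := by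
  unfold gDD
  refine ContinuousAt.mul ?_ (gH_contAt hq)
  refine (ContinuousAt.div (by fun_prop) (by fun_prop) (by positivity)).sub
    (ContinuousAt.div (by fun_prop) (by fun_prop) hq.ne')

lemma gH_cont {N : ℕ} {a : ℝ} (ha : 0 < a) : Continuous (gH N a) :=
  continuous_iff_continuousAt.2 fun z =>
    (gH_contAt (q := (a, z)) ha).comp (f := fun z : Evec N => (a, z)) (by fun_prop)
lemma gD_cont {N : ℕ} (i : Fin N) {a : ℝ} (ha : 0 < a) : Continuous (gD N a i) :=
  continuous_iff_continuousAt.2 fun z =>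
    (gD_contAt i (q := (a, z)) ha).comp (f := fun z : Evec N => (a, z)) (by fun_prop)
lemma gDD_cont {N : ℕ} (i : Fin N) {a : ℝ} (ha : 0 < a) : Continuous (gDD N a i) :=
  continuous_iff_continuousAt.2 fun z =>
    (gDD_contAt i (q := (a, z)) ha).comp (f := fun z : Evec N => (a, z)) (by fun_prop)

def gB (N : ℕ) (a : ℝ) : ℝ := (3 / a + (1 + 2 * a) / a + 1) * (2 * π * a) ^ (-(N : ℝ) / 2)

lemma coord_le {N : ℕ} (z : Evec N) (i : Fin N) : |z i| ≤ ‖z‖ := by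
  simpa using PiLp.norm_apply_le z i

lemma sq_exp_le {a r : ℝ} (ha : 0 < a) : r ^ 2 * exp (-r ^ 2 / (2 * a)) ≤ 2 * a := by
  have h := add_one_le_exp (r ^ 2 / (2 * a))
  have h1 : r ^ 2 ≤ 2 * a * exp (r ^ 2 / (2 * a)) := by
    have : r ^ 2 / (2 * a) ≤ exp (r ^ 2 / (2 * a)) := by linarith
    rw [div_le_iff₀ (by positivity)] at this; linarith
  rw [neg_div, exp_neg]
  have := exp_pos (r ^ 2 / (2 * a))
  rw [← div_eq_mul_inv, div_le_iff₀ this]; exact h1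

lemma gH_nn {N : ℕ} {a : ℝ} (ha : 0 < a) (z : Evec N) : 0 ≤ gH N a z := (gH_pos ha z).le

lemma gH_le0 {N : ℕ} {a : ℝ} (ha : 0 < a) (z : Evec N) : gH N a z ≤ (2 * π * a) ^ (-(N : ℝ) / 2) := by
  unfold gH
  have h1 : exp (-‖z‖ ^ 2 / (2 * a)) ≤ 1 := by
    apply exp_le_one_iff.2; rw [neg_div]; have : 0 ≤ ‖z‖ ^ 2 / (2 * a) := by positivity
    linarith
  have : 0 ≤ (2 * π * a) ^ (-(N : ℝ) / 2) := by positivity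
  nlinarith

lemma sq_gH_le {N : ℕ} {a : ℝ} (ha : 0 < a) (z : Evec N) :
    ‖z‖ ^ 2 * gH N a z ≤ 2 * a * (2 * π * a) ^ (-(N : ℝ) / 2) := by
  unfold gH
  have := sq_exp_le (r := ‖z‖) ha
  have h : 0 ≤ (2 * π * a) ^ (-(N : ℝ) / 2) := by positivity
  nlinarith

lemma gH_le {N : ℕ} {a : ℝ} (ha : 0 < a) (z : Evec N) : |gH N a z| ≤ gB N a := by
  rw [abs_of_nonneg (gH_nn ha z)]
  refine (gH_le0 ha z).trans ?_
  unfold gB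
  have h : 0 ≤ (2 * π * a) ^ (-(N : ℝ) / 2) := by positivity
  have : 0 ≤ 3 / a + (1 + 2 * a) / a := by positivity
  nlinarith

lemma gD_le {N : ℕ} (i : Fin N) {a : ℝ} (ha : 0 < a) (z : Evec N) : |gD N a i z| ≤ gB N a := by
  unfold gD
  rw [abs_mul, abs_neg, abs_div, abs_of_pos ha, abs_of_nonneg (gH_nn ha z)]
  have h1 := gH_le0 ha z
  have h2 := sq_gH_le ha z
  have h : 0 ≤ (2 * π * a) ^ (-(N : ℝ) / 2) := by positivity
  have hz : |z i| ≤ 1 + ‖z‖ ^ 2 := by nlinarith [coord_le z i, sq_nonneg (‖z‖ - 1)]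
  have h3 : |z i| * gH N a z ≤ (1 + 2 * a) * (2 * π * a) ^ (-(N : ℝ) / 2) := by
    nlinarith [mul_le_mul_of_nonneg_right hz (gH_nn ha z)]
  calc |z i| / a * gH N a z = |z i| * gH N a z / a := by ring
    _ ≤ (1 + 2 * a) * (2 * π * a) ^ (-(N : ℝ) / 2) / a := by gcongr
    _ = ((1 + 2 * a) / a) * (2 * π * a) ^ (-(N : ℝ) / 2) := by ring
    _ ≤ _ := by
      unfold gB
      gcongr
      have : 0 ≤ 3 / a := by positivity
      linarith

lemma gDD_le {N : ℕ} (i : Fin N) {a : ℝ} (ha : 0 < a) (z : Evec N) : |gDD N a i z| ≤ gB N a := by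
  unfold gDD
  rw [abs_mul, abs_of_nonneg (gH_nn ha z)]
  have h1 := gH_le0 ha z
  have h2 := sq_gH_le ha z
  have h : 0 ≤ (2 * π * a) ^ (-(N : ℝ) / 2) := by positivity
  have hz : |z i ^ 2 / a ^ 2 - 1 / a| ≤ ‖z‖ ^ 2 / a ^ 2 + 1 / a := by
    have h4 : z i ^ 2 ≤ ‖z‖ ^ 2 := by
      rw [← sq_abs]; gcongr; exact coord_le z i
    have h5 : z i ^ 2 / a ^ 2 ≤ ‖z‖ ^ 2 / a ^ 2 := by gcongr
    have h6 : 0 ≤ z i ^ 2 / a ^ 2 := by positivity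
    have h7 : 0 < 1 / a := by positivity
    rw [abs_le]; constructor <;> linarith
  calc _ ≤ (‖z‖ ^ 2 / a ^ 2 + 1 / a) * gH N a z := by gcongr; exact gH_nn ha z
    _ = ‖z‖ ^ 2 * gH N a z / a ^ 2 + gH N a z / a := by ring
    _ ≤ 2 * a * (2 * π * a) ^ (-(N : ℝ) / 2) / a ^ 2 + (2 * π * a) ^ (-(N : ℝ) / 2) / a := by gcongr
    _ = (3 / a) * (2 * π * a) ^ (-(N : ℝ) / 2) := by field_simp; norm_num
    _ ≤ _ := by
      unfold gB
      gcongr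
      have : 0 ≤ (1 + 2 * a) / a := by positivity
      linarith

lemma gB_ev (N : ℕ) {a : ℝ} (ha : 0 < a) : ∀ᶠ b in 𝓝 a, 0 < b ∧ gB N b ≤ gB N a + 1 := by
  have hc : ContinuousAt (gB N) a := by
    unfold gB
    refine ContinuousAt.mul ?_ ?_
    · refine ((ContinuousAt.div (by fun_prop) (by fun_prop) ha.ne').add
        (ContinuousAt.div (by fun_prop) (by fun_prop) ha.ne')).add (by fun_prop)
    · refine ContinuousAt.rpow_const (by fun_prop) (Or.inl (by positivity))
  have h1 : ∀ᶠ b in 𝓝 a, gB N b < gB N a + 1 := hc.eventually (gt_mem_nhds (by linarith))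
  filter_upwards [h1, lt_mem_nhds ha] with b h1 h2 using ⟨h2, h1.le⟩

lemma gH_integral {N : ℕ} {a : ℝ} (ha : 0 < a) : ∫ z, gH N a z = 1 := by
  unfold gH
  rw [integral_const_mul]
  have h := GaussianFourier.integral_rexp_neg_mul_sq_norm (V := Evec N) (b := 1 / (2 * a)) (by positivity)
  have h2 : (fun z : Evec N => exp (-‖z‖ ^ 2 / (2 * a))) = fun z => exp (-(1 / (2 * a)) * ‖z‖ ^ 2) := by
    ext z; congr 1; field_simp
  rw [h2, h]
  have : π / (1 / (2 * a)) = 2 * π * a := by field_simp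
  rw [this, ← rpow_add (by positivity)]
  simp
  rw [neg_div, neg_add_cancel, rpow_zero]

lemma gH_int {N : ℕ} {a : ℝ} (ha : 0 < a) : Integrable (gH N a) := by
  by_contra h
  have := integral_undef h
  rw [gH_integral ha] at this
  exact one_ne_zero this

lemma sq_gH_int {N : ℕ} {a : ℝ} (ha : 0 < a) : Integrable (fun z => ‖z‖ ^ 2 * gH N a z) := by
  have h1 := (gH_int (N := N) (a := 2 * a) (by positivity)).const_mul
    (4 * a * (2 * π * a) ^ (-(N : ℝ) / 2) / (2 * π * (2 * a)) ^ (-(N : ℝ) / 2))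
  refine h1.mono' ?_ ?_
  · exact ((by fun_prop : Continuous fun z : Evec N => ‖z‖ ^ 2).mul (gH_cont ha)).aestronglyMeasurable
  · refine Eventually.of_forall fun z => ?_
    have := gH_nn ha z
    rw [norm_of_nonneg (by positivity)]
    unfold gH
    have h2 := sq_exp_le (a := 2 * a) (r := ‖z‖) (by positivity)
    have h3 : exp (-‖z‖ ^ 2 / (2 * a)) = exp (-‖z‖ ^ 2 / (2 * (2 * a))) * exp (-‖z‖ ^ 2 / (2 * (2 * a))) := by
      rw [← exp_add]; congr 1; field_simp; ring
    rw [h3]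
    have h4 : (2 * π * (2 * a)) ^ (-(N : ℝ) / 2) ≠ 0 := by positivity
    calc _ = (‖z‖ ^ 2 * exp (-‖z‖ ^ 2 / (2 * (2 * a)))) * ((2 * π * a) ^ (-(N : ℝ) / 2) * exp (-‖z‖ ^ 2 / (2 * (2 * a)))) := by ring
      _ ≤ (2 * (2 * a)) * ((2 * π * a) ^ (-(N : ℝ) / 2) * exp (-‖z‖ ^ 2 / (2 * (2 * a)))) := by gcongr
      _ = _ := by field_simp; norm_num

lemma coord_gH_int {N : ℕ} (i : Fin N) {a : ℝ} (ha : 0 < a) : Integrable (fun z => z i * gH N a z) := by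
  refine ((gH_int ha).add (sq_gH_int ha)).mono' ?_ ?_
  · exact ((by fun_prop : Continuous fun z : Evec N => z i).mul (gH_cont ha)).aestronglyMeasurable
  · refine Eventually.of_forall fun z => ?_
    have := gH_nn ha z
    rw [norm_mul, norm_of_nonneg this]
    have hz : ‖z i‖ ≤ 1 + ‖z‖ ^ 2 := by
      rw [Real.norm_eq_abs]; nlinarith [coord_le z i, sq_nonneg (‖z‖ - 1)]
    simp only [Pi.add_apply]
    nlinarith

lemma gD_int {N : ℕ} (i : Fin N) {a : ℝ} (ha : 0 < a) : Integrable (gD N a i) := by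
  have := (coord_gH_int i ha).const_mul (-(1 / a))
  refine this.congr (Eventually.of_forall fun z => ?_)
  simp only [gD]; ring

lemma gDD_int {N : ℕ} (i : Fin N) {a : ℝ} (ha : 0 < a) : Integrable (gDD N a i) := by
  refine (((sq_gH_int ha).const_mul (1 / a ^ 2)).add ((gH_int ha).const_mul (1 / a))).mono'
    (gDD_cont i ha).aestronglyMeasurable (Eventually.of_forall fun z => ?_)
  have := gH_nn ha z
  simp only [Pi.add_apply, gDD, norm_mul, norm_of_nonneg this]
  have h4 : z i ^ 2 ≤ ‖z‖ ^ 2 := by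
    rw [← sq_abs]; gcongr; exact coord_le z i
  have h5 : z i ^ 2 / a ^ 2 ≤ ‖z‖ ^ 2 / a ^ 2 := by gcongr
  have h6 : 0 ≤ z i ^ 2 / a ^ 2 := by positivity
  have h7 : 0 < 1 / a := by positivity
  have : ‖z i ^ 2 / a ^ 2 - 1 / a‖ ≤ ‖z‖ ^ 2 / a ^ 2 + 1 / a := by
    rw [Real.norm_eq_abs, abs_le]; constructor <;> linarith
  calc _ ≤ (‖z‖ ^ 2 / a ^ 2 + 1 / a) * gH N a z := by gcongr
    _ = _ := by ring

lemma gD_integral {N : ℕ} (i : Fin N) (a : ℝ) : ∫ z, gD N a i z = 0 := by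
  have h := integral_neg_eq_self (gD N a i) volume
  have h2 : (fun z => gD N a i (-z)) = fun z => - gD N a i z := by
    ext z; simp [gD, gH]; ring
  rw [h2, integral_neg] at h
  linarith

lemma coord_gH_integral {N : ℕ} (i : Fin N) {a : ℝ} (ha : 0 < a) : ∫ z, z i * gH N a z = 0 := by
  have h := gD_integral i (N := N) a
  have h2 : (fun z => gD N a i z) = fun z => -(1 / a) * (z i * gH N a z) := by
    ext z; simp only [gD]; ring
  rw [h2, integral_const_mul] at h
  have : -(1 / a) ≠ 0 := by simp [ha.ne']
  exact (mul_eq_zero.1 h).resolve_left this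

lemma gH_smul {N : ℕ} {a c : ℝ} (ha : 0 < a) (hc : 0 < c) (z : Evec N) :
    gH N a (c • z) = (c ^ N)⁻¹ * gH N (a / c ^ 2) z := by
  unfold gH
  have h1 : -‖c • z‖ ^ 2 / (2 * a) = -‖z‖ ^ 2 / (2 * (a / c ^ 2)) := by
    rw [norm_smul, norm_of_nonneg hc.le]; field_simp
  rw [h1, ← mul_assoc]
  congr 1
  have h2 : 2 * π * (a / c ^ 2) = (2 * π * a) * (c ^ 2)⁻¹ := by ring
  rw [h2, mul_rpow (x := 2 * π * a) (y := (c ^ 2)⁻¹) (by positivity) (by positivity)]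
  have h3 : ((c ^ 2)⁻¹ : ℝ) ^ (-(N : ℝ) / 2) = c ^ N := by
    rw [← rpow_natCast c 2, ← rpow_neg hc.le, ← rpow_mul hc.le, ← rpow_natCast c N]
    congr 1; push_cast; ring
  rw [h3]; field_simp

lemma gD_smul {N : ℕ} (i : Fin N) {a c : ℝ} (ha : 0 < a) (hc : 0 < c) (z : Evec N) :
    gD N a i (c • z) = (c ^ N)⁻¹ * c⁻¹ * gD N (a / c ^ 2) i z := by
  unfold gD
  rw [gH_smul ha hc]
  simp; field_simp

lemma gH_prod {N : ℕ} {a b : ℝ} (ha : 0 < a) (hb : 0 < b) (p q : Evec N) :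
    gH N a (p - q) * gH N b q = gH N (a + b) p * gH N (a * b / (a + b)) (q - (b / (a + b)) • p) := by
  unfold gH
  have h1 : exp (-‖p - q‖ ^ 2 / (2 * a)) * exp (-‖q‖ ^ 2 / (2 * b)) =
      exp (-‖p‖ ^ 2 / (2 * (a + b))) * exp (-‖q - (b / (a + b)) • p‖ ^ 2 / (2 * (a * b / (a + b)))) := by
    rw [← exp_add, ← exp_add]
    congr 1
    rw [norm_sub_sq_real, norm_sub_sq_real, norm_smul, inner_smul_right, real_inner_comm,
      norm_of_nonneg (by positivity)]
    field_simp; ring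
  have h2 : (2 * π * a) ^ (-(N : ℝ) / 2) * (2 * π * b) ^ (-(N : ℝ) / 2) =
      (2 * π * (a + b)) ^ (-(N : ℝ) / 2) * (2 * π * (a * b / (a + b))) ^ (-(N : ℝ) / 2) := by
    rw [← mul_rpow (by positivity) (by positivity), ← mul_rpow (by positivity) (by positivity)]
    congr 1; field_simp
  calc _ = ((2 * π * a) ^ (-(N : ℝ) / 2) * (2 * π * b) ^ (-(N : ℝ) / 2)) *
        (exp (-‖p - q‖ ^ 2 / (2 * a)) * exp (-‖q‖ ^ 2 / (2 * b))) := by ring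
    _ = _ := by rw [h1, h2]; ring

lemma gH_conv {N : ℕ} {a b : ℝ} (ha : 0 < a) (hb : 0 < b) (p : Evec N) :
    ∫ q, gH N a (p - q) * gH N b q = gH N (a + b) p := by
  simp_rw [gH_prod ha hb]
  rw [integral_const_mul, integral_sub_right_eq_self (gH N (a * b / (a + b))),
    gH_integral (by positivity), mul_one]

lemma gD_conv {N : ℕ} (i : Fin N) {a b : ℝ} (ha : 0 < a) (hb : 0 < b) (p : Evec N) :
    ∫ q, gH N a (p - q) * gD N b i q = gD N (a + b) i p := by
  have h1 : ∀ q : Evec N, gH N a (p - q) * gD N b i q =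
      (-(1 / b) * gH N (a + b) p) * (q i * gH N (a * b / (a + b)) (q - (b / (a + b)) • p)) := by
    intro q
    unfold gD
    linear_combination (-(q i / b)) * gH_prod ha hb p q
  simp_rw [h1]
  rw [integral_const_mul]
  have hc : 0 < a * b / (a + b) := by positivity
  have h2 : ∫ q : Evec N, q i * gH N (a * b / (a + b)) (q - (b / (a + b)) • p) =
      (b / (a + b)) * p i := by
    rw [← integral_add_right_eq_self _ ((b / (a + b)) • p)]
    simp only [add_sub_cancel_right, PiLp.add_apply, PiLp.smul_apply, smul_eq_mul, add_mul]
    rw [integral_add (coord_gH_int i hc) ((gH_int hc).const_mul _), coord_gH_integral i hc,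
      integral_const_mul, gH_integral hc]
    ring
  rw [h2]
  unfold gD
  field_simp

def gC (N : ℕ) (i : Fin N) : ℝ := ∫ z, |gD N 1 i z|

lemma gC_nn (N : ℕ) (i : Fin N) : 0 ≤ gC N i := integral_nonneg fun _ => abs_nonneg _

lemma gD_norm {N : ℕ} (i : Fin N) {a : ℝ} (ha : 0 < a) : ∫ z, |gD N a i z| = gC N i / √a := by
  have hs : 0 < √a := sqrt_pos.2 ha
  have h := Measure.integral_comp_smul (volume : Measure (Evec N)) (fun z => |gD N a i z|) (√a)
  have h2 : ∀ z : Evec N, |gD N a i (√a • z)| = ((√a ^ N)⁻¹ * (√a)⁻¹) * |gD N 1 i z| := by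
    intro z
    rw [gD_smul i ha hs, sq_sqrt ha.le, div_self ha.ne', abs_mul, abs_of_nonneg (by positivity)]
  simp_rw [h2] at h
  rw [integral_const_mul] at h
  simp only [finrank_euclideanSpace, Fintype.card_fin, smul_eq_mul] at h
  rw [abs_of_nonneg (by positivity)] at h
  have h3 : (√a ^ N)⁻¹ ≠ 0 := by positivity
  rw [mul_assoc] at h
  have := mul_left_cancel₀ h3 h
  rw [← this]; unfold gC; ring


lemma tendsto_int_mul {N : ℕ} {P : Type*} {l : Filter P} [l.IsCountablyGenerated]
    {k : P → Evec N → ℝ} {k0 : Evec N → ℝ} {g : P → Evec N → ℝ} {g0 : Evec N → ℝ} {M : ℝ}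
    (hkm : ∀ᶠ p in l, AEStronglyMeasurable (k p) volume)
    (hkb : ∀ᶠ p in l, ∀ w, |k p w| ≤ M)
    (hkt : ∀ᵐ w, Tendsto (fun p => k p w) l (𝓝 (k0 w)))
    (hg : ∀ᶠ p in l, Integrable (g p)) (hg0 : Integrable g0)
    (hgt : Tendsto (fun p => ∫ w, |g p w - g0 w|) l (𝓝 0)) :
    Tendsto (fun p => ∫ w, k p w * g p w) l (𝓝 (∫ w, k0 w * g0 w)) := by
  have h1 : Tendsto (fun p => ∫ w, k p w * g0 w) l (𝓝 (∫ w, k0 w * g0 w)) := by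
    refine tendsto_integral_filter_of_dominated_convergence (fun w => M * |g0 w|) ?_ ?_ ?_ ?_
    · filter_upwards [hkm] with p hp using hp.mul hg0.aestronglyMeasurable
    · filter_upwards [hkb] with p hp
      refine Eventually.of_forall fun w => ?_
      rw [norm_mul, Real.norm_eq_abs, Real.norm_eq_abs]
      exact mul_le_mul_of_nonneg_right (hp w) (abs_nonneg _)
    · exact hg0.abs.const_mul M
    · filter_upwards [hkt] with w hw using hw.mul_const _
  have h2 : Tendsto (fun p => (∫ w, k p w * g p w) - ∫ w, k p w * g0 w) l (𝓝 0) := by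
    refine squeeze_zero_norm' ?_ (by simpa using hgt.const_mul M)
    filter_upwards [hkm, hkb, hg] with p hm hb hg
    have i1 : Integrable (fun w => k p w * g p w) := hg.bdd_mul hm (c := M) (Eventually.of_forall hb)
    have i2 : Integrable (fun w => k p w * g0 w) := hg0.bdd_mul hm (c := M) (Eventually.of_forall hb)
    rw [← integral_sub i1 i2]
    refine (norm_integral_le_integral_norm _).trans ?_
    rw [← integral_const_mul]
    refine integral_mono (i1.sub i2).norm ((hg.sub hg0).abs.const_mul M) fun w => ?_
    simp only [Pi.sub_apply]
    rw [← mul_sub, norm_mul, Real.norm_eq_abs, Real.norm_eq_abs]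
    exact mul_le_mul_of_nonneg_right (hb w) (abs_nonneg _)
  simpa using h2.add h1

def cv {N : ℕ} (k : Evec N → ℝ) (c : ℝ) (g : Evec N → ℝ) (x : Evec N) : ℝ := ∫ v, k (x - c • v) * g v

lemma cv_tendsto {N : ℕ} {P : Type*} {l : Filter P} [l.IsCountablyGenerated]
    {kk : ℝ → Evec N → ℝ} (hc : ∀ q : ℝ × Evec N, 0 < q.1 → ContinuousAt (fun q : ℝ × Evec N => kk q.1 q.2) q)
    (hb : ∀ a, 0 < a → ∀ z, |kk a z| ≤ gB N a)
    {a c : P → ℝ} {a0 c0 : ℝ} {x : P → Evec N} {x0 : Evec N} {g : P → Evec N → ℝ} {g0 : Evec N → ℝ}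
    (ha0 : 0 < a0) (ha : Tendsto a l (𝓝 a0)) (hcc : Tendsto c l (𝓝 c0)) (hx : Tendsto x l (𝓝 x0))
    (hg : ∀ᶠ p in l, Integrable (g p)) (hg0 : Integrable g0)
    (hgt : Tendsto (fun p => ∫ w, |g p w - g0 w|) l (𝓝 0)) :
    Tendsto (fun p => cv (kk (a p)) (c p) (g p) (x p)) l (𝓝 (cv (kk a0) c0 g0 x0)) := by
  unfold cv
  have hev := ha.eventually (gB_ev N ha0)
  refine tendsto_int_mul (M := gB N a0 + 1) ?_ ?_ ?_ hg hg0 hgt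
  · filter_upwards [hev] with p hp
    have : Continuous (kk (a p)) := continuous_iff_continuousAt.2 fun z =>
      (hc (a p, z) hp.1).comp (f := fun z : Evec N => (a p, z)) (by fun_prop)
    exact (this.comp (by fun_prop)).aestronglyMeasurable
  · filter_upwards [hev] with p hp w
    exact (hb _ hp.1 _).trans hp.2
  · refine Eventually.of_forall fun w => ?_
    have h1 : Tendsto (fun p => (a p, x p - c p • w)) l (𝓝 (a0, x0 - c0 • w)) :=
      ha.prodMk_nhds (hx.sub (hcc.smul_const w))
    exact (hc (a0, x0 - c0 • w) ha0).tendsto.comp h1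

section cvk
variable {N : ℕ} {k k' : Evec N → ℝ} {M c : ℝ} {g : Evec N → ℝ}

lemma cv_integrand (hk : Continuous k) (hb : ∀ z, |k z| ≤ M) (hg : Integrable g) (x : Evec N) :
    Integrable (fun v => k (x - c • v) * g v) :=
  hg.bdd_mul (c := M) (hk.comp (by fun_prop)).aestronglyMeasurable (Eventually.of_forall fun _ => hb _)

lemma cv_bound (hb : ∀ z, |k z| ≤ M) (hg : Integrable g) (x : Evec N) :
    |cv k c g x| ≤ M * ∫ v, |g v| := by
  unfold cv
  refine (norm_integral_le_integral_norm (fun v => k (x - c • v) * g v)).trans ?_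
  rw [← integral_const_mul]
  refine integral_mono_of_nonneg (Eventually.of_forall fun _ => norm_nonneg _) (hg.abs.const_mul M)
    (Eventually.of_forall fun w => ?_)
  simp only [norm_mul, Real.norm_eq_abs]
  exact mul_le_mul_of_nonneg_right (hb _) (abs_nonneg _)

lemma cv_prod (hk : Continuous k) (hki : Integrable k) (hg : Integrable g) :
    Integrable (fun q : Evec N × Evec N => k (q.1 - c • q.2) * g q.2) (volume.prod volume) := by
  have hm : AEStronglyMeasurable (fun q : Evec N × Evec N => k (q.1 - c • q.2) * g q.2)
      (volume.prod volume) := by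
    have h1 : Continuous (fun q : Evec N × Evec N => k (q.1 - c • q.2)) := hk.comp (by fun_prop)
    exact h1.aestronglyMeasurable.mul hg.aestronglyMeasurable.comp_snd
  refine (integrable_prod_iff' hm).2 ⟨Eventually.of_forall fun v => ?_, ?_⟩
  · exact (hki.comp_sub_right (c • v)).mul_const (g v)
  · have : (fun v => ∫ x, ‖k (x - c • v) * g v‖) = fun v => (∫ z, ‖k z‖) * ‖g v‖ := by
      ext v
      simp only [norm_mul]
      rw [integral_mul_const, integral_sub_right_eq_self (fun z => ‖k z‖)]
    simp only [this]
    exact hg.norm.const_mul _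

lemma cv_int (hk : Continuous k) (hki : Integrable k) (hg : Integrable g) :
    Integrable (cv k c g) := (cv_prod hk hki hg).integral_prod_left

lemma cv_norm (hk : Continuous k) (hki : Integrable k) (hg : Integrable g) :
    ∫ x, |cv k c g x| ≤ (∫ z, |k z|) * ∫ v, |g v| := by
  have h := (cv_prod (c := c) hk hki hg)
  calc ∫ x, |cv k c g x| ≤ ∫ x, ∫ v, |k (x - c • v) * g v| := by
        refine integral_mono_of_nonneg (Eventually.of_forall fun _ => abs_nonneg _) h.norm.integral_prod_left
          (Eventually.of_forall fun w => ?_)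
        exact norm_integral_le_integral_norm (fun v => k (w - c • v) * g v)
    _ = ∫ v, ∫ x, |k (x - c • v) * g v| := by
        exact integral_integral_swap (f := fun x v => |k (x - c • v) * g v|) h.norm
    _ = _ := by
        simp only [abs_mul, integral_mul_const]
        simp only [integral_sub_right_eq_self (fun z => |k z|)]
        rw [integral_const_mul]

lemma cv_line {e : Evec N} (hd : ∀ z, HasLineDerivAt ℝ k (k' z) z e) (hk : Continuous k)
    (hk' : Continuous k') (hb : ∀ z, |k z| ≤ M) (hb' : ∀ z, |k' z| ≤ M) (hg : Integrable g) (x : Evec N) :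
    HasLineDerivAt ℝ (cv k c g) (cv k' c g x) x e := by
  unfold HasLineDerivAt
  unfold cv
  have h := hasDerivAt_integral_of_dominated_loc_of_deriv_le (μ := (volume : Measure (Evec N))) (𝕜 := ℝ)
    (F := fun t v => k (x + t • e - c • v) * g v) (F' := fun t v => k' (x + t • e - c • v) * g v)
    (x₀ := 0) (s := Set.univ) (bound := fun v => M * |g v|) univ_mem ?_ ?_ ?_ ?_ ?_ ?_
  · simpa using h.2
  · exact Eventually.of_forall fun t => (cv_integrand hk hb hg _).aestronglyMeasurable
  · exact cv_integrand hk hb hg _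
  · exact (cv_integrand hk' hb' hg _).aestronglyMeasurable
  · refine Eventually.of_forall fun v t _ => ?_
    rw [norm_mul]
    exact mul_le_mul_of_nonneg_right (hb' _) (abs_nonneg _)
  · exact hg.abs.const_mul M
  · refine Eventually.of_forall fun v t _ => ?_
    have h0 := hd (x + t • e - c • v)
    unfold HasLineDerivAt at h0
    have h1 : HasDerivAt (fun s : ℝ => s - t) 1 t := (hasDerivAt_id t).sub_const t
    have h2 := HasDerivAt.scomp_of_eq t h0 h1 (by simp)
    simp only [one_smul] at h2
    refine (h2.congr_of_eventuallyEq (Eventually.of_forall fun s => ?_)).mul_const _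
    simp only [Function.comp]
    congr 1
    module

end cvk

lemma gH_line {N : ℕ} (i : Fin N) {a : ℝ} (ha : 0 < a) (z : Evec N) :
    HasLineDerivAt ℝ (gH N a) (gD N a i z) z (EuclideanSpace.single i 1) := by
  unfold HasLineDerivAt
  have h0 : ∀ t : ℝ, gH N a (z + t • EuclideanSpace.single i 1) =
      (2 * π * a) ^ (-(N : ℝ) / 2) * exp (-(‖z‖ ^ 2 + 2 * t * z i + t ^ 2) / (2 * a)) := by
    intro t
    unfold gH
    rw [norm_add_sq_real, inner_smul_right, norm_smul, EuclideanSpace.inner_single_right]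
    simp; ring_nf; simp
  simp only [h0]
  have h1 : HasDerivAt (fun t : ℝ => -(‖z‖ ^ 2 + 2 * t * z i + t ^ 2) / (2 * a)) (-(z i / a)) 0 := by
    have := (((((hasDerivAt_id (0:ℝ)).const_mul 2).mul_const (z i)).const_add (‖z‖ ^ 2)).add
      ((hasDerivAt_id (0:ℝ)).pow 2)).neg.div_const (2 * a)
    refine (this.congr_of_eventuallyEq (Eventually.of_forall fun t => ?_)).congr_deriv ?_
    · simp
    · simp; field_simp
  refine (h1.exp.const_mul _).congr_deriv ?_
  unfold gD gH
  simp; ring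

lemma gD_line {N : ℕ} (i : Fin N) {a : ℝ} (ha : 0 < a) (z : Evec N) :
    HasLineDerivAt ℝ (gD N a i) (gDD N a i z) z (EuclideanSpace.single i 1) := by
  have h := gH_line i ha z
  unfold HasLineDerivAt at h ⊢
  unfold gD
  have h1 : HasDerivAt (fun t : ℝ => -((z + t • EuclideanSpace.single i (1:ℝ)) i / a)) (-(1 / a)) 0 := by
    simp
    have := (((hasDerivAt_id (0:ℝ)).const_add (z i)).div_const a).fun_neg
    simpa using this
  refine (h1.mul h).congr_deriv ?_
  simp [gDD, gD]; field_simp; ring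

lemma gH_time {N : ℕ} {a : ℝ} (ha : 0 < a) (z : Evec N) :
    HasDerivAt (fun a => gH N a z) (1 / 2 * ∑ i, gDD N a i z) a := by
  unfold gH
  have h1 : HasDerivAt (fun a : ℝ => (2 * π * a) ^ (-(N : ℝ) / 2))
      (2 * π * (-(N : ℝ) / 2) * (2 * π * a) ^ (-(N : ℝ) / 2 - 1)) a := by
    have := ((hasDerivAt_id a).const_mul (2 * π)).rpow_const (p := -(N : ℝ) / 2) (Or.inl (by simp; positivity))
    simpa using this
  have h2 : HasDerivAt (fun a : ℝ => -‖z‖ ^ 2 / (2 * a)) (‖z‖ ^ 2 / (2 * a ^ 2)) a := by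
    have := (hasDerivAt_const a (-‖z‖ ^ 2)).div ((hasDerivAt_id a).const_mul 2) (by simp; positivity)
    refine this.congr_deriv ?_
    simp; field_simp
  refine (h1.mul h2.exp).congr_deriv ?_
  unfold gDD
  rw [← Finset.sum_mul, Finset.sum_sub_distrib, ← Finset.sum_div]
  have h3 : ∑ i, z i ^ 2 = ‖z‖ ^ 2 := (EuclideanSpace.real_norm_sq_eq z).symm
  rw [h3, rpow_sub_one (by positivity)]
  unfold gH
  simp
  field_simp
  ring

lemma gH_cv_time {N : ℕ} {a c : ℝ} (ha : 0 < a) {g : Evec N → ℝ} (hg : Integrable g) (x : Evec N) :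
    HasDerivAt (fun a => cv (gH N a) c g x) (1 / 2 * ∑ i, cv (gDD N a i) c g x) a := by
  have hs := gB_ev N ha
  have h := hasDerivAt_integral_of_dominated_loc_of_deriv_le (μ := (volume : Measure (Evec N))) (𝕜 := ℝ)
    (F := fun b v => gH N b (x - c • v) * g v) (F' := fun b v => (1 / 2 * ∑ i, gDD N b i (x - c • v)) * g v)
    (x₀ := a) (s := {b | 0 < b ∧ gB N b ≤ gB N a + 1}) (bound := fun v => (1 / 2 * (N * (gB N a + 1))) * |g v|)
    hs ?_ ?_ ?_ ?_ ?_ ?_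
  · refine h.2.congr_deriv ?_
    unfold cv
    rw [← integral_finsetSum _ fun i _ => cv_integrand (gDD_cont i ha) (gDD_le i ha) hg x, ← integral_const_mul]
    congr 1; ext v; rw [mul_assoc, Finset.sum_mul]
  · filter_upwards [hs] with b hb using (cv_integrand (gH_cont hb.1) (gH_le hb.1) hg _).aestronglyMeasurable
  · exact cv_integrand (gH_cont ha) (gH_le ha) hg _
  · refine AEStronglyMeasurable.mul (Continuous.aestronglyMeasurable ?_) hg.aestronglyMeasurable
    exact continuous_const.mul (continuous_finsetSum _ fun i _ => (gDD_cont i ha).comp (by fun_prop))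
  · refine Eventually.of_forall fun v b hb => ?_
    rw [norm_mul, norm_mul]
    refine mul_le_mul_of_nonneg_right ?_ (abs_nonneg _)
    rw [norm_of_nonneg (by norm_num)]
    refine mul_le_mul_of_nonneg_left ?_ (by norm_num)
    refine (norm_sum_le _ _).trans ((Finset.sum_le_sum fun i _ => (gDD_le i hb.1 _).trans hb.2).trans ?_)
    simp [mul_add]
  · exact hg.abs.const_mul _
  · exact Eventually.of_forall fun v b hb => (gH_time hb.1 _).mul_const _


lemma cv_test {N : ℕ} {k ψ g : Evec N → ℝ} {B c : ℝ} (hψ : Continuous ψ) (hψb : ∀ x, |ψ x| ≤ B)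
    (hk : Continuous k) (hki : Integrable k) (hg : Integrable g) :
    ∫ x, ψ x * cv k c g x = ∫ w, (∫ x, ψ x * k (x - c • w)) * g w := by
  have h := cv_prod (c := c) hk hki hg
  have h1 : Integrable (fun q : Evec N × Evec N => ψ q.1 * (k (q.1 - c • q.2) * g q.2)) (volume.prod volume) := by
    refine h.bdd_mul (c := B) ?_ (Eventually.of_forall fun q => hψb q.1)
    exact (hψ.comp continuous_fst).aestronglyMeasurable
  have h2 := integral_integral_swap (f := fun x w => ψ x * (k (x - c • w) * g w)) h1
  unfold cv
  simp only [← integral_const_mul]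
  rw [h2]
  refine integral_congr_ae (Eventually.of_forall fun w => ?_)
  simp only [← mul_assoc]
  rw [integral_mul_const]

lemma integral_dil {N : ℕ} (h : Evec N → ℝ) (c : ℝ) (hc : 0 < c) :
    ∫ v, c ^ N * h (c • v) = ∫ x, h x := by
  rw [integral_const_mul, Measure.integral_comp_smul]
  simp only [finrank_euclideanSpace, Fintype.card_fin, smul_eq_mul]
  rw [abs_of_pos (by positivity), ← mul_assoc, mul_inv_cancel₀ (by positivity), one_mul]

lemma gauss_scaleH {N : ℕ} {η a c : ℝ} (hη : 0 < η) (ha : 0 < a) (hc : 0 < c) (X w : Evec N) :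
    ∫ x, gH N η (X - c • x) * gH N a (x - w) = gH N (η + c ^ 2 * a) (X - c • w) := by
  rw [← integral_add_right_eq_self _ w]
  have h1 : ∀ q : Evec N, gH N η (X - c • (q + w)) * gH N a (q + w - w) =
      (c ^ N)⁻¹ * (gH N (η / c ^ 2) ((c⁻¹ • X - w) - q) * gH N a q) := by
    intro q
    rw [add_sub_cancel_right, ← mul_assoc, ← gH_smul hη hc]
    congr 2
    rw [smul_sub, smul_sub, smul_smul, mul_inv_cancel₀ hc.ne', one_smul, smul_add]
    abel
  simp only [h1]
  rw [integral_const_mul, gH_conv (by positivity) ha]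
  have h2 : X - c • w = c • (c⁻¹ • X - w) := by
    rw [smul_sub, smul_smul, mul_inv_cancel₀ hc.ne', one_smul]
  rw [h2, gH_smul (by positivity) hc]
  congr 2
  field_simp

lemma gauss_scaleD {N : ℕ} (i : Fin N) {η a c : ℝ} (hη : 0 < η) (ha : 0 < a) (hc : 0 < c) (X w : Evec N) :
    ∫ x, gH N η (X - c • x) * gD N a i (x - w) = c * gD N (η + c ^ 2 * a) i (X - c • w) := by
  rw [← integral_add_right_eq_self _ w]
  have h1 : ∀ q : Evec N, gH N η (X - c • (q + w)) * gD N a i (q + w - w) =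
      (c ^ N)⁻¹ * (gH N (η / c ^ 2) ((c⁻¹ • X - w) - q) * gD N a i q) := by
    intro q
    rw [add_sub_cancel_right, ← mul_assoc, ← gH_smul hη hc]
    congr 2
    rw [smul_sub, smul_sub, smul_smul, mul_inv_cancel₀ hc.ne', one_smul, smul_add]
    abel
  simp only [h1]
  rw [integral_const_mul, gD_conv i (by positivity) ha]
  have h2 : X - c • w = c • (c⁻¹ • X - w) := by
    rw [smul_sub, smul_smul, mul_inv_cancel₀ hc.ne', one_smul]
  rw [h2, gD_smul i (by positivity) hc]
  have h3 : (η + c ^ 2 * a) / c ^ 2 = η / c ^ 2 + a := by field_simp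
  rw [h3]
  field_simp

def nu (t : ℝ) : ℝ := exp (2 * t) - 1

lemma nu_pos {t : ℝ} (ht : 0 < t) : 0 < nu t := by
  unfold nu; have := add_one_le_exp (2 * t); linarith

lemma nu_ge (t : ℝ) : 2 * t ≤ nu t := by
  unfold nu; have := add_one_le_exp (2 * t); linarith

lemma FP_eq {N : ℕ} (t : ℝ) (v w : Evec N) :
    FPkernel N t v w = exp t ^ N * gH N (nu t) (exp t • v - w) := by
  unfold FPkernel gH nu
  rw [← exp_nat_mul]; ring

lemma FP_grad {N : ℕ} {t : ℝ} (ht : 0 < t) (v w : Evec N) :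
    exp (-t) * @inner ℝ _ _ (gradient (fun u => FPkernel N t u w) v) w =
      exp t ^ N * ∑ i, gD N (nu t) i (exp t • v - w) * w i := by
  have hν := nu_pos ht
  set z := exp t • v - w with hz
  have hg : HasGradientAt (fun u => FPkernel N t u w)
      ((-(exp t ^ N * gH N (nu t) z * exp t / nu t)) • z) v := by
    rw [hasGradientAt_iff_hasFDerivAt]
    simp only [FP_eq]
    unfold gH
    have h1 : HasFDerivAt (fun u : Evec N => exp t • u - w) (exp t • ContinuousLinearMap.id ℝ (Evec N)) v :=
      ((hasFDerivAt_id v).const_smul (exp t)).sub_const w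
    have h2 := h1.norm_sq
    have h3 : HasFDerivAt (fun u : Evec N => -‖exp t • u - w‖ ^ 2 / (2 * nu t)) _ v :=
      (h2.fun_neg.mul_const (2 * nu t)⁻¹)
    have h4 := (((h3.exp).const_mul ((2 * π * nu t) ^ (-(N : ℝ) / 2))).const_mul (exp t ^ N))
    refine h4.congr_fderiv ?_
    ext y
    simp
    rw [← hz]
    field_simp
    rw [hz, inner_sub_left, inner_smul_left]
    simp
  rw [hg.gradient, inner_smul_left]
  have h5 : @inner ℝ _ _ z w = ∑ i, z i * w i := by
    simp [PiLp.inner_apply, mul_comm]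
  rw [h5]
  simp only [gD]
  rw [Finset.mul_sum, Finset.mul_sum, Finset.mul_sum]
  refine Finset.sum_congr rfl fun i _ => ?_
  simp
  have : exp (-t) * exp t = 1 := by rw [← exp_add]; simp
  field_simp
  linear_combination (z i * w i * gH N (nu t) z) * this

structure GoodF (N : ℕ) (T M C : ℝ) (f : ℝ → Evec N → ℝ) : Prop where
  hM : 0 ≤ M
  hC : 0 ≤ C
  int : ∀ s, Integrable (f s)
  bd : ∀ s, ∀ᵐ v, |f s v| ≤ M
  int1 : ∀ s, Integrable (fun v => ‖v‖ * f s v)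
  cont : ∀ s0, Tendsto (fun s => ∫ v, |f s v - f s0 v|) (𝓝 s0) (𝓝 0)
  cont1 : ∀ s0, Tendsto (fun s => ∫ v, ‖v‖ * |f s v - f s0 v|) (𝓝 s0) (𝓝 0)
  int2 : ∀ s, Integrable (fun v => ‖v‖ ^ 2 * f s v ^ 2)
  b0 : ∀ s, ∫ v, |f s v| ≤ C
  b1 : ∀ s, ∫ v, ‖v‖ * |f s v| ≤ C
  b2 : ∀ s, ∫ v, ‖v‖ ^ 2 * f s v ^ 2 ≤ C
  mild : ∀ t ∈ Set.Ioc (0 : ℝ) T, ∀ᵐ v : Evec N ∂volume,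
    f t v = (∫ w : Evec N, FPkernel N t v w * f 0 w) +
      ∫ s in Set.Ioc (0 : ℝ) t, exp (-(t - s)) *
        ∫ w : Evec N,
          (@inner ℝ _ _ (gradient (fun u => FPkernel N (t - s) u w) v) w) * (f s w) ^ 2

def gg {N : ℕ} (f : ℝ → Evec N → ℝ) (i : Fin N) (s : ℝ) (w : Evec N) : ℝ := w i * f s w ^ 2

section good
variable {N : ℕ} {T M C : ℝ} {f : ℝ → Evec N → ℝ}

lemma GoodF.gm (h : GoodF N T M C f) (i : Fin N) (s : ℝ) : AEStronglyMeasurable (gg f i s) volume := by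
  unfold gg
  have : Continuous fun w : Evec N => w i := by fun_prop
  exact this.aestronglyMeasurable.mul ((h.int s).aestronglyMeasurable.pow 2)

lemma GoodF.gle (h : GoodF N T M C f) (i : Fin N) (s : ℝ) : ∀ᵐ w, |gg f i s w| ≤ M * (‖w‖ * |f s w|) := by
  filter_upwards [h.bd s] with w hw
  unfold gg
  rw [abs_mul, abs_pow]
  calc |w i| * |f s w| ^ 2 = |w i| * |f s w| * |f s w| := by ring
    _ ≤ ‖w‖ * |f s w| * M := by gcongr; exact coord_le w i
    _ = _ := by ring

lemma GoodF.int1' (h : GoodF N T M C f) (s : ℝ) : Integrable (fun w => ‖w‖ * |f s w|) := by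
  have := (h.int1 s).abs
  simpa [abs_mul] using this

lemma GoodF.gint (h : GoodF N T M C f) (i : Fin N) (s : ℝ) : Integrable (gg f i s) :=
  ((h.int1' s).const_mul M).mono' (h.gm i s) (h.gle i s)

lemma GoodF.gnorm (h : GoodF N T M C f) (i : Fin N) (s : ℝ) : ∫ w, |gg f i s w| ≤ M * C := by
  refine (integral_mono_ae (h.gint i s).abs ((h.int1' s).const_mul M) (h.gle i s)).trans ?_
  rw [integral_const_mul]
  exact mul_le_mul_of_nonneg_left (h.b1 s) h.hM

lemma GoodF.gcont (h : GoodF N T M C f) (i : Fin N) (s0 : ℝ) :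
    Tendsto (fun s => ∫ w, |gg f i s w - gg f i s0 w|) (𝓝 s0) (𝓝 0) := by
  refine squeeze_zero (fun s => integral_nonneg fun w => abs_nonneg _) (fun s => ?_)
    (by simpa using (h.cont1 s0).const_mul (2 * M))
  rw [← integral_const_mul]
  have hi : Integrable (fun w => ‖w‖ * |f s w - f s0 w|) := by
    have := ((h.int1 s).sub (h.int1 s0)).abs
    refine this.congr (Eventually.of_forall fun w => ?_)
    simp only [Pi.sub_apply, ← mul_sub, abs_mul, abs_norm]
  refine integral_mono_ae ((h.gint i s).sub (h.gint i s0)).abs (hi.const_mul _) ?_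
  filter_upwards [h.bd s, h.bd s0] with w h1 h2
  unfold gg
  have : w i * f s w ^ 2 - w i * f s0 w ^ 2 = w i * ((f s w + f s0 w) * (f s w - f s0 w)) := by ring
  rw [this, abs_mul, abs_mul]
  have h3 : |f s w + f s0 w| ≤ 2 * M := (abs_add_le _ _).trans (by linarith)
  calc _ ≤ ‖w‖ * (2 * M * |f s w - f s0 w|) := by gcongr; exact coord_le w i
    _ = _ := by ring

end good


section good
variable {N : ℕ} {T M C : ℝ} {f : ℝ → Evec N → ℝ}

def DD (f : ℝ → Evec N → ℝ) (t s : ℝ) (v : Evec N) : ℝ :=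
  ∑ i, exp (t - s) ^ N * cv (gD N (nu (t - s)) i) 1 (gg f i s) (exp (t - s) • v)

lemma GoodF.mild' (h : GoodF N T M C f) {t : ℝ} (ht : t ∈ Set.Ioc (0 : ℝ) T) :
    ∀ᵐ v, f t v = exp t ^ N * cv (gH N (nu t)) 1 (f 0) (exp t • v) + ∫ s in Set.Ioo 0 t, DD f t s v := by
  filter_upwards [h.mild t ht] with v hv
  rw [hv]
  congr 1
  · unfold cv
    rw [← integral_const_mul]
    simp only [FP_eq, one_smul, mul_assoc]
  · rw [integral_Ioc_eq_integral_Ioo]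
    refine setIntegral_congr_fun measurableSet_Ioo fun s hs => ?_
    have hτ : 0 < t - s := by linarith [hs.2]
    simp only [DD, cv, one_smul]
    rw [← Finset.mul_sum, ← integral_finsetSum]
    · rw [← integral_const_mul, ← integral_const_mul]
      refine integral_congr_ae (Eventually.of_forall fun w => ?_)
      simp only
      rw [← mul_assoc, FP_grad hτ, mul_assoc, Finset.sum_mul]
      simp only [gg, mul_assoc]
    · intro i _
      have := cv_integrand (c := 1) (gD_cont i (nu_pos hτ)) (gD_le i (nu_pos hτ)) (h.gint i s) (exp (t - s) • v)
      simpa using this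

lemma GoodF.DD_cont (h : GoodF N T M C f) (t : ℝ) :
    ContinuousOn (fun q : ℝ × Evec N => DD f t q.1 q.2) (Set.Ioo 0 t ×ˢ Set.univ) := by
  intro q hq
  refine ContinuousAt.continuousWithinAt ?_
  have hτ : 0 < t - q.1 := by linarith [hq.1.2]
  unfold DD
  refine tendsto_finsetSum _ fun i _ => ?_
  refine Tendsto.mul ?_ ?_
  · exact ContinuousAt.tendsto (by fun_prop)
  · refine cv_tendsto (kk := fun a => gD N a i) (fun q hq => gD_contAt i hq) (fun a ha => gD_le i ha) (nu_pos hτ)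
      (a := fun q : ℝ × Evec N => nu (t - q.1)) (c := fun _ => 1) (g := fun q : ℝ × Evec N => gg f i q.1)
      (x := fun q : ℝ × Evec N => exp (t - q.1) • q.2)
      ?_ tendsto_const_nhds ?_ (Eventually.of_forall fun p => h.gint i p.1) (h.gint i q.1) ?_
    · unfold nu; exact ContinuousAt.tendsto (by fun_prop)
    · exact ContinuousAt.tendsto (f := fun q : ℝ × Evec N => exp (t - q.1) • q.2) (by fun_prop)
    · exact (h.gcont i q.1).comp continuousAt_fst

lemma integrable_dil {c : ℝ} (hc : 0 < c) {k : Evec N → ℝ} (hk : Integrable k) :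
    Integrable (fun v => c ^ N * k (c • v)) := (hk.comp_smul hc.ne').const_mul _

lemma GoodF.DD_int1 (h : GoodF N T M C f) {t s : ℝ} (hs : s < t) : Integrable (DD f t s) := by
  have hτ : 0 < t - s := by linarith
  unfold DD
  refine integrable_finsetSum _ fun i _ => ?_
  exact integrable_dil (exp_pos _) (cv_int (gD_cont i (nu_pos hτ)) (gD_int i (nu_pos hτ)) (h.gint i s))

lemma GoodF.DD_norm (h : GoodF N T M C f) {t s : ℝ} (hs : s < t) :
    ∫ v, |DD f t s v| ≤ (∑ i, gC N i) * (M * C) * (t - s) ^ (-(1/2) : ℝ) := by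
  have hτ : 0 < t - s := by linarith
  have hν := nu_pos hτ
  have hI : ∀ i, Integrable (cv (gD N (nu (t - s)) i) 1 (gg f i s)) := fun i =>
    cv_int (gD_cont i hν) (gD_int i hν) (h.gint i s)
  calc ∫ v, |DD f t s v| ≤ ∫ v, ∑ i, exp (t - s) ^ N * |cv (gD N (nu (t - s)) i) 1 (gg f i s) (exp (t - s) • v)| := by
        refine integral_mono (h.DD_int1 hs).abs
          (integrable_finsetSum _ fun i _ => integrable_dil (exp_pos _) (hI i).abs) fun v => ?_
        simp only [DD]
        refine (Finset.abs_sum_le_sum_abs _ _).trans (Finset.sum_le_sum fun i _ => ?_)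
        rw [abs_mul, abs_of_pos (by positivity)]
    _ = ∑ i, ∫ x, |cv (gD N (nu (t - s)) i) 1 (gg f i s) x| := by
        rw [integral_finsetSum _ fun i _ => integrable_dil (exp_pos _) (hI i).abs]
        refine Finset.sum_congr rfl fun i _ => ?_
        exact integral_dil (fun x => |cv (gD N (nu (t - s)) i) 1 (gg f i s) x|) _ (exp_pos _)
    _ ≤ ∑ i, gC N i * ((M * C) * (t - s) ^ (-(1/2) : ℝ)) := by
        refine Finset.sum_le_sum fun i _ => ?_
        refine (cv_norm (gD_cont i hν) (gD_int i hν) (h.gint i s)).trans ?_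
        rw [gD_norm i hν]
        have h1 : (√(nu (t - s)))⁻¹ ≤ (t - s) ^ (-(1/2) : ℝ) := by
          rw [rpow_neg hτ.le, ← sqrt_eq_rpow]
          have := nu_ge (t - s)
          gcongr
          linarith
        have := h.gnorm i s
        have := gC_nn N i
        have : 0 ≤ M * C := mul_nonneg h.hM h.hC
        calc gC N i / √(nu (t - s)) * ∫ v, |gg f i s v|
            ≤ gC N i / √(nu (t - s)) * (M * C) := by gcongr
          _ = gC N i * ((M * C) * (√(nu (t - s)))⁻¹) := by ring
          _ ≤ _ := by gcongr
    _ = _ := by rw [← Finset.sum_mul]; ring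

lemma GoodF.DD_prod (h : GoodF N T M C f) {t : ℝ} (ht : 0 < t) :
    Integrable (fun q : ℝ × Evec N => DD f t q.1 q.2) ((volume.restrict (Set.Ioo 0 t)).prod volume) := by
  have hm : AEStronglyMeasurable (fun q : ℝ × Evec N => DD f t q.1 q.2)
      ((volume.restrict (Set.Ioo 0 t)).prod volume) := by
    have := (h.DD_cont t).aestronglyMeasurable (μ := (volume : Measure ℝ).prod (volume : Measure (Evec N)))
      (measurableSet_Ioo.prod MeasurableSet.univ)
    rwa [← Measure.prod_restrict, Measure.restrict_univ] at this
  refine (integrable_prod_iff hm).2 ⟨?_, ?_⟩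
  · refine (ae_restrict_iff' measurableSet_Ioo).2 (Eventually.of_forall fun s hs => h.DD_int1 hs.2)
  · have hi : IntegrableOn (fun s : ℝ => (∑ i, gC N i) * (M * C) * (t - s) ^ (-(1/2) : ℝ)) (Set.Ioo 0 t) := by
      refine Integrable.const_mul ?_ _
      have h1 : IntervalIntegrable (fun s : ℝ => s ^ (-(1/2) : ℝ)) volume 0 t :=
        intervalIntegral.intervalIntegrable_rpow' (by norm_num)
      have h2 := (h1.comp_sub_left t)
      simp only [sub_zero, sub_self] at h2
      exact ((intervalIntegrable_iff_integrableOn_Ioo_of_le ht.le).1 h2.symm)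
    refine hi.mono' hm.norm.integral_prod_right' ?_
    refine (ae_restrict_iff' measurableSet_Ioo).2 (Eventually.of_forall fun s hs => ?_)
    rw [norm_of_nonneg (integral_nonneg fun _ => norm_nonneg _)]
    exact h.DD_norm hs.2

lemma GoodF.tested (h : GoodF N T M C f) {t : ℝ} (ht : t ∈ Set.Ioc (0 : ℝ) T) {φ : Evec N → ℝ} {B : ℝ}
    (hφ : Continuous φ) (hB : ∀ v, |φ v| ≤ B) :
    ∫ v, φ v * f t v = (∫ w, (∫ x, φ ((exp t)⁻¹ • x) * gH N (nu t) (x - w)) * f 0 w) +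
      ∫ s in (0:ℝ)..t, ∑ i, ∫ w, (∫ x, φ ((exp (t - s))⁻¹ • x) * gD N (nu (t - s)) i (x - w)) * gg f i s w := by
  have hν := nu_pos ht.1
  have hP := h.DD_prod ht.1
  have hP2 : Integrable (fun q : ℝ × Evec N => φ q.2 * DD f t q.1 q.2)
      ((volume.restrict (Set.Ioo 0 t)).prod volume) :=
    hP.bdd_mul (c := B) (hφ.comp continuous_snd).aestronglyMeasurable (Eventually.of_forall fun q => hB q.2)
  have key : ∀ (k g : Evec N → ℝ) (τ : ℝ), Continuous k → Integrable k → Integrable g →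
      ∫ v, φ v * (exp τ ^ N * cv k 1 g (exp τ • v)) =
        ∫ w, (∫ x, φ ((exp τ)⁻¹ • x) * k (x - w)) * g w := by
    intro k g τ hk hki hg
    have h1 := integral_dil (fun x => φ ((exp τ)⁻¹ • x) * cv k 1 g x) (exp τ) (exp_pos τ)
    have h2 := cv_test (c := 1) (ψ := fun x => φ ((exp τ)⁻¹ • x)) (hφ.comp (by fun_prop)) (fun x => hB _) hk hki hg
    simp only [one_smul] at h2
    rw [← h2, ← h1]
    refine integral_congr_ae (Eventually.of_forall fun v => ?_)
    simp only [smul_smul]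
    rw [inv_mul_cancel₀ (exp_pos τ).ne', one_smul]; ring
  have keyi : ∀ (k g : Evec N → ℝ) (τ : ℝ), Continuous k → Integrable k → Integrable g →
      Integrable (fun v => φ v * (exp τ ^ N * cv k 1 g (exp τ • v))) := by
    intro k g τ hk hki hg
    exact (integrable_dil (exp_pos τ) (cv_int hk hki hg)).bdd_mul (c := B) hφ.aestronglyMeasurable
      (Eventually.of_forall fun v => hB v)
  have e1 : ∫ v, φ v * f t v = ∫ v, (φ v * (exp t ^ N * cv (gH N (nu t)) 1 (f 0) (exp t • v)) +
      ∫ s in Set.Ioo 0 t, φ v * DD f t s v) := by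
    refine integral_congr_ae ?_
    filter_upwards [h.mild' ht] with v hv
    rw [hv, mul_add, integral_const_mul]
  rw [e1, integral_add (keyi _ _ _ (gH_cont hν) (gH_int hν) (h.int 0)) hP2.integral_prod_right,
    key _ _ _ (gH_cont hν) (gH_int hν) (h.int 0)]
  congr 1
  rw [intervalIntegral.integral_of_le ht.1.le, integral_Ioc_eq_integral_Ioo]
  rw [← integral_integral_swap (f := fun s v => φ v * DD f t s v) hP2]
  refine setIntegral_congr_fun measurableSet_Ioo fun s hs => ?_
  have hν' := nu_pos (sub_pos.2 hs.2)
  simp only [DD, Finset.mul_sum]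
  rw [integral_finsetSum _ fun i _ => keyi _ _ _ (gD_cont i hν') (gD_int i hν') (h.gint i s)]
  exact Finset.sum_congr rfl fun i _ => key _ _ _ (gD_cont i hν') (gD_int i hν') (h.gint i s)

lemma GoodF.mass (h : GoodF N T M C f) {t : ℝ} (ht : t ∈ Set.Icc (0 : ℝ) T) : ∫ v, f t v = ∫ v, f 0 v := by
  rcases ht.1.eq_or_lt with h0 | h0
  · rw [← h0]
  have := h.tested ⟨h0, ht.2⟩ (φ := fun _ => 1) (B := 1) continuous_const (by simp)
  simp only [one_mul] at this
  rw [this]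
  simp only [integral_sub_right_eq_self (gH N (nu t)), gH_integral (nu_pos h0), one_mul]
  have h2 : ∀ s i w, ∫ x, gD N (nu (t - s)) i (x - w) = 0 := fun s i w => by
    rw [integral_sub_right_eq_self (gD N (nu (t - s)) i), gD_integral]
  simp [h2]

def VV (f : ℝ → Evec N → ℝ) (a s : ℝ) (x : Evec N) : ℝ :=
  ∑ i, exp s * cv (gD N a i) (exp s) (gg f i s) x

def uu (f : ℝ → Evec N → ℝ) (η t : ℝ) (x : Evec N) : ℝ := cv (gH N η) (exp t) (f t) x

lemma GoodF.duhamel (h : GoodF N T M C f) {t η : ℝ} (ht : t ∈ Set.Icc (0 : ℝ) T) (hη : 0 < η) (X : Evec N) :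
    uu f η t X = cv (gH N (η + (exp (2 * t) - 1))) 1 (f 0) X +
      ∫ s in (0:ℝ)..t, VV f (η + (exp (2 * t) - exp (2 * s))) s X := by
  rcases ht.1.eq_or_lt with h0 | h0
  · rw [← h0]; simp [uu]
  have := h.tested ⟨h0, ht.2⟩ (φ := fun v => gH N η (X - exp t • v)) (B := gB N η)
    ((gH_cont hη).comp (by fun_prop)) (fun v => gH_le hη _)
  unfold uu
  rw [show cv (gH N η) (exp t) (f t) X = ∫ v, gH N η (X - exp t • v) * f t v from rfl, this]
  congr 1
  · unfold cv
    refine integral_congr_ae (Eventually.of_forall fun w => ?_)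
    simp only
    congr 1
    have := gauss_scaleH (N := N) hη (nu_pos h0) one_pos X w
    simp only [smul_smul, mul_inv_cancel₀ (exp_pos t).ne']
    rw [this]; simp [nu]
  · refine intervalIntegral.integral_congr_Ioo_of_le h0.le fun s hs => ?_
    simp only [VV]
    refine Finset.sum_congr rfl fun i _ => ?_
    unfold cv
    rw [← integral_const_mul]
    refine integral_congr_ae (Eventually.of_forall fun w => ?_)
    simp only
    have := gauss_scaleD (N := N) i hη (nu_pos (sub_pos.2 hs.2)) (exp_pos s) X w
    have h1 : exp t * (exp (t - s))⁻¹ = exp s := by rw [← exp_neg, ← exp_add]; congr 1; ring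
    have h2 : exp s ^ 2 * nu (t - s) = exp (2 * t) - exp (2 * s) := by
      unfold nu
      rw [mul_sub, ← exp_nat_mul, ← exp_add, mul_one]
      congr 2; push_cast; ring
    simp only [smul_smul, h1]
    rw [this, h2, mul_assoc]

lemma GoodF.VV_cont (h : GoodF N T M C f) {q : ℝ × ℝ × Evec N} (hq : 0 < q.1) :
    ContinuousAt (fun q : ℝ × ℝ × Evec N => VV f q.1 q.2.1 q.2.2) q := by
  unfold VV
  refine tendsto_finsetSum _ fun i _ => ?_
  refine Tendsto.mul ?_ ?_
  · exact ContinuousAt.tendsto (f := fun q : ℝ × ℝ × Evec N => exp q.2.1) (by fun_prop)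
  · refine cv_tendsto (kk := fun a => gD N a i) (fun q hq => gD_contAt i hq) (fun a ha => gD_le i ha) hq
      (a := fun q : ℝ × ℝ × Evec N => q.1) (c := fun q => exp q.2.1) (g := fun q : ℝ × ℝ × Evec N => gg f i q.2.1)
      (x := fun q : ℝ × ℝ × Evec N => q.2.2)
      continuousAt_fst ?_ ?_ (Eventually.of_forall fun p => h.gint i p.2.1) (h.gint i q.2.1) ?_
    · exact ContinuousAt.tendsto (f := fun q : ℝ × ℝ × Evec N => exp q.2.1) (by fun_prop)
    · exact ContinuousAt.tendsto (f := fun q : ℝ × ℝ × Evec N => q.2.2) (by fun_prop)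
    · exact (h.gcont i q.2.1).comp (ContinuousAt.tendsto (f := fun q : ℝ × ℝ × Evec N => q.2.1) (by fun_prop))

lemma GoodF.cvf_cont (h : GoodF N T M C f) {kk : ℝ → Evec N → ℝ}
    (hc : ∀ q : ℝ × Evec N, 0 < q.1 → ContinuousAt (fun q : ℝ × Evec N => kk q.1 q.2) q)
    (hb : ∀ a, 0 < a → ∀ z, |kk a z| ≤ gB N a) {η : ℝ} (hη : 0 < η) :
    Continuous (fun q : ℝ × Evec N => cv (kk η) (exp q.1) (f q.1) q.2) := by
  refine continuous_iff_continuousAt.2 fun q => ?_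
  refine cv_tendsto (kk := kk) hc hb hη (a := fun _ => η) (c := fun q : ℝ × Evec N => exp q.1)
    (g := fun q : ℝ × Evec N => f q.1) (x := fun q : ℝ × Evec N => q.2) tendsto_const_nhds ?_ continuousAt_snd
    (Eventually.of_forall fun p => h.int p.1) (h.int q.1) ((h.cont q.1).comp continuousAt_fst)
  exact ContinuousAt.tendsto (f := fun q : ℝ × Evec N => exp q.1) (by fun_prop)

lemma GoodF.cvg_cont (h : GoodF N T M C f) (j : Fin N) {kk : ℝ → Evec N → ℝ}
    (hc : ∀ q : ℝ × Evec N, 0 < q.1 → ContinuousAt (fun q : ℝ × Evec N => kk q.1 q.2) q)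
    (hb : ∀ a, 0 < a → ∀ z, |kk a z| ≤ gB N a) {η : ℝ} (hη : 0 < η) :
    Continuous (fun q : ℝ × Evec N => cv (kk η) (exp q.1) (gg f j q.1) q.2) := by
  refine continuous_iff_continuousAt.2 fun q => ?_
  refine cv_tendsto (kk := kk) hc hb hη (a := fun _ => η) (c := fun q : ℝ × Evec N => exp q.1)
    (g := fun q : ℝ × Evec N => gg f j q.1) (x := fun q : ℝ × Evec N => q.2) tendsto_const_nhds ?_ continuousAt_snd
    (Eventually.of_forall fun p => h.gint j p.1) (h.gint j q.1) ((h.gcont j q.1).comp continuousAt_fst)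
  exact ContinuousAt.tendsto (f := fun q : ℝ × Evec N => exp q.1) (by fun_prop)

lemma GoodF.VV_ii (h : GoodF N T M C f) {η t : ℝ} (hη : 0 < η) (x : Evec N) {a b : ℝ} (ha : a ≤ t) (hb : b ≤ t) :
    IntervalIntegrable (fun s => VV f (η + (exp (2 * t) - exp (2 * s))) s x) volume a b := by
  refine ContinuousOn.intervalIntegrable fun s hs => ContinuousAt.continuousWithinAt ?_
  have hs' : s ≤ t := hs.2.trans (max_le ha hb)
  have h1 : exp (2 * s) ≤ exp (2 * t) := exp_le_exp.2 (by linarith)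
  exact ContinuousAt.comp (f := fun s : ℝ => (η + (exp (2 * t) - exp (2 * s)), s, x))
    (g := fun q : ℝ × ℝ × Evec N => VV f q.1 q.2.1 q.2.2)
    (h.VV_cont (q := (η + (exp (2 * t) - exp (2 * s)), s, x)) (by simp only; linarith))
    (by fun_prop)

lemma GoodF.restart (h : GoodF N T M C f) {t t' η : ℝ} (ht : 0 ≤ t) (htt : t ≤ t') (ht' : t' ≤ T) (hη : 0 < η)
    (X : Evec N) :
    uu f η t' X = cv (gH N (η + (exp (2 * t') - exp (2 * t)))) (exp t) (f t) X +
      ∫ s in t..t', VV f (η + (exp (2 * t') - exp (2 * s))) s X := by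
  have h1 : exp (2 * t) ≤ exp (2 * t') := exp_le_exp.2 (by linarith)
  have e1 := h.duhamel (t := t') ⟨ht.trans htt, ht'⟩ hη X
  have e2 := h.duhamel (t := t) (η := η + (exp (2 * t') - exp (2 * t))) ⟨ht, htt.trans ht'⟩ (by linarith) X
  unfold uu at e2
  rw [e1, e2, ← intervalIntegral.integral_add_adjacent_intervals (h.VV_ii hη X (ht.trans htt) htt)
    (h.VV_ii hη X htt le_rfl)]
  rw [← add_assoc]
  congr 2
  · congr 2; ring
  · refine intervalIntegral.integral_congr fun s _ => ?_
    congr 1; ring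

lemma deriv_diag {G : ℝ → ℝ → ℝ} {t : ℝ} (hG : ContinuousAt (fun q : ℝ × ℝ => G q.1 q.2) (t, t))
    (hi : ∀ᶠ t' in 𝓝[>] t, IntervalIntegrable (G t') volume t t') :
    HasDerivWithinAt (fun t' => ∫ s in t..t', G t' s) (G t t) (Set.Ioi t) t := by
  rw [hasDerivWithinAt_iff_isLittleO, Asymptotics.isLittleO_iff]
  intro ε hε
  have h1 := Metric.continuousAt_iff.1 hG ε hε
  obtain ⟨δ, hδ, hd⟩ := h1
  filter_upwards [hi, Ioo_mem_nhdsGT (show t < t + δ by linarith)] with t' hii ht'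
  rw [intervalIntegral.integral_same, sub_zero, smul_eq_mul]
  have e : (t' - t) * G t t = ∫ s in t..t', G t t := by simp
  rw [e, ← intervalIntegral.integral_sub hii (by simp)]
  refine intervalIntegral.norm_integral_le_of_norm_le_const fun s hs => ?_
  rw [Set.uIoc_of_le ht'.1.le] at hs
  have := @hd (t', s) (by
    rw [Prod.dist_eq, max_lt_iff, Real.dist_eq, Real.dist_eq, abs_lt, abs_lt]
    simp only
    have := ht'.1; have := ht'.2; have := hs.1; have := hs.2
    refine ⟨⟨?_, ?_⟩, ?_, ?_⟩ <;> linarith)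
  exact this.le

def RR (f : ℝ → Evec N → ℝ) (η t : ℝ) (x : Evec N) : ℝ :=
  ∑ i, (exp (2 * t) * cv (gDD N η i) (exp t) (f t) x + exp t * cv (gD N η i) (exp t) (gg f i t) x)

lemma GoodF.uderiv (h : GoodF N T M C f) {t η : ℝ} (ht : t ∈ Set.Ico 0 T) (hη : 0 < η) (x : Evec N) :
    HasDerivWithinAt (fun t' => uu f η t' x) (RR f η t x) (Set.Ioi t) t := by
  have d1 : HasDerivAt (fun t' => η + (exp (2 * t') - exp (2 * t))) (2 * exp (2 * t)) t := by
    have := ((((hasDerivAt_id t).const_mul 2).exp).sub_const (exp (2 * t))).const_add η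
    refine this.congr_deriv ?_
    simp; ring
  have d2 := HasDerivAt.comp_of_eq (h₂ := fun a => cv (gH N a) (exp t) (f t) x) t (gH_cv_time (c := exp t) hη (h.int t) x) d1 (by simp)
  have d3 := deriv_diag (G := fun t' s => VV f (η + (exp (2 * t') - exp (2 * s))) s x) (t := t) ?_ ?_
  · have d4 := d2.hasDerivWithinAt.add d3
    refine (d4.congr_of_eventuallyEq ?_ ?_).congr_deriv ?_
    · filter_upwards [Ioo_mem_nhdsGT ht.2] with t' ht'
      exact h.restart ht.1 ht'.1.le ht'.2.le hη x
    · exact h.restart ht.1 le_rfl ht.2.le hη x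
    · simp only [RR, VV, sub_self, add_zero, Finset.sum_add_distrib, Finset.mul_sum, Finset.sum_mul]
      congr 1
      refine Finset.sum_congr rfl fun i _ => by ring
  · exact ContinuousAt.comp (f := fun q : ℝ × ℝ => (η + (exp (2 * q.1) - exp (2 * q.2)), q.2, x))
      (g := fun q : ℝ × ℝ × Evec N => VV f q.1 q.2.1 q.2.2)
      (h.VV_cont (q := (η + (exp (2 * t) - exp (2 * t)), t, x)) (by simpa using hη))
      (by fun_prop)
  · filter_upwards [self_mem_nhdsWithin] with t' ht'
    exact h.VV_ii hη x (le_of_lt ht') le_rfl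

end good


def jj (δ y : ℝ) : ℝ := √(y ^ 2 + δ ^ 2) - δ
def jd (δ y : ℝ) : ℝ := y / √(y ^ 2 + δ ^ 2)
def jdd (δ y : ℝ) : ℝ := δ ^ 2 / √(y ^ 2 + δ ^ 2) ^ 3

section jlem
variable {δ : ℝ}

lemma jroot_pos (hδ : 0 < δ) (y : ℝ) : 0 < √(y ^ 2 + δ ^ 2) := sqrt_pos.2 (by positivity)

lemma jroot_ge (y : ℝ) : δ ≤ √(y ^ 2 + δ ^ 2) := by
  apply le_sqrt_of_sq_le; nlinarith [sq_nonneg y]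

lemma jroot_ge' (y : ℝ) : |y| ≤ √(y ^ 2 + δ ^ 2) := by
  apply le_sqrt_of_sq_le; rw [sq_abs]; nlinarith [sq_nonneg δ]

lemma jroot_sq (y : ℝ) : √(y ^ 2 + δ ^ 2) ^ 2 = y ^ 2 + δ ^ 2 := sq_sqrt (by positivity)

lemma jroot_deriv (hδ : 0 < δ) (y : ℝ) : HasDerivAt (fun y => √(y ^ 2 + δ ^ 2)) (jd δ y) y := by
  have := (((hasDerivAt_id y).pow 2).add_const (δ ^ 2)).sqrt (by simp; positivity)
  refine this.congr_deriv ?_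
  simp [jd]
  have := jroot_pos hδ y
  field_simp

lemma jj_deriv (hδ : 0 < δ) (y : ℝ) : HasDerivAt (jj δ) (jd δ y) y := (jroot_deriv hδ y).sub_const δ

lemma jd_deriv (hδ : 0 < δ) (y : ℝ) : HasDerivAt (jd δ) (jdd δ y) y := by
  have hp := jroot_pos hδ y
  have := (hasDerivAt_id y).div (jroot_deriv hδ y) hp.ne'
  refine this.congr_deriv ?_
  simp [jd, jdd]
  field_simp
  rw [jroot_sq]; ring

lemma jj_cont : Continuous (jj δ) := by unfold jj; fun_prop
lemma jd_cont (hδ : 0 < δ) : Continuous (jd δ) := by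
  unfold jd; exact continuous_id.div (by fun_prop) fun y => (jroot_pos hδ y).ne'
lemma jdd_cont (hδ : 0 < δ) : Continuous (jdd δ) := by
  unfold jdd; exact continuous_const.div (by fun_prop) fun y => (pow_pos (jroot_pos hδ y) 3).ne'

lemma jj_nn (y : ℝ) : 0 ≤ jj δ y := by unfold jj; linarith [jroot_ge (δ := δ) y]

lemma jj_le (hδ : 0 < δ) (y : ℝ) : jj δ y ≤ |y| := by
  unfold jj
  have : √(y ^ 2 + δ ^ 2) ≤ |y| + δ := by
    apply sqrt_le_iff.2
    refine ⟨by positivity, ?_⟩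
    nlinarith [sq_abs y, abs_nonneg y, mul_nonneg (abs_nonneg y) hδ.le]
  linarith

lemma jj_ge (y : ℝ) : |y| - δ ≤ jj δ y := by unfold jj; linarith [jroot_ge' (δ := δ) y]

lemma jd_le (hδ : 0 < δ) (y : ℝ) : |jd δ y| ≤ 1 := by
  unfold jd
  rw [abs_div, abs_of_pos (jroot_pos hδ y), div_le_one (jroot_pos hδ y)]
  exact jroot_ge' y

lemma jdd_nn (y : ℝ) : 0 ≤ jdd δ y := by unfold jdd; positivity

lemma jdd_le (hδ : 0 < δ) (y : ℝ) : jdd δ y ≤ 1 / δ := by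
  unfold jdd
  rw [div_le_div_iff₀ (pow_pos (jroot_pos hδ y) 3) hδ, one_mul]
  calc δ ^ 2 * δ = δ ^ 3 := by ring
    _ ≤ _ := by gcongr; exact jroot_ge y

lemma jdd_le' (hδ : 0 < δ) (y : ℝ) : jdd δ y * y ^ 2 ≤ δ := by
  unfold jdd
  have h := jroot_pos hδ y
  rw [div_mul_eq_mul_div, div_le_iff₀ (pow_pos h 3)]
  have h1 := jroot_ge (δ := δ) y
  have h2 := jroot_sq (δ := δ) y
  have : √(y ^ 2 + δ ^ 2) ^ 3 = √(y ^ 2 + δ ^ 2) * (y ^ 2 + δ ^ 2) := by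
    linear_combination √(y ^ 2 + δ ^ 2) * h2
  rw [this]
  have : δ * (y ^ 2) ≤ √(y ^ 2 + δ ^ 2) * (y ^ 2 + δ ^ 2) := by
    apply mul_le_mul h1 (by nlinarith [sq_nonneg δ]) (by positivity) h.le
  nlinarith

end jlem

lemma cont_slice {N : ℕ} {Φ : ℝ → Evec N → ℝ} (h : Continuous fun q : ℝ × Evec N => Φ q.1 q.2) (s : ℝ) :
    Continuous (Φ s) := h.comp (by fun_prop : Continuous fun x : Evec N => (s, x))

lemma gH_int_dil {N : ℕ} {η c : ℝ} (hη : 0 < η) (hc : 0 < c) (x : Evec N) :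
    Integrable (fun v => gH N η (x - c • v)) := by
  have h1 : Integrable (fun z => gH N η (x - z)) := (gH_int hη).comp_sub_left x
  exact h1.comp_smul hc.ne'

lemma gH_integral_dil {N : ℕ} {η c : ℝ} (hη : 0 < η) (hc : 0 < c) (x : Evec N) :
    ∫ v, gH N η (x - c • v) = (c ^ N)⁻¹ := by
  have h1 := integral_dil (fun z => gH N η (x - z)) c hc
  rw [integral_const_mul, integral_sub_left_eq_self (gH N η), gH_integral hη] at h1
  field_simp
  linarith

lemma jensen {N : ℕ} {η c : ℝ} (hη : 0 < η) (hc : 0 < c) {g : Evec N → ℝ} (hg : Integrable g)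
    (hg2 : Integrable (fun v => g v ^ 2)) (x : Evec N) :
    cv (gH N η) c g x ^ 2 ≤ (c ^ N)⁻¹ * cv (gH N η) c (fun v => g v ^ 2) x := by
  set A := cv (gH N η) c g x with hA
  set L := (c ^ N)⁻¹ with hL
  have hLp : 0 < L := by positivity
  have i0 := gH_int_dil hη hc x
  have i1 := cv_integrand (c := c) (gH_cont hη) (gH_le hη) hg x
  have i2 := cv_integrand (c := c) (gH_cont hη) (gH_le hη) hg2 x
  have h0 : 0 ≤ ∫ v, gH N η (x - c • v) * (L * g v - A) ^ 2 :=
    integral_nonneg fun v => mul_nonneg (gH_nn hη _) (sq_nonneg _)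
  have e : ∫ v, gH N η (x - c • v) * (L * g v - A) ^ 2 =
      L ^ 2 * cv (gH N η) c (fun v => g v ^ 2) x - 2 * L * A * A + A ^ 2 * L := by
    have e1 : ∀ v, gH N η (x - c • v) * (L * g v - A) ^ 2 =
      L ^ 2 * (gH N η (x - c • v) * g v ^ 2) - 2 * L * A * (gH N η (x - c • v) * g v) +
        A ^ 2 * gH N η (x - c • v) := fun v => by ring
    simp only [e1]
    have ia : Integrable (fun v => L ^ 2 * (gH N η (x - c • v) * g v ^ 2) - 2 * L * A * (gH N η (x - c • v) * g v)) :=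
      (i2.const_mul _).sub (i1.const_mul _)
    rw [integral_add ia (i0.const_mul _), integral_sub (i2.const_mul _) (i1.const_mul _), integral_const_mul,
      integral_const_mul, integral_const_mul, gH_integral_dil hη hc]
    rfl
  rw [e] at h0
  have : 0 ≤ L * (L * cv (gH N η) c (fun v => g v ^ 2) x - A ^ 2) := by nlinarith
  have := nonneg_of_mul_nonneg_right this hLp
  linarith

section good
variable {N : ℕ} {T M C : ℝ} {f : ℝ → Evec N → ℝ}

lemma GoodF.RR_cont (h : GoodF N T M C f) {η : ℝ} (hη : 0 < η) :
    Continuous (fun q : ℝ × Evec N => RR f η q.1 q.2) := by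
  unfold RR
  refine continuous_finsetSum _ fun i _ => ?_
  refine Continuous.add (Continuous.mul (by fun_prop) ?_) (Continuous.mul (by fun_prop) ?_)
  · exact h.cvf_cont (kk := fun a => gDD N a i) (fun q hq => gDD_contAt i hq) (fun a ha => gDD_le i ha) hη
  · exact h.cvg_cont i (kk := fun a => gD N a i) (fun q hq => gD_contAt i hq) (fun a ha => gD_le i ha) hη

lemma GoodF.uu_cont (h : GoodF N T M C f) {η : ℝ} (hη : 0 < η) :
    Continuous (fun q : ℝ × Evec N => uu f η q.1 q.2) := by
  unfold uu
  exact h.cvf_cont (kk := fun a => gH N a) (fun q hq => gH_contAt hq) (fun a ha => gH_le ha) hη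

lemma GoodF.RRi_int (h : GoodF N T M C f) {η : ℝ} (hη : 0 < η) (s : ℝ) (i : Fin N) :
    Integrable (fun x => exp (2 * s) * cv (gDD N η i) (exp s) (f s) x + exp s * cv (gD N η i) (exp s) (gg f i s) x) :=
  ((cv_int (gDD_cont i hη) (gDD_int i hη) (h.int s)).const_mul _).add
    ((cv_int (gD_cont i hη) (gD_int i hη) (h.gint i s)).const_mul _)

lemma GoodF.RR_int (h : GoodF N T M C f) {η : ℝ} (hη : 0 < η) (s : ℝ) : Integrable (RR f η s) := by
  unfold RR
  exact integrable_finsetSum _ fun i _ => h.RRi_int hη s i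

lemma GoodF.RR_norm (h : GoodF N T M C f) {η : ℝ} (hη : 0 < η) {s : ℝ} (hs : s ≤ T) :
    ∫ x, |RR f η s x| ≤ ∑ i, (exp (2 * T) * ((∫ z, |gDD N η i z|) * C) + exp T * ((∫ z, |gD N η i z|) * (M * C))) := by
  have j1 : ∀ i, Integrable (fun x => |cv (gDD N η i) (exp s) (f s) x|) := fun i =>
    (cv_int (gDD_cont i hη) (gDD_int i hη) (h.int s)).abs
  have j2 : ∀ i, Integrable (fun x => |cv (gD N η i) (exp s) (gg f i s) x|) := fun i =>
    (cv_int (gD_cont i hη) (gD_int i hη) (h.gint i s)).abs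
  have j3 : ∀ i, Integrable (fun x => exp (2 * s) * |cv (gDD N η i) (exp s) (f s) x| + exp s * |cv (gD N η i) (exp s) (gg f i s) x|) :=
    fun i => ((j1 i).const_mul _).add ((j2 i).const_mul _)
  calc ∫ x, |RR f η s x| ≤ ∫ x, ∑ i, (exp (2 * s) * |cv (gDD N η i) (exp s) (f s) x| + exp s * |cv (gD N η i) (exp s) (gg f i s) x|) := by
        refine integral_mono (h.RR_int hη s).abs
          (integrable_finsetSum _ fun i _ => j3 i) fun x => ?_
        simp only [RR]
        refine (Finset.abs_sum_le_sum_abs _ _).trans (Finset.sum_le_sum fun i _ => ?_)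
        refine (abs_add_le _ _).trans ?_
        rw [abs_mul, abs_mul, abs_of_pos (exp_pos _), abs_of_pos (exp_pos _)]
    _ ≤ _ := by
        rw [integral_finsetSum _ fun i _ => j3 i]
        refine Finset.sum_le_sum fun i _ => ?_
        rw [integral_add ((j1 i).const_mul _) ((j2 i).const_mul _), integral_const_mul, integral_const_mul]
        have k1 := cv_norm (c := exp s) (gDD_cont i hη) (gDD_int i hη) (h.int s)
        have k2 := cv_norm (c := exp s) (gD_cont i hη) (gD_int i hη) (h.gint i s)
        have k3 := h.b0 s
        have k4 := h.gnorm i s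
        have n1 : 0 ≤ ∫ z, |gDD N η i z| := integral_nonneg fun _ => abs_nonneg _
        have n2 : 0 ≤ ∫ z, |gD N η i z| := integral_nonneg fun _ => abs_nonneg _
        have n3 : 0 ≤ ∫ x, |cv (gDD N η i) (exp s) (f s) x| := integral_nonneg fun _ => abs_nonneg _
        have n4 : 0 ≤ ∫ x, |cv (gD N η i) (exp s) (gg f i s) x| := integral_nonneg fun _ => abs_nonneg _
        have e1 : exp (2 * s) ≤ exp (2 * T) := exp_le_exp.2 (by linarith)
        have e2 : exp s ≤ exp T := exp_le_exp.2 hs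
        refine add_le_add (mul_le_mul e1 (k1.trans ?_) n3 (exp_pos _).le)
          (mul_le_mul e2 (k2.trans ?_) n4 (exp_pos _).le)
        · exact mul_le_mul_of_nonneg_left k3 n1
        · exact mul_le_mul_of_nonneg_left k4 n2

def GG (f : ℝ → Evec N → ℝ) (η δ s : ℝ) : ℝ :=
  1 / 4 * ∑ i, ∫ x, jdd δ (uu f η s x) * cv (gH N η) (exp s) (gg f i s) x ^ 2

lemma GoodF.gsq_int (h : GoodF N T M C f) (i : Fin N) (s : ℝ) : Integrable (fun v => gg f i s v ^ 2) := by
  refine ((h.int2 s).const_mul (M ^ 2)).mono' ((h.gm i s).pow 2) ?_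
  filter_upwards [h.bd s] with w hw
  unfold gg
  have h1 : (w i) ^ 2 ≤ ‖w‖ ^ 2 := sq_le_sq' (by linarith [abs_le.1 (coord_le w i)]) (abs_le.1 (coord_le w i)).2
  have h2 : f s w ^ 2 ≤ M ^ 2 := sq_le_sq' (abs_le.1 hw).1 (abs_le.1 hw).2
  rw [norm_of_nonneg (sq_nonneg _)]
  calc (w i * f s w ^ 2) ^ 2 = f s w ^ 2 * (w i ^ 2 * f s w ^ 2) := by ring
    _ ≤ M ^ 2 * (‖w‖ ^ 2 * f s w ^ 2) := by gcongr

lemma GoodF.Gam_sq_int (h : GoodF N T M C f) {η : ℝ} (hη : 0 < η) (i : Fin N) (s : ℝ) :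
    Integrable (fun x => cv (gH N η) (exp s) (gg f i s) x ^ 2) := by
  have hc := cv_int (c := exp s) (gH_cont hη) (gH_int hη) (h.gint i s)
  have hb : ∀ x, ‖cv (gH N η) (exp s) (gg f i s) x‖ ≤ gB N η * ∫ v, |gg f i s v| :=
    fun x => cv_bound (gH_le hη) (h.gint i s) x
  have := Integrable.bdd_mul (f := cv (gH N η) (exp s) (gg f i s)) (g := cv (gH N η) (exp s) (gg f i s)) hc hc.aestronglyMeasurable
    (Eventually.of_forall hb)
  refine this.congr (Eventually.of_forall fun x => by simp only; ring)

lemma GoodF.GGi_int (h : GoodF N T M C f) {η δ : ℝ} (hη : 0 < η) (hδ : 0 < δ) (i : Fin N) (s : ℝ) :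
    Integrable (fun x => jdd δ (uu f η s x) * cv (gH N η) (exp s) (gg f i s) x ^ 2) := by
  refine Integrable.bdd_mul (f := fun x => jdd δ (uu f η s x)) (g := fun x => cv (gH N η) (exp s) (gg f i s) x ^ 2)
    (c := 1 / δ) (h.Gam_sq_int hη i s) ?_ (Eventually.of_forall fun x => ?_)
  · have : Continuous (uu f η s) := cont_slice (Φ := uu f η) (h.uu_cont hη) s
    exact ((jdd_cont hδ).comp this).aestronglyMeasurable
  · rw [norm_of_nonneg (jdd_nn _)]; exact jdd_le hδ _

lemma GoodF.ibp (h : GoodF N T M C f) {η δ : ℝ} (hη : 0 < η) (hδ : 0 < δ) (s : ℝ) :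
    ∫ x, jd δ (uu f η s x) * RR f η s x ≤ GG f η δ s := by
  have uc : Continuous (uu f η s) := cont_slice (Φ := uu f η) (h.uu_cont hη) s
  have jdm : AEStronglyMeasurable (fun x => jd δ (uu f η s x)) volume := ((jd_cont hδ).comp uc).aestronglyMeasurable
  unfold RR GG
  simp only [Finset.mul_sum]
  rw [integral_finsetSum]
  swap
  · intro i _
    exact (h.RRi_int hη s i).bdd_mul (c := 1) jdm (Eventually.of_forall fun x => jd_le hδ _)
  refine Finset.sum_le_sum fun i _ => ?_
  set du : Evec N → ℝ := cv (gD N η i) (exp s) (f s) with hdu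
  set Ga : Evec N → ℝ := cv (gH N η) (exp s) (gg f i s) with hGa
  have duc : Continuous du := cont_slice (Φ := fun s => cv (gD N η i) (exp s) (f s)) (h.cvf_cont (kk := fun a => gD N a i)
    (fun q hq => gD_contAt i hq) (fun a ha => gD_le i ha) hη) s
  have dui : Integrable du := cv_int (gD_cont i hη) (gD_int i hη) (h.int s)
  have Gai : Integrable Ga := cv_int (gH_cont hη) (gH_int hη) (h.gint i s)
  have W : Integrable (fun x => exp (2 * s) * du x + exp s * Ga x) := (dui.const_mul _).add (Gai.const_mul _)
  have I1 : Integrable (fun x => (jdd δ (uu f η s x) * du x) * (exp (2 * s) * du x + exp s * Ga x)) := by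
    refine W.bdd_mul (c := 1 / δ * (gB N η * ∫ v, |f s v|)) ?_ (Eventually.of_forall fun x => ?_)
    · exact (((jdd_cont hδ).comp uc).mul duc).aestronglyMeasurable
    · rw [norm_mul, norm_of_nonneg (jdd_nn _)]
      exact mul_le_mul (jdd_le hδ _) (cv_bound (gD_le i hη) (h.int s) x) (norm_nonneg _) (by positivity)
  have e : ∫ x, jd δ (uu f η s x) * (exp (2 * s) * cv (gDD N η i) (exp s) (f s) x + exp s * cv (gD N η i) (exp s) (gg f i s) x)
      = - ∫ x, (jdd δ (uu f η s x) * du x) * (exp (2 * s) * du x + exp s * Ga x) := by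
    refine integral_bilinear_hasLineDerivAt_right_eq_neg_left_of_integrable (B := ContinuousLinearMap.mul ℝ ℝ)
      (f := fun x => jd δ (uu f η s x)) (g := fun x => exp (2 * s) * du x + exp s * Ga x)
      (f' := fun x => jdd δ (uu f η s x) * du x)
      (g' := fun x => exp (2 * s) * cv (gDD N η i) (exp s) (f s) x + exp s * cv (gD N η i) (exp s) (gg f i s) x)
      (v := EuclideanSpace.single i 1) ?_ ?_ ?_ ?_ ?_
    · exact I1
    · exact (h.RRi_int hη s i).bdd_mul (c := 1) jdm (Eventually.of_forall fun x => jd_le hδ _)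
    · exact W.bdd_mul (c := 1) jdm (Eventually.of_forall fun x => jd_le hδ _)
    · intro x _
      have := cv_line (c := exp s) (gH_line i hη) (gH_cont hη) (gD_cont i hη) (gH_le hη) (gD_le i hη) (h.int s) x
      unfold HasLineDerivAt at this ⊢
      exact HasDerivAt.comp_of_eq (h₂ := jd δ) 0 (jd_deriv hδ (uu f η s x)) this (by simp [uu])
    · intro x _
      have t1 := cv_line (c := exp s) (gH_line i hη) (gH_cont hη) (gD_cont i hη) (gH_le hη) (gD_le i hη) (h.gint i s) x
      have t2 := cv_line (c := exp s) (gD_line i hη) (gD_cont i hη) (gDD_cont i hη) (gD_le i hη) (gDD_le i hη) (h.int s) x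
      unfold HasLineDerivAt at t1 t2 ⊢
      exact (t2.const_mul _).add (t1.const_mul _)
  rw [e, ← integral_neg, ← integral_const_mul]
  refine integral_mono I1.neg ((h.GGi_int hη hδ i s).const_mul _) fun x => ?_
  have h1 := jdd_nn (δ := δ) (uu f η s x)
  have h2 : exp (2 * s) = exp s ^ 2 := by rw [← exp_nat_mul]; norm_num
  simp only [Pi.neg_apply]
  rw [h2]
  have h3 := mul_nonneg h1 (sq_nonneg (exp s * du x + Ga x / 2))
  nlinarith

lemma GoodF.GG_meas (h : GoodF N T M C f) {η δ : ℝ} (hη : 0 < η) (hδ : 0 < δ) :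
    StronglyMeasurable (fun s => GG f η δ s) := by
  unfold GG
  refine StronglyMeasurable.const_mul ?_ _
  refine Finset.stronglyMeasurable_fun_sum _ fun i _ => ?_
  have hc : Continuous (fun q : ℝ × Evec N => jdd δ (uu f η q.1 q.2) * cv (gH N η) (exp q.1) (gg f i q.1) q.2 ^ 2) :=
    ((jdd_cont hδ).comp (h.uu_cont hη)).mul
      ((h.cvg_cont i (kk := fun a => gH N a) (fun q hq => gH_contAt hq) (fun a ha => gH_le ha) hη).pow 2)
  exact hc.stronglyMeasurable.integral_prod_right (f := fun s x => jdd δ (uu f η s x) * cv (gH N η) (exp s) (gg f i s) x ^ 2)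

lemma GoodF.GG_nn (f : ℝ → Evec N → ℝ) (η δ s : ℝ) : 0 ≤ GG f η δ s := by
  unfold GG
  refine mul_nonneg (by norm_num) (Finset.sum_nonneg fun i _ => integral_nonneg fun x => ?_)
  exact mul_nonneg (jdd_nn _) (sq_nonneg _)

lemma GoodF.gsq_norm (h : GoodF N T M C f) (i : Fin N) (s : ℝ) : ∫ v, |gg f i s v ^ 2| ≤ M ^ 2 * C := by
  have h0 := h.b2 s
  refine le_trans ?_ (mul_le_mul_of_nonneg_left h0 (sq_nonneg M))
  rw [← integral_const_mul]
  refine integral_mono_ae (h.gsq_int i s).abs ((h.int2 s).const_mul _) ?_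
  filter_upwards [h.bd s] with w hw
  unfold gg
  have h1 : (w i) ^ 2 ≤ ‖w‖ ^ 2 := sq_le_sq' (by linarith [abs_le.1 (coord_le w i)]) (abs_le.1 (coord_le w i)).2
  have h2 : f s w ^ 2 ≤ M ^ 2 := sq_le_sq' (abs_le.1 hw).1 (abs_le.1 hw).2
  rw [abs_of_nonneg (sq_nonneg _)]
  calc (w i * f s w ^ 2) ^ 2 = f s w ^ 2 * (w i ^ 2 * f s w ^ 2) := by ring
    _ ≤ M ^ 2 * (‖w‖ ^ 2 * f s w ^ 2) := by gcongr

lemma GoodF.GG_le (h : GoodF N T M C f) {η δ s : ℝ} (hη : 0 < η) (hδ : 0 < δ) (hs : 0 ≤ s) :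
    GG f η δ s ≤ 1 / 4 * (N * (1 / δ * (M ^ 2 * C))) := by
  unfold GG
  refine mul_le_mul_of_nonneg_left ?_ (by norm_num)
  have hcst : (N : ℝ) * (1 / δ * (M ^ 2 * C)) = ∑ i : Fin N, (1 / δ * (M ^ 2 * C)) := by simp
  rw [hcst]
  refine Finset.sum_le_sum fun i _ => ?_
  have hci := cv_int (c := exp s) (gH_cont hη) (gH_int hη) (h.gsq_int i s)
  have he : (exp s ^ N)⁻¹ ≤ 1 := inv_le_one_of_one_le₀ (one_le_pow₀ (one_le_exp hs))
  calc _ ≤ ∫ x, 1 / δ * |cv (gH N η) (exp s) (fun v => gg f i s v ^ 2) x| := by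
        refine integral_mono (h.GGi_int hη hδ i s) (hci.abs.const_mul _) fun x => ?_
        have h1 := jensen hη (exp_pos s) (h.gint i s) (h.gsq_int i s) x
        refine mul_le_mul (jdd_le hδ _) (h1.trans ?_) (sq_nonneg _) (by positivity)
        refine (le_abs_self _).trans ?_
        rw [abs_mul, abs_of_nonneg (by positivity)]
        exact mul_le_of_le_one_left (abs_nonneg _) he
    _ ≤ _ := by
        rw [integral_const_mul]
        refine mul_le_mul_of_nonneg_left ?_ (by positivity)
        refine (cv_norm (gH_cont hη) (gH_int hη) (h.gsq_int i s)).trans ?_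
        have : ∫ z, |gH N η z| = 1 := by
          simp only [abs_of_nonneg (gH_nn hη _)]; exact gH_integral hη
        rw [this, one_mul]
        exact h.gsq_norm i s

lemma GoodF.GG_ii (h : GoodF N T M C f) {η δ t : ℝ} (hη : 0 < η) (hδ : 0 < δ) (ht : 0 ≤ t) :
    IntervalIntegrable (fun s => GG f η δ s) volume 0 t := by
  rw [intervalIntegrable_iff_integrableOn_Ioc_of_le ht]
  refine Integrable.mono' (g := fun _ => 1 / 4 * (N * (1 / δ * (M ^ 2 * C)))) (integrable_const _) (h.GG_meas hη hδ).aestronglyMeasurable ?_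
  refine (ae_restrict_iff' measurableSet_Ioc).2 (Eventually.of_forall fun s hs => ?_)
  rw [norm_of_nonneg (GoodF.GG_nn f η δ s)]
  exact h.GG_le hη hδ hs.1.le

lemma GoodF.uu_int (h : GoodF N T M C f) {η : ℝ} (hη : 0 < η) (s : ℝ) : Integrable (uu f η s) :=
  cv_int (gH_cont hη) (gH_int hη) (h.int s)

lemma GoodF.jj_int (h : GoodF N T M C f) {η δ : ℝ} (hη : 0 < η) (hδ : 0 < δ) (s : ℝ) :
    Integrable (fun x => jj δ (uu f η s x)) := by
  refine (h.uu_int hη s).abs.mono' (jj_cont.comp_aestronglyMeasurable (h.uu_int hη s).aestronglyMeasurable)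
    (Eventually.of_forall fun x => ?_)
  rw [norm_of_nonneg (jj_nn _)]
  exact jj_le hδ _

lemma GoodF.energy (h : GoodF N T M C f) {η δ t : ℝ} (hη : 0 < η) (hδ : 0 < δ) (ht : t ∈ Set.Icc 0 T) :
    ∫ x, jj δ (uu f η t x) ≤ (∫ v, |f 0 v|) + ∫ s in (0:ℝ)..t, GG f η δ s := by
  have hcont : Continuous (fun q : ℝ × Evec N => jd δ (uu f η q.1 q.2) * RR f η q.1 q.2) :=
    ((jd_cont hδ).comp (h.uu_cont hη)).mul (h.RR_cont hη)
  have hsx : ∀ s, Integrable (fun x => jd δ (uu f η s x) * RR f η s x) := fun s => by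
    refine (h.RR_int hη s).bdd_mul (c := 1) ?_ (Eventually.of_forall fun x => jd_le hδ _)
    exact (jd_cont hδ).comp_aestronglyMeasurable (h.uu_int hη s).aestronglyMeasurable
  have hprod : Integrable (fun q : ℝ × Evec N => jd δ (uu f η q.1 q.2) * RR f η q.1 q.2)
      ((volume.restrict (Set.Ioc 0 t)).prod volume) := by
    have hm := hcont.aestronglyMeasurable (μ := (volume.restrict (Set.Ioc 0 t)).prod (volume : Measure (Evec N)))
    refine (integrable_prod_iff hm).2 ⟨Eventually.of_forall hsx, ?_⟩
    refine Integrable.mono' (g := fun _ => ∑ i, (exp (2 * T) * ((∫ z, |gDD N η i z|) * C) + exp T * ((∫ z, |gD N η i z|) * (M * C))))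
      (integrable_const _) hm.norm.integral_prod_right' ?_
    refine (ae_restrict_iff' measurableSet_Ioc).2 (Eventually.of_forall fun s hs => ?_)
    rw [norm_of_nonneg (integral_nonneg fun _ => norm_nonneg _)]
    refine le_trans ?_ (h.RR_norm hη (hs.2.trans ht.2))
    refine integral_mono (hsx s).norm (h.RR_int hη s).abs fun x => ?_
    simp only [norm_mul, Real.norm_eq_abs]
    exact mul_le_of_le_one_left (abs_nonneg _) (jd_le hδ _)
  have ftc : ∀ x, jj δ (uu f η t x) - jj δ (uu f η 0 x) = ∫ s in Set.Ioc 0 t, jd δ (uu f η s x) * RR f η s x := by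
    intro x
    rw [← intervalIntegral.integral_of_le ht.1]
    have hpc : Continuous fun s : ℝ => (s, x) := by fun_prop
    refine (intervalIntegral.integral_eq_sub_of_hasDeriv_right_of_le (f := fun s => jj δ (uu f η s x)) ht.1 ?_ ?_ ?_).symm
    · exact (jj_cont.comp ((h.uu_cont hη).comp hpc)).continuousOn
    · intro s hs
      exact (jj_deriv hδ _).comp_hasDerivWithinAt s (h.uderiv ⟨hs.1.le, hs.2.trans_le ht.2⟩ hη x)
    · exact (hcont.comp hpc).intervalIntegrable _ _
  have e1 : ∫ x, jj δ (uu f η t x) = (∫ x, jj δ (uu f η 0 x)) + ∫ s in Set.Ioc 0 t, ∫ x, jd δ (uu f η s x) * RR f η s x := by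
    rw [integral_integral_swap hprod]
    simp only [← ftc]
    rw [integral_sub (h.jj_int hη hδ t) (h.jj_int hη hδ 0)]
    ring
  rw [e1]
  refine add_le_add ?_ ?_
  · refine (integral_mono (h.jj_int hη hδ 0) (h.uu_int hη 0).abs fun x => jj_le hδ _).trans ?_
    refine (cv_norm (gH_cont hη) (gH_int hη) (h.int 0)).trans ?_
    have : ∫ z, |gH N η z| = 1 := by
      simp only [abs_of_nonneg (gH_nn hη _)]; exact gH_integral hη
    rw [this, one_mul]
  · rw [intervalIntegral.integral_of_le ht.1]
    refine integral_mono hprod.integral_prod_left ?_ fun s => h.ibp hη hδ s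
    exact (intervalIntegrable_iff_integrableOn_Ioc_of_le ht.1).1 (h.GG_ii hη hδ ht.1)

end good


def om {N : ℕ} (g : Evec N → ℝ) (z : Evec N) : ℝ := ∫ y, |g (y - z) - g y|

lemma om_cont {N : ℕ} {g : Evec N → ℝ} (hg : Integrable g) : Continuous (om g) := by
  have hm : MemLp g 1 volume := memLp_one_iff_integrable.2 hg
  let F : Evec N → C(Evec N, Evec N) := fun z => ⟨fun y => y - z, by fun_prop⟩
  have hF : Continuous F := by
    apply ContinuousMap.continuous_of_continuous_uncurry
    exact continuous_snd.sub continuous_fst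
  have hmp : ∀ z, MeasurePreserving (F z) (volume : Measure (Evec N)) volume :=
    fun z => measurePreserving_sub_right volume z
  have h1 := Continuous.compMeasurePreservingLp (f := fun _ : Evec N => hm.toLp g) continuous_const hF hmp
    ENNReal.one_ne_top
  have h2 : Continuous fun z => ‖Lp.compMeasurePreserving (F z) (hmp z) (hm.toLp g) - hm.toLp g‖ :=
    (h1.sub continuous_const).norm
  refine h2.congr fun z => ?_
  have hm' : MemLp (fun y => g (y - z)) 1 volume := hm.comp_measurePreserving (hmp z)
  have e : Lp.compMeasurePreserving (F z) (hmp z) (hm.toLp g) - hm.toLp g = (hm'.sub hm).toLp _ := rfl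
  rw [e, Lp.norm_toLp, eLpNorm_one_eq_lintegral_enorm, om]
  rw [← integral_norm_eq_lintegral_enorm (hm'.sub hm).1]
  rfl

lemma om_le {N : ℕ} {g : Evec N → ℝ} (hg : Integrable g) (z : Evec N) : om g z ≤ 2 * ∫ v, |g v| := by
  have i1 : Integrable fun y => |g (y - z)| := (hg.comp_sub_right z).abs
  have i2 : Integrable fun y => |g y| := hg.abs
  calc om g z ≤ ∫ y, (|g (y - z)| + |g y|) := by
        refine integral_mono (((hg.comp_sub_right z).sub hg).abs) (i1.add i2) fun y => ?_
        exact abs_sub _ _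
    _ = 2 * ∫ v, |g v| := by
        rw [integral_add i1 i2, integral_sub_right_eq_self (fun y => |g y|) z]; ring

lemma om_nn {N : ℕ} (g : Evec N → ℝ) (z : Evec N) : 0 ≤ om g z := integral_nonneg fun _ => abs_nonneg _

lemma om_zero {N : ℕ} (g : Evec N → ℝ) : om g 0 = 0 := by simp [om]

lemma approx_le {N : ℕ} {g : Evec N → ℝ} (hg : Integrable g) (hgm : StronglyMeasurable g) {ε : ℝ} (hε : 0 < ε) :
    ∫ y, |cv (gH N ε) 1 g y - g y| ≤ ∫ z, gH N ε z * om g z := by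
  have i0 : Integrable fun z => gH N ε z * om g z := by
    refine ((gH_int hε).mul_bdd (g := om g) (c := 2 * ∫ v, |g v|) (om_cont hg).aestronglyMeasurable ?_)
    filter_upwards with z
    rw [norm_of_nonneg (om_nn g z)]; exact om_le hg z
  let F : Evec N × Evec N → ℝ := fun q => gH N ε q.2 * |g (q.1 - q.2) - g q.1|
  have Fm : AEStronglyMeasurable F (volume.prod volume) := by
    apply StronglyMeasurable.aestronglyMeasurable
    have a1 : StronglyMeasurable fun q : Evec N × Evec N => g (q.1 - q.2) :=
      hgm.comp_measurable (measurable_fst.sub measurable_snd)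
    have a2 : StronglyMeasurable fun q : Evec N × Evec N => g q.1 := hgm.comp_measurable measurable_fst
    have a3 : StronglyMeasurable fun q : Evec N × Evec N => gH N ε q.2 :=
      (gH_cont hε).stronglyMeasurable.comp_measurable measurable_snd
    exact a3.mul (a1.sub a2).norm
  have e1 : ∀ z, ∫ y, F (y, z) = gH N ε z * om g z := fun z => by
    simp only [F]; rw [integral_const_mul]; rfl
  have Fi : Integrable F (volume.prod volume) := by
    rw [integrable_prod_iff' Fm]
    refine ⟨Eventually.of_forall fun z => ?_, ?_⟩
    · exact (((hg.comp_sub_right z).sub hg).abs).const_mul (gH N ε z)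
    · refine i0.congr (Eventually.of_forall fun z => ?_)
      simp only [← e1]
      refine integral_congr_ae (Eventually.of_forall fun y => ?_)
      exact (norm_of_nonneg (mul_nonneg (gH_nn hε z) (abs_nonneg _))).symm
  have e2 : ∫ y, ∫ z, F (y, z) = ∫ z, gH N ε z * om g z := by
    rw [integral_integral_swap Fi]
    exact integral_congr_ae (Eventually.of_forall e1)
  rw [← e2]
  refine integral_mono_of_nonneg (Eventually.of_forall fun _ => abs_nonneg _) Fi.integral_prod_left
    (Eventually.of_forall fun y => ?_)
  have b1 : cv (gH N ε) 1 g y = ∫ z, gH N ε z * g (y - z) := by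
    unfold cv
    rw [← integral_sub_left_eq_self _ volume y]
    simp
  have i1 : Integrable fun z => gH N ε z * g (y - z) :=
    (hg.comp_sub_left y).bdd_mul (c := gB N ε) (gH_cont hε).aestronglyMeasurable
      (Eventually.of_forall fun z => gH_le hε z)
  have i2 : Integrable fun z => gH N ε z * g y := (gH_int hε).mul_const _
  have b2 : g y = ∫ z, gH N ε z * g y := by rw [integral_mul_const, gH_integral hε, one_mul]
  have b3 : cv (gH N ε) 1 g y - g y = ∫ z, gH N ε z * (g (y - z) - g y) := by
    have b4 : ∫ z, gH N ε z * (g (y - z) - g y) = (∫ z, gH N ε z * g (y - z)) - ∫ z, gH N ε z * g y := by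
      rw [← integral_sub i1 i2]
      congr 1; ext z; ring
    rw [b4, ← b2, b1]
  simp only [b3]
  refine (norm_integral_le_integral_norm (fun z => gH N ε z * (g (y - z) - g y))).trans (le_of_eq ?_)
  refine integral_congr_ae (Eventually.of_forall fun z => ?_)
  simp only [norm_mul, F, norm_eq_abs]
  rw [abs_of_nonneg (gH_nn hε z)]

lemma approx_id {N : ℕ} {g : Evec N → ℝ} (hg : Integrable g) :
    Tendsto (fun ε => ∫ y, |cv (gH N ε) 1 g y - g y|) (𝓝[>] 0) (𝓝 0) := by
  wlog hgm : StronglyMeasurable g generalizing g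
  · have he := hg.1.ae_eq_mk
    have := this (hg.congr he) hg.1.stronglyMeasurable_mk
    refine this.congr fun ε => ?_
    refine integral_congr_ae ?_
    filter_upwards [he] with y hy
    have : cv (gH N ε) 1 g y = cv (gH N ε) 1 (hg.1.mk g) y := by
      refine integral_congr_ae ?_
      filter_upwards [he] with v hv
      rw [hv]
    rw [this, hy]
  have hlim : Tendsto (fun ε : ℝ => ∫ z, gH N 1 z * om g (√ε • z)) (𝓝[>] 0) (𝓝 (∫ z : Evec N, gH N 1 z * 0)) := by
    refine tendsto_integral_filter_of_dominated_convergence (fun z => gH N 1 z * (2 * ∫ v, |g v|)) ?_ ?_ ?_ ?_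
    · filter_upwards with ε
      exact ((gH_cont one_pos).mul ((om_cont hg).comp (by fun_prop))).aestronglyMeasurable
    · filter_upwards with ε
      filter_upwards with z
      rw [norm_of_nonneg (mul_nonneg (gH_nn one_pos z) (om_nn g _))]
      exact mul_le_mul_of_nonneg_left (om_le hg _) (gH_nn one_pos z)
    · exact (gH_int one_pos).mul_const _
    · filter_upwards with z
      refine Tendsto.const_mul _ ?_
      have hc : Continuous fun ε : ℝ => om g (√ε • z) := (om_cont hg).comp (by fun_prop)
      have := hc.tendsto 0
      simp only [sqrt_zero, zero_smul, om_zero] at this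
      exact this.mono_left nhdsWithin_le_nhds
  simp only [mul_zero, integral_zero] at hlim
  refine squeeze_zero' (Eventually.of_forall fun ε => integral_nonneg fun _ => abs_nonneg _) ?_ hlim
  filter_upwards [self_mem_nhdsWithin] with ε hε
  have hε : 0 < ε := hε
  refine (approx_le hg hgm hε).trans (le_of_eq ?_)
  rw [← integral_dil _ (√ε) (sqrt_pos.2 hε)]
  refine integral_congr_ae (Eventually.of_forall fun z => ?_)
  have hs : 0 < √ε ^ N := pow_pos (sqrt_pos.2 hε) _
  simp only
  rw [gH_smul hε (sqrt_pos.2 hε), sq_sqrt hε.le, div_self hε.ne']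
  field_simp

lemma cv_scale {N : ℕ} {η c : ℝ} (hη : 0 < η) (hc : 0 < c) (g : Evec N → ℝ) (y : Evec N) :
    cv (gH N η) c g (c • y) = (c ^ N)⁻¹ * cv (gH N (η / c ^ 2)) 1 g y := by
  unfold cv
  rw [← integral_const_mul]
  refine integral_congr_ae (Eventually.of_forall fun v => ?_)
  simp only [one_smul]
  rw [← smul_sub, gH_smul hη hc, mul_assoc]


lemma ae_conv {N : ℕ} {U : ℝ → Evec N → ℝ} {u0 : Evec N → ℝ} (hU : ∀ ε, 0 < ε → Integrable (U ε))
    (hu0 : Integrable u0) (hlim : Tendsto (fun ε => ∫ y, |U ε y - u0 y|) (𝓝[>] 0) (𝓝 0))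
    {ns : ℕ → ℝ} (hns : Tendsto ns atTop (𝓝[>] 0)) :
    ∃ ms : ℕ → ℕ, Tendsto ms atTop atTop ∧ ∀ᵐ y, Tendsto (fun n => U (ns (ms n)) y) atTop (𝓝 (u0 y)) := by
  obtain ⟨n0, hn0⟩ := eventually_atTop.1 (hns.eventually self_mem_nhdsWithin)
  have hpos : ∀ n, 0 < ns (n + n0) := fun n => hn0 _ (by omega)
  have h1 : TendstoInMeasure volume (fun n => U (ns (n + n0))) atTop u0 := by
    refine tendstoInMeasure_of_tendsto_eLpNorm (p := 1) one_ne_zero (fun n => (hU _ (hpos n)).1) hu0.1 ?_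
    have h2 : Tendsto (fun n => ENNReal.ofReal (∫ y, |U (ns (n + n0)) y - u0 y|)) atTop (𝓝 0) := by
      rw [← ENNReal.ofReal_zero]
      exact (ENNReal.continuous_ofReal.tendsto 0).comp
        (hlim.comp (hns.comp (tendsto_add_atTop_nat n0)))
    refine h2.congr fun n => ?_
    rw [eLpNorm_one_eq_lintegral_enorm]
    exact ofReal_integral_norm_eq_lintegral_enorm ((hU _ (hpos n)).sub hu0)
  obtain ⟨ms, hms, hae⟩ := h1.exists_seq_tendsto_ae
  exact ⟨fun n => ms n + n0, (tendsto_add_atTop_nat n0).comp hms.tendsto_atTop, hae⟩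

lemma nl_lim {N : ℕ} {U G : ℝ → Evec N → ℝ} {u0 g0 : Evec N → ℝ} (hU : ∀ ε, 0 < ε → Integrable (U ε))
    (hu0 : Integrable u0) (hlim : Tendsto (fun ε => ∫ y, |U ε y - u0 y|) (𝓝[>] 0) (𝓝 0))
    (hG : ∀ ε, 0 < ε → Integrable (G ε))
    (hg0 : Integrable g0) (hlimG : Tendsto (fun ε => ∫ y, |G ε y - g0 y|) (𝓝[>] 0) (𝓝 0))
    {k : ℝ → ℝ} {K : ℝ} (hk : Continuous k) (hK : ∀ y, |k y| ≤ K) :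
    Tendsto (fun ε => ∫ y, k (U ε y) * G ε y) (𝓝[>] 0) (𝓝 (∫ y, k (u0 y) * g0 y)) := by
  refine tendsto_of_subseq_tendsto fun ns hns => ?_
  obtain ⟨ms, hms, hae⟩ := ae_conv hU hu0 hlim hns
  have hcomp : Tendsto (fun n => ns (ms n)) atTop (𝓝[>] 0) := hns.comp hms
  have hpos := hcomp.eventually self_mem_nhdsWithin
  refine ⟨ms, tendsto_int_mul (M := K) ?_ ?_ ?_ ?_ hg0 (hlimG.comp hcomp)⟩
  · filter_upwards [hpos] with n hn
    exact hk.comp_aestronglyMeasurable (hU _ hn).1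
  · exact Eventually.of_forall fun n w => hK _
  · filter_upwards [hae] with y hy
    exact (hk.tendsto _).comp hy
  · filter_upwards [hpos] with n hn
    exact hG _ hn

section lim
variable {N : ℕ} {T M C : ℝ} {f : ℝ → Evec N → ℝ}

lemma div_tendsto {c : ℝ} (hc : 0 < c) : Tendsto (fun η : ℝ => η / c ^ 2) (𝓝[>] 0) (𝓝[>] 0) := by
  refine tendsto_nhdsWithin_of_tendsto_nhds_of_eventually_within _ ?_ ?_
  · have h : Continuous fun η : ℝ => η / c ^ 2 := by fun_prop
    have := h.tendsto 0
    rw [zero_div] at this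
    exact this.mono_left nhdsWithin_le_nhds
  · filter_upwards [self_mem_nhdsWithin] with η hη
    have hη : 0 < η := hη
    exact div_pos hη (pow_pos hc 2)

lemma GoodF.GG_scaled (h : GoodF N T M C f) {η δ : ℝ} (hη : 0 < η) (hδ : 0 < δ) (s : ℝ) (i : Fin N) :
    ∫ x, jdd δ (uu f η s x) * cv (gH N η) (exp s) (gg f i s) x ^ 2 ≤
      ∫ y, (jdd δ ((exp s ^ N)⁻¹ * cv (gH N (η / exp s ^ 2)) 1 (f s) y) * (exp s ^ N)⁻¹) *
        cv (gH N (η / exp s ^ 2)) 1 (fun v => gg f i s v ^ 2) y := by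
  have hc := exp_pos s
  have hcN : 0 < exp s ^ N := by positivity
  have hci := cv_int (c := exp s) (gH_cont hη) (gH_int hη) (h.gsq_int i s)
  have e : ∫ y, (jdd δ ((exp s ^ N)⁻¹ * cv (gH N (η / exp s ^ 2)) 1 (f s) y) * (exp s ^ N)⁻¹) *
        cv (gH N (η / exp s ^ 2)) 1 (fun v => gg f i s v ^ 2) y =
      ∫ x, jdd δ (uu f η s x) * ((exp s ^ N)⁻¹ * cv (gH N η) (exp s) (fun v => gg f i s v ^ 2) x) := by
    rw [← integral_dil (fun x => jdd δ (uu f η s x) * ((exp s ^ N)⁻¹ * cv (gH N η) (exp s)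
      (fun v => gg f i s v ^ 2) x)) (exp s) hc]
    refine integral_congr_ae (Eventually.of_forall fun y => ?_)
    simp only [uu]
    rw [cv_scale hη hc, cv_scale hη hc]
    field_simp
  rw [e]
  refine integral_mono (h.GGi_int hη hδ i s) ?_ fun x => ?_
  · refine Integrable.bdd_mul (f := fun x => jdd δ (uu f η s x))
      (g := fun x => (exp s ^ N)⁻¹ * cv (gH N η) (exp s) (fun v => gg f i s v ^ 2) x)
      (c := 1 / δ) (hci.const_mul _) ?_ (Eventually.of_forall fun x => ?_)
    · exact (jdd_cont hδ).comp_aestronglyMeasurable (h.uu_int hη s).1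
    · rw [norm_of_nonneg (jdd_nn _)]; exact jdd_le hδ _
  · exact mul_le_mul_of_nonneg_left (jensen hη hc (h.gint i s) (h.gsq_int i s) x) (jdd_nn _)

lemma GoodF.GGi_lim (h : GoodF N T M C f) {δ s : ℝ} (hδ : 0 < δ) (i : Fin N) :
    Tendsto (fun η => ∫ y, (jdd δ ((exp s ^ N)⁻¹ * cv (gH N (η / exp s ^ 2)) 1 (f s) y) * (exp s ^ N)⁻¹) *
        cv (gH N (η / exp s ^ 2)) 1 (fun v => gg f i s v ^ 2) y) (𝓝[>] 0)
      (𝓝 (∫ y, (jdd δ ((exp s ^ N)⁻¹ * f s y) * (exp s ^ N)⁻¹) * gg f i s y ^ 2)) := by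
  have h0 := nl_lim (U := fun ε => cv (gH N ε) 1 (f s)) (G := fun ε => cv (gH N ε) 1 (fun v => gg f i s v ^ 2))
    (fun ε hε => cv_int (gH_cont hε) (gH_int hε) (h.int s)) (h.int s) (approx_id (h.int s))
    (fun ε hε => cv_int (gH_cont hε) (gH_int hε) (h.gsq_int i s)) (h.gsq_int i s) (approx_id (h.gsq_int i s))
    (k := fun y => jdd δ ((exp s ^ N)⁻¹ * y) * (exp s ^ N)⁻¹) (K := 1 / δ * (exp s ^ N)⁻¹)
    (((jdd_cont hδ).comp (by fun_prop)).mul_const _) (fun y => by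
      have hcN : 0 < (exp s ^ N)⁻¹ := by positivity
      rw [abs_of_nonneg (mul_nonneg (jdd_nn _) hcN.le)]
      exact mul_le_mul_of_nonneg_right (jdd_le hδ _) hcN.le)
  exact h0.comp (div_tendsto (exp_pos s))

lemma GoodF.GGi_bd (h : GoodF N T M C f) {δ s : ℝ} (hδ : 0 < δ) (hs : s ≤ T) (i : Fin N) :
    ∫ y, (jdd δ ((exp s ^ N)⁻¹ * f s y) * (exp s ^ N)⁻¹) * gg f i s y ^ 2 ≤ δ * exp T ^ N * C := by
  have hcN : 0 < exp s ^ N := by positivity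
  have hle : exp s ^ N ≤ exp T ^ N := pow_le_pow_left₀ (exp_pos s).le (exp_le_exp.2 hs) N
  calc _ ≤ ∫ y, (δ * exp T ^ N) * (‖y‖ ^ 2 * f s y ^ 2) := by
        refine integral_mono_of_nonneg (Eventually.of_forall fun y => ?_) ((h.int2 s).const_mul _)
          (Eventually.of_forall fun y => ?_)
        · exact mul_nonneg (mul_nonneg (jdd_nn _) (by positivity)) (sq_nonneg _)
        · simp only [gg]
          have h1 := jdd_le' hδ ((exp s ^ N)⁻¹ * f s y)
          have h2 : (y i) ^ 2 ≤ ‖y‖ ^ 2 :=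
            sq_le_sq' (by linarith [abs_le.1 (coord_le y i)]) (abs_le.1 (coord_le y i)).2
          have e : jdd δ ((exp s ^ N)⁻¹ * f s y) * (exp s ^ N)⁻¹ * (y i * f s y ^ 2) ^ 2 =
            (jdd δ ((exp s ^ N)⁻¹ * f s y) * ((exp s ^ N)⁻¹ * f s y) ^ 2) * (exp s ^ N) * ((y i) ^ 2 * f s y ^ 2) := by
            field_simp
          rw [e]
          gcongr
    _ ≤ _ := by
        rw [integral_const_mul]
        exact mul_le_mul_of_nonneg_left (h.b2 s) (by positivity)

lemma GoodF.GG_lim (h : GoodF N T M C f) {δ s : ℝ} (hδ : 0 < δ) (hs : s ≤ T) :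
    Tendsto (fun η => max (GG f η δ s - 1 / 4 * (N * (δ * exp T ^ N * C))) 0) (𝓝[>] 0) (𝓝 0) := by
  set κ := 1 / 4 * (N * (δ * exp T ^ N * C)) with hκ
  have h1 := ((tendsto_finsetSum Finset.univ fun i _ => h.GGi_lim (s := s) hδ i).const_mul (1 / 4)).sub_const κ
  have h2 := h1.max (tendsto_const_nhds (x := (0 : ℝ)))
  have h3 : max (1 / 4 * (∑ i, ∫ y, (jdd δ ((exp s ^ N)⁻¹ * f s y) * (exp s ^ N)⁻¹) * gg f i s y ^ 2) - κ) 0 = 0 := by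
    refine max_eq_right (sub_nonpos.2 ?_)
    rw [hκ]
    refine mul_le_mul_of_nonneg_left ?_ (by norm_num)
    have hcst : (N : ℝ) * (δ * exp T ^ N * C) = ∑ i : Fin N, (δ * exp T ^ N * C) := by simp
    rw [hcst]
    exact Finset.sum_le_sum fun i _ => h.GGi_bd hδ hs i
  rw [h3] at h2
  refine squeeze_zero' (Eventually.of_forall fun η => le_max_right _ _) ?_ h2
  filter_upwards [self_mem_nhdsWithin] with η hη
  refine max_le_max (sub_le_sub_right ?_ _) le_rfl
  unfold GG
  exact mul_le_mul_of_nonneg_left (Finset.sum_le_sum fun i _ => h.GG_scaled hη hδ s i) (by norm_num)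

lemma jj_lip {δ : ℝ} (hδ : 0 < δ) (x y : ℝ) : |jj δ x - jj δ y| ≤ |x - y| := by
  have := Convex.norm_image_sub_le_of_norm_hasDerivWithin_le (f := jj δ) (f' := jd δ) (C := 1) (s := Set.univ)
    (x := y) (y := x) (fun z _ => (jj_deriv hδ z).hasDerivWithinAt) (fun z _ => jd_le hδ z) convex_univ
    (Set.mem_univ _) (Set.mem_univ _)
  simpa using this

lemma GoodF.jj_lim (h : GoodF N T M C f) {δ t : ℝ} (hδ : 0 < δ) :
    Tendsto (fun η => ∫ x, jj δ (uu f η t x)) (𝓝[>] 0)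
      (𝓝 (∫ y, exp t ^ N * jj δ ((exp t ^ N)⁻¹ * f t y))) := by
  have hc := exp_pos t
  have hcN : 0 < exp t ^ N := by positivity
  have key : ∀ u : Evec N → ℝ, Integrable u → Integrable fun y => exp t ^ N * jj δ ((exp t ^ N)⁻¹ * u y) := by
    intro u hu
    refine Integrable.const_mul ?_ _
    refine (hu.const_mul (exp t ^ N)⁻¹).abs.mono' (jj_cont.comp_aestronglyMeasurable (hu.const_mul _).1)
      (Eventually.of_forall fun y => ?_)
    rw [norm_of_nonneg (jj_nn _)]
    exact jj_le hδ _
  rw [tendsto_iff_norm_sub_tendsto_zero]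
  have h0 := (approx_id (h.int t)).comp (div_tendsto hc)
  refine squeeze_zero' (Eventually.of_forall fun η => norm_nonneg _) ?_ h0
  filter_upwards [self_mem_nhdsWithin] with η hη
  have hη : 0 < η := hη
  have hε : 0 < η / exp t ^ 2 := by positivity
  have hA := cv_int (c := 1) (gH_cont hε) (gH_int hε) (h.int t)
  have e : ∫ x, jj δ (uu f η t x) = ∫ y, exp t ^ N * jj δ ((exp t ^ N)⁻¹ * cv (gH N (η / exp t ^ 2)) 1 (f t) y) := by
    rw [← integral_dil _ (exp t) hc]
    refine integral_congr_ae (Eventually.of_forall fun y => ?_)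
    simp only [uu]
    rw [cv_scale hη hc]
  rw [e, ← integral_sub (key _ hA) (key _ (h.int t))]
  refine (norm_integral_le_integral_norm _).trans ?_
  refine integral_mono (((key _ hA).sub (key _ (h.int t))).norm) ((hA.sub (h.int t)).abs) fun y => ?_
  simp only [norm_eq_abs]
  rw [← mul_sub, abs_mul, abs_of_pos hcN]
  calc _ ≤ exp t ^ N * |(exp t ^ N)⁻¹ * cv (gH N (η / exp t ^ 2)) 1 (f t) y - (exp t ^ N)⁻¹ * f t y| :=
        mul_le_mul_of_nonneg_left (jj_lip hδ _ _) hcN.le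
    _ = _ := by
        rw [← mul_sub, abs_mul, abs_of_pos (inv_pos.2 hcN), ← mul_assoc, mul_inv_cancel₀ hcN.ne', one_mul]

lemma GoodF.energy_lim (h : GoodF N T M C f) {δ t : ℝ} (hδ : 0 < δ) (ht : t ∈ Set.Icc 0 T) :
    ∫ y, exp t ^ N * jj δ ((exp t ^ N)⁻¹ * f t y) ≤
      (∫ v, |f 0 v|) + t * (1 / 4 * (N * (δ * exp T ^ N * C))) := by
  set κ := 1 / 4 * (N * (δ * exp T ^ N * C)) with hκ
  have hκ0 : 0 ≤ κ := by have := h.hC; positivity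
  have hC := h.hC
  have hm : ∀ η, 0 < η → AEStronglyMeasurable (fun s => max (GG f η δ s - κ) 0) (volume.restrict (Set.Ioc 0 t)) :=
    fun η hη => (((h.GG_meas hη hδ).sub stronglyMeasurable_const).sup stronglyMeasurable_const).aestronglyMeasurable
  have hb : ∀ η, 0 < η → ∀ s, 0 ≤ s → ‖max (GG f η δ s - κ) 0‖ ≤ 1 / 4 * (N * (1 / δ * (M ^ 2 * C))) := by
    intro η hη s hs
    rw [norm_of_nonneg (le_max_right _ _)]
    refine max_le ?_ (by positivity)
    linarith [h.GG_le hη hδ hs]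
  have hlim : Tendsto (fun η => ∫ s in Set.Ioc 0 t, max (GG f η δ s - κ) 0) (𝓝[>] 0)
      (𝓝 (∫ s in Set.Ioc 0 t, (0 : ℝ))) := by
    refine tendsto_integral_filter_of_dominated_convergence (fun _ => 1 / 4 * (N * (1 / δ * (M ^ 2 * C)))) ?_ ?_
      (integrable_const _) ?_
    · filter_upwards [self_mem_nhdsWithin] with η hη using hm η hη
    · filter_upwards [self_mem_nhdsWithin] with η hη
      exact (ae_restrict_iff' measurableSet_Ioc).2 (Eventually.of_forall fun s hs => hb η hη s hs.1.le)
    · exact (ae_restrict_iff' measurableSet_Ioc).2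
        (Eventually.of_forall fun s hs => h.GG_lim hδ (hs.2.trans ht.2))
  rw [integral_zero] at hlim
  have hR := (hlim.add_const (t * κ)).const_add (∫ v, |f 0 v|)
  rw [zero_add] at hR
  refine le_of_tendsto_of_tendsto (h.jj_lim (t := t) hδ) hR ?_
  filter_upwards [self_mem_nhdsWithin] with η hη
  have hη : 0 < η := hη
  refine (h.energy hη hδ ht).trans (add_le_add_right ?_ _)
  rw [intervalIntegral.integral_of_le ht.1]
  have i1 : Integrable (fun s => max (GG f η δ s - κ) 0) (volume.restrict (Set.Ioc 0 t)) :=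
    (integrable_const (1 / 4 * (N * (1 / δ * (M ^ 2 * C))))).mono' (hm η hη)
      ((ae_restrict_iff' measurableSet_Ioc).2 (Eventually.of_forall fun s hs => hb η hη s hs.1.le))
  have i2 : Integrable (fun _ : ℝ => κ) (volume.restrict (Set.Ioc 0 t)) := integrable_const _
  have e : (∫ s in Set.Ioc 0 t, max (GG f η δ s - κ) 0) + t * κ = ∫ s in Set.Ioc 0 t, (max (GG f η δ s - κ) 0 + κ) := by
    rw [integral_add i1 i2]
    simp [ht.1]
  rw [e]
  refine integral_mono ((intervalIntegrable_iff_integrableOn_Ioc_of_le ht.1).1 (h.GG_ii hη hδ ht.1)) (i1.add i2)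
    fun s => ?_
  simp only
  linarith [le_max_left (GG f η δ s - κ) 0]

theorem GoodF.contraction (h : GoodF N T M C f) {t : ℝ} (ht : t ∈ Set.Icc 0 T) :
    ∫ v, |f t v| ≤ ∫ v, |f 0 v| := by
  have hcN : 0 < exp t ^ N := by positivity
  have h1 : Tendsto (fun δ => ∫ y, exp t ^ N * jj δ ((exp t ^ N)⁻¹ * f t y)) (𝓝[>] 0) (𝓝 (∫ v, |f t v|)) := by
    refine tendsto_integral_filter_of_dominated_convergence (fun v => |f t v|) ?_ ?_ (h.int t).abs ?_
    · filter_upwards with δ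
      exact (jj_cont.comp_aestronglyMeasurable ((h.int t).const_mul _).1).const_mul _
    · filter_upwards [self_mem_nhdsWithin] with δ hδ
      filter_upwards with y
      rw [norm_of_nonneg (mul_nonneg hcN.le (jj_nn _))]
      calc _ ≤ exp t ^ N * |(exp t ^ N)⁻¹ * f t y| := mul_le_mul_of_nonneg_left (jj_le hδ _) hcN.le
        _ = _ := by rw [abs_mul, abs_of_pos (inv_pos.2 hcN), ← mul_assoc, mul_inv_cancel₀ hcN.ne', one_mul]
    · filter_upwards with y
      have hc : Continuous fun δ : ℝ => exp t ^ N * jj δ ((exp t ^ N)⁻¹ * f t y) := by unfold jj; fun_prop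
      have h2 := hc.tendsto 0
      have e : exp t ^ N * jj 0 ((exp t ^ N)⁻¹ * f t y) = |f t y| := by
        simp only [jj]
        rw [zero_pow two_ne_zero, add_zero, sub_zero, sqrt_sq_eq_abs, abs_mul, abs_of_pos (inv_pos.2 hcN),
          ← mul_assoc, mul_inv_cancel₀ hcN.ne', one_mul]
      rw [e] at h2
      exact h2.mono_left nhdsWithin_le_nhds
  have h2 : Tendsto (fun δ : ℝ => (∫ v, |f 0 v|) + t * (1 / 4 * (N * (δ * exp T ^ N * C)))) (𝓝[>] 0)
      (𝓝 (∫ v, |f 0 v|)) := by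
    have hc : Continuous fun δ : ℝ => (∫ v, |f 0 v|) + t * (1 / 4 * (N * (δ * exp T ^ N * C))) := by fun_prop
    have := hc.tendsto 0
    simp only [zero_mul, mul_zero, add_zero] at this
    exact this.mono_left nhdsWithin_le_nhds
  refine le_of_tendsto_of_tendsto h1 h2 ?_
  filter_upwards [self_mem_nhdsWithin] with δ hδ
  exact h.energy_lim hδ ht
end lim


lemma ups_facts {N : ℕ} {p m : ℝ} (hm : 1 ≤ m) (hp2 : 2 ≤ p) {h : Evec N → ℝ} {R : ℝ} (hR : 0 ≤ R)
    (hmeas : AEStronglyMeasurable h volume) (hU : UpsilonNorm N p m h ≤ ENNReal.ofReal R) :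
    Integrable h ∧ (∀ᵐ v, |h v| ≤ R) ∧ Integrable (fun v => ‖v‖ * h v) ∧
    Integrable (fun v => ‖v‖ ^ 2 * h v ^ 2) ∧ (∫ v, |h v| ≤ R) ∧ (∫ v, ‖v‖ * |h v| ≤ R) ∧
    (∫ v, ‖v‖ ^ 2 * h v ^ 2 ≤ R + R ^ p) := by
  have u1 : eLpNorm h ⊤ volume ≤ ENNReal.ofReal R := (le_max_left _ _).trans hU
  have u2 : wLpNorm N 1 1 h ≤ ENNReal.ofReal R := ((le_max_left _ _).trans (le_max_right _ _)).trans hU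
  have u3 : wLpNorm N (ENNReal.ofReal p) m h ≤ ENNReal.ofReal R :=
    ((le_max_right _ _).trans (le_max_right _ _)).trans hU
  have wm : ∀ q : ℝ, 0 ≤ q → Continuous fun v : Evec N => 1 + ‖v‖ ^ q := fun q hq =>
    continuous_const.add (continuous_norm.rpow_const fun _ => Or.inr hq)
  have hp0 : 0 < p := by linarith
  have nmeas : AEStronglyMeasurable (fun v : Evec N => ‖v‖) volume := continuous_norm.aestronglyMeasurable
  have wn : ∀ q : ℝ, ∀ v : Evec N, 0 ≤ ‖v‖ ^ q := fun q v => rpow_nonneg (norm_nonneg v) q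
  -- first moment
  have k1 : MemLp (fun v => (1 + ‖v‖ ^ (1 : ℝ)) * h v) 1 volume :=
    ⟨(wm 1 zero_le_one).aestronglyMeasurable.mul hmeas, u2.trans_lt ENNReal.ofReal_lt_top⟩
  have i1 : Integrable (fun v => (1 + ‖v‖ ^ (1 : ℝ)) * h v) volume := memLp_one_iff_integrable.1 k1
  have b1 : ∫ v, |(1 + ‖v‖ ^ (1 : ℝ)) * h v| ≤ R := by
    have e := ofReal_integral_norm_eq_lintegral_enorm i1
    rw [wLpNorm, eLpNorm_one_eq_lintegral_enorm, ← e] at u2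
    exact (ENNReal.ofReal_le_ofReal_iff hR).1 u2
  have e1 : ∀ v, |(1 + ‖v‖ ^ (1 : ℝ)) * h v| = (1 + ‖v‖) * |h v| := fun v => by
    rw [abs_mul, rpow_one, abs_of_nonneg (by positivity)]
  -- p norm
  have hpe : (ENNReal.ofReal p).toReal = p := ENNReal.toReal_ofReal hp0.le
  have hpe0 : ENNReal.ofReal p ≠ 0 := by simpa using hp0
  have k3 : MemLp (fun v => (1 + ‖v‖ ^ m) * h v) (ENNReal.ofReal p) volume :=
    ⟨(wm m (by linarith)).aestronglyMeasurable.mul hmeas, u3.trans_lt ENNReal.ofReal_lt_top⟩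
  have i3 : Integrable (fun v => ‖(1 + ‖v‖ ^ m) * h v‖ ^ p) volume := by
    have := k3.integrable_norm_rpow hpe0 ENNReal.ofReal_ne_top
    rwa [hpe] at this
  have b3 : ∫ v, ‖(1 + ‖v‖ ^ m) * h v‖ ^ p ≤ R ^ p := by
    have hn : 0 ≤ ∫ v, ‖(1 + ‖v‖ ^ m) * h v‖ ^ p := integral_nonneg fun v => rpow_nonneg (norm_nonneg _) _
    rw [wLpNorm, k3.eLpNorm_eq_integral_rpow_norm hpe0 ENNReal.ofReal_ne_top, hpe,
      ENNReal.ofReal_le_ofReal_iff hR] at u3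
    have := rpow_le_rpow (rpow_nonneg hn _) u3 hp0.le
    rwa [← rpow_mul hn, inv_mul_cancel₀ hp0.ne', rpow_one] at this
  have i1a : Integrable (fun v => (1 + ‖v‖) * |h v|) volume := by
    refine i1.abs.congr (Eventually.of_forall fun v => ?_)
    exact e1 v
  have b1a : ∫ v, (1 + ‖v‖) * |h v| ≤ R := by
    simpa only [e1] using b1
  have sqle : ∀ v, ‖v‖ ^ 2 * h v ^ 2 ≤ (1 + ‖v‖) * |h v| + ‖(1 + ‖v‖ ^ m) * h v‖ ^ p := by
    intro v
    set a := ‖v‖ * |h v| with ha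
    have ha0 : 0 ≤ a := by positivity
    have ea : ‖v‖ ^ 2 * h v ^ 2 = a ^ 2 := by rw [ha, mul_pow, sq_abs]
    have hv : ‖v‖ ≤ 1 + ‖v‖ ^ m := by
      rcases le_total ‖v‖ 1 with h1 | h1
      · linarith [wn m v]
      · have := rpow_le_rpow_of_exponent_le h1 hm
        rw [rpow_one] at this; linarith
    have a1 : a ≤ (1 + ‖v‖) * |h v| := by
      rw [ha]; exact mul_le_mul_of_nonneg_right (by linarith) (abs_nonneg _)
    have a2 : a ≤ ‖(1 + ‖v‖ ^ m) * h v‖ := by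
      rw [norm_mul, norm_of_nonneg (by linarith [wn m v] : 0 ≤ 1 + ‖v‖ ^ m), ha]
      exact mul_le_mul_of_nonneg_right hv (abs_nonneg _)
    have a3 : a ^ p ≤ ‖(1 + ‖v‖ ^ m) * h v‖ ^ p := rpow_le_rpow ha0 a2 hp0.le
    rw [ea]
    rcases le_total a 1 with h1 | h1
    · have : a ^ 2 ≤ a := by nlinarith
      have := rpow_nonneg ha0 p
      linarith
    · have := rpow_le_rpow_of_exponent_le h1 hp2
      rw [rpow_two] at this
      linarith
  have i4 : Integrable (fun v => ‖v‖ ^ 2 * h v ^ 2) volume := by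
    refine (i1a.add i3).mono' ((nmeas.pow 2).mul (hmeas.pow 2)) (Eventually.of_forall fun v => ?_)
    rw [norm_of_nonneg (by positivity)]
    exact sqle v
  have ih : Integrable h := i1a.mono' hmeas (Eventually.of_forall fun v => by
    rw [norm_eq_abs]; nlinarith [norm_nonneg v, abs_nonneg (h v)])
  have ih1 : Integrable (fun v => ‖v‖ * h v) := i1a.mono' (nmeas.mul hmeas) (Eventually.of_forall fun v => by
    rw [norm_mul, norm_norm, norm_eq_abs]; nlinarith [norm_nonneg v, abs_nonneg (h v)])
  have ih1a : Integrable (fun v => ‖v‖ * |h v|) := by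
    refine ih1.abs.congr (Eventually.of_forall fun v => ?_)
    simp only [abs_mul, abs_norm]
  refine ⟨ih, ?_, ih1, i4, ?_, ?_, ?_⟩
  · rw [eLpNorm_exponent_top] at u1
    filter_upwards [ae_le_eLpNormEssSup (f := h) (μ := volume)] with v hv
    have := hv.trans u1
    rw [← ofReal_norm, ENNReal.ofReal_le_ofReal_iff hR] at this
    exact this
  · refine le_trans (integral_mono ih.abs i1a fun v => ?_) b1a
    simp only; nlinarith [norm_nonneg v, abs_nonneg (h v)]
  · refine le_trans (integral_mono ih1a i1a fun v => ?_) b1a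
    simp only; nlinarith [norm_nonneg v, abs_nonneg (h v)]
  · refine le_trans (integral_mono i4 (i1a.add i3) sqle) ?_
    have := integral_add i1a i3
    simp only [Pi.add_apply] at this ⊢
    rw [this]
    exact add_le_add b1a b3

lemma ups_tri {N : ℕ} {p m : ℝ} (hm : 1 ≤ m) (hp2 : 2 ≤ p) {g h : Evec N → ℝ}
    (hg : AEStronglyMeasurable g volume) (hh : AEStronglyMeasurable h volume) :
    UpsilonNorm N p m g ≤ UpsilonNorm N p m (fun v => g v - h v) + UpsilonNorm N p m h := by
  have wm : ∀ q : ℝ, 0 ≤ q → Continuous fun v : Evec N => 1 + ‖v‖ ^ q := fun q hq =>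
    continuous_const.add (continuous_norm.rpow_const fun _ => Or.inr hq)
  have key : ∀ (P : ℝ≥0∞) (q : ℝ), 1 ≤ P → 0 ≤ q →
      wLpNorm N P q g ≤ wLpNorm N P q (fun v => g v - h v) + wLpNorm N P q h := by
    intro P q hP hq
    have a1 : AEStronglyMeasurable (fun v => (1 + ‖v‖ ^ q) * (g v - h v)) volume :=
      (wm q hq).aestronglyMeasurable.mul (hg.sub hh)
    have a2 : AEStronglyMeasurable (fun v => (1 + ‖v‖ ^ q) * h v) volume :=
      (wm q hq).aestronglyMeasurable.mul hh
    have := eLpNorm_add_le a1 a2 hP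
    refine le_trans (le_of_eq ?_) this
    unfold wLpNorm
    congr 1
    ext v
    simp only [Pi.add_apply]; ring
  have key0 : eLpNorm g ⊤ volume ≤ eLpNorm (fun v => g v - h v) ⊤ volume + eLpNorm h ⊤ volume := by
    have := eLpNorm_add_le (p := ⊤) (hg.sub hh) hh le_top
    refine le_trans (le_of_eq ?_) this
    congr 1
    ext v
    simp
  have hpe : 1 ≤ ENNReal.ofReal p := by
    rw [← ENNReal.ofReal_one]; exact ENNReal.ofReal_le_ofReal (by linarith)
  unfold UpsilonNorm
  refine max_le ?_ (max_le ?_ ?_)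
  · exact key0.trans (add_le_add (le_max_left _ _) (le_max_left _ _))
  · exact (key 1 1 le_rfl zero_le_one).trans
      (add_le_add ((le_max_left _ _).trans (le_max_right _ _)) ((le_max_left _ _).trans (le_max_right _ _)))
  · exact (key _ m hpe (by linarith)).trans
      (add_le_add ((le_max_right _ _).trans (le_max_right _ _)) ((le_max_right _ _).trans (le_max_right _ _)))

lemma ups_unif {N : ℕ} {p m T : ℝ} (hm : 1 ≤ m) (hp2 : 2 ≤ p) {f : ℝ → Evec N → ℝ}
    (hf : ∀ t ∈ Set.Icc (0 : ℝ) T, MemUpsilon N p m (f t)) (hc : ContinuousInUpsilon N p m T f) :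
    ∃ R : ℝ, 0 ≤ R ∧ ∀ t ∈ Set.Icc (0 : ℝ) T, UpsilonNorm N p m (f t) ≤ ENNReal.ofReal R := by
  have key : ∃ R : ℝ≥0∞, R < ⊤ ∧ ∀ t ∈ Set.Icc (0 : ℝ) T, UpsilonNorm N p m (f t) ≤ R := by
    refine (isCompact_Icc (a := (0 : ℝ)) (b := T)).induction_on
      (p := fun S => ∃ R : ℝ≥0∞, R < ⊤ ∧ ∀ t ∈ S, UpsilonNorm N p m (f t) ≤ R) ?_ ?_ ?_ ?_
    · exact ⟨0, by simp, by simp⟩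
    · rintro s t hst ⟨R, hR, h⟩
      exact ⟨R, hR, fun u hu => h u (hst hu)⟩
    · rintro s t ⟨R, hR, h⟩ ⟨R', hR', h'⟩
      refine ⟨max R R', max_lt hR hR', ?_⟩
      rintro u (hu | hu)
      · exact (h u hu).trans (le_max_left _ _)
      · exact (h' u hu).trans (le_max_right _ _)
    · intro t0 ht0
      obtain ⟨δ, hδ, hd⟩ := hc t0 ht0 1 one_pos
      refine ⟨Set.Icc 0 T ∩ Metric.ball t0 δ, inter_mem_nhdsWithin _ (Metric.ball_mem_nhds t0 hδ),
        ENNReal.ofReal 1 + UpsilonNorm N p m (f t0), ?_, ?_⟩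
      · obtain ⟨_, a, b, c⟩ := hf t0 ht0
        exact ENNReal.add_lt_top.2 ⟨ENNReal.ofReal_lt_top, max_lt a (max_lt b c)⟩
      · rintro t ⟨ht, htb⟩
        refine (ups_tri hm hp2 (hf t ht).1 (hf t0 ht0).1).trans (add_le_add_left ?_ _)
        exact (hd t ht (by simpa [Real.dist_eq] using htb)).le
  obtain ⟨R, hR, h⟩ := key
  refine ⟨R.toReal, ENNReal.toReal_nonneg, fun t ht => ?_⟩
  rw [ENNReal.ofReal_toReal hR.ne]
  exact h t ht

lemma mkGood {N : ℕ} {p m T : ℝ} (hm : 1 ≤ m) (hp2 : 2 ≤ p) (hT : 0 < T) {f₀ : Evec N → ℝ}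
    {f : ℝ → Evec N → ℝ} (hf : IsMildSolution N p m T f₀ f) :
    ∃ M C, GoodF N T M C (fun s => f (max 0 (min s T))) := by
  obtain ⟨hU, hc, h0, hmild⟩ := hf
  obtain ⟨R, hR, hRb⟩ := ups_unif hm hp2 hU hc
  have hcl : ∀ s : ℝ, max 0 (min s T) ∈ Set.Icc 0 T := fun s =>
    ⟨le_max_left _ _, max_le hT.le (min_le_right _ _)⟩
  have hcle : ∀ s ∈ Set.Icc 0 T, max 0 (min s T) = s := fun s hs => by
    rw [min_eq_left hs.2, max_eq_right hs.1]
  have facts : ∀ s : ℝ, _ := fun s => ups_facts hm hp2 hR (hU _ (hcl s)).1 (hRb _ (hcl s))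
  have hRp : 0 ≤ R ^ p := rpow_nonneg hR p
  have hcont : ∀ s0 : ℝ, ∀ ε : ℝ, 0 < ε → ∀ᶠ s in 𝓝 s0,
      (∫ v, |f (max 0 (min s T)) v - f (max 0 (min s0 T)) v|) ≤ ε ∧
      (∫ v, ‖v‖ * |f (max 0 (min s T)) v - f (max 0 (min s0 T)) v|) ≤ ε := by
    intro s0 ε hε
    obtain ⟨δ, hδ, hd⟩ := hc _ (hcl s0) ε hε
    have hcc : Continuous fun s : ℝ => max 0 (min s T) := by fun_prop
    filter_upwards [(hcc.tendsto s0) (Metric.ball_mem_nhds _ hδ)] with s hs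
    have hs' : |max 0 (min s T) - max 0 (min s0 T)| < δ := by simpa [Real.dist_eq] using hs
    have := ups_facts hm hp2 hε.le ((hU _ (hcl s)).1.sub (hU _ (hcl s0)).1) (hd _ (hcl s) hs').le
    exact ⟨this.2.2.2.2.1, this.2.2.2.2.2.1⟩
  refine ⟨R, R + R ^ p, ⟨hR, by positivity, fun s => (facts s).1, fun s => (facts s).2.1,
    fun s => (facts s).2.2.1, fun s0 => ?_, fun s0 => ?_, fun s => (facts s).2.2.2.1,
    fun s => (facts s).2.2.2.2.1.trans (by linarith), fun s => (facts s).2.2.2.2.2.1.trans (by linarith),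
    fun s => (facts s).2.2.2.2.2.2, ?_⟩⟩
  · rw [Metric.tendsto_nhds]
    intro ε hε
    filter_upwards [hcont s0 (ε / 2) (by positivity)] with s hs
    rw [dist_zero_right, norm_of_nonneg (integral_nonneg fun _ => abs_nonneg _)]
    linarith [hs.1]
  · rw [Metric.tendsto_nhds]
    intro ε hε
    filter_upwards [hcont s0 (ε / 2) (by positivity)] with s hs
    rw [dist_zero_right, norm_of_nonneg (integral_nonneg fun _ => mul_nonneg (norm_nonneg _) (abs_nonneg _))]
    linarith [hs.2]
  · intro t ht
    filter_upwards [hmild t ht] with v hv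
    simp only [hcle t ⟨ht.1.le, ht.2⟩, hcle 0 ⟨le_rfl, hT.le⟩]
    rw [hv]
    congr 1
    · refine integral_congr_ae ?_
      filter_upwards [h0] with w hw
      rw [hw]
    · refine setIntegral_congr_fun measurableSet_Ioc fun s hs => ?_
      simp only [hcle s ⟨hs.1.le, hs.2.trans ht.2⟩]

/-- **Mass conservation (Lemma 2.10).** If `f ∈ X_T` solves the Cauchy problem with
non-negative initial condition `f₀ ∈ Υ`, then `‖f(t)‖₁ = ‖f₀‖₁` for all `t ∈ [0,T]`. -/
theorem mass_conservation
    (N : ℕ) (hN : 1 ≤ N) (m p T : ℝ) (hm : 1 ≤ m) (hpN : (N : ℝ) < p) (hp2 : 2 ≤ p)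
    (hT : 0 < T) (f₀ : Evec N → ℝ) (hf₀Ups : MemUpsilon N p m f₀)
    (hf₀pos : ∀ᵐ v : Evec N ∂volume, 0 ≤ f₀ v)
    (f : ℝ → Evec N → ℝ) (hf : MemXT N p m T f₀ f) :
    ∀ t ∈ Set.Icc (0 : ℝ) T, eLpNorm (f t) 1 volume = eLpNorm f₀ 1 volume := by
  obtain ⟨M, C, hG⟩ := mkGood hm hp2 hT hf.1
  intro t ht
  have h0T : (0 : ℝ) ∈ Set.Icc 0 T := ⟨le_rfl, hT.le⟩
  have hcle : ∀ s ∈ Set.Icc 0 T, max 0 (min s T) = s := fun s hs => by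
    rw [min_eq_left hs.2, max_eq_right hs.1]
  have e1 := hG.mass ht
  have e2 := hG.contraction ht
  have it := hG.int t
  have i0 := hG.int 0
  simp only [hcle t ht, hcle 0 h0T] at e1 e2 it i0
  have hae := hf.1.2.2.1
  have hnn : ∫ v, |f 0 v| = ∫ v, f 0 v := by
    refine integral_congr_ae ?_
    filter_upwards [hae, hf₀pos] with v h1 h2
    rw [h1, abs_of_nonneg h2]
  have h3 : ∫ v, f t v ≤ ∫ v, |f t v| := integral_mono it it.abs fun v => le_abs_self _
  have h4 : ∫ v, |f t v| = ∫ v, |f 0 v| := le_antisymm e2 (by rw [hnn, ← e1]; exact h3)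
  have e5 : ∀ g : Evec N → ℝ, Integrable g → eLpNorm g 1 volume = ENNReal.ofReal (∫ v, |g v|) := by
    intro g hg
    rw [eLpNorm_one_eq_lintegral_enorm]
    exact (ofReal_integral_norm_eq_lintegral_enorm hg).symm
  rw [e5 _ it, h4, ← e5 _ i0]
  exact eLpNorm_congr_ae hae
end
end

section
/- Let N ≥ 1 and ε ∈ (0,1). Then there exists a constant C_ε > 0 such that for every measurable g : ℝ^N → ℝ with 0 ≤ g ≤ 1 a.e. and ∫_{ℝ^N} |v|² g(v) dv < ∞, the function v ↦ s(g(v)) is integrable on ℝ^N and 0 ≤ −S(g) ≤ ε E(g) + C_ε. -/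
open MeasureTheory Real Filter
open scoped ENNReal NNReal Topology

noncomputable section

/-- `s(r) = (1-r)log(1-r) + r log r` (with the convention `log 0 = 0`, so `s(0)=s(1)=0`). -/
noncomputable def entFn (r : ℝ) : ℝ := (1 - r) * Real.log (1 - r) + r * Real.log r

/-- The entropy `S(g) = ∫ s(g(v)) dv`. -/
noncomputable def Sent (N : ℕ) (g : Evec N → ℝ) : ℝ := ∫ v : Evec N, entFn (g v)

/-- The kinetic energy `E(g) = (1/2) ∫ |v|² g(v) dv`. -/
noncomputable def Ekin (N : ℕ) (g : Evec N → ℝ) : ℝ := (1 / 2) * ∫ v : Evec N, ‖v‖ ^ 2 * g v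

/-- The free energy `H(g) = S(g) + E(g)`. -/
noncomputable def Hfun (N : ℕ) (g : Evec N → ℝ) : ℝ := Sent N g + Ekin N g

/-- The Fermi-Dirac distribution `F^β(v) = (1 + β e^{|v|²/2})⁻¹`. -/
noncomputable def FD (N : ℕ) (β : ℝ) (v : Evec N) : ℝ := (1 + β * exp (‖v‖ ^ 2 / 2))⁻¹

/-- `β(M)`: the unique `β > 0` such that `F^β` has mass `M` (chosen via `Classical.epsilon`). -/
noncomputable def betaOf (N : ℕ) (M : ℝ) : ℝ :=
  Classical.epsilon (fun β : ℝ => 0 < β ∧ ∫ v : Evec N, FD N β v = M)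

/-- The Fermi-Dirac equilibrium `F_M = F^{β(M)}` of mass `M`. -/
noncomputable def FDM (N : ℕ) (M : ℝ) : Evec N → ℝ := FD N (betaOf N M)


theorem entFn_nonpos_aux {r : ℝ} (h0 : 0 ≤ r) (h1 : r ≤ 1) : 0 ≤ -entFn r := by
  have a : (1 - r) * Real.log (1 - r) ≤ 0 :=
    mul_nonpos_of_nonneg_of_nonpos (by linarith) (Real.log_nonpos (by linarith) (by linarith))
  have b : r * Real.log r ≤ 0 :=
    mul_nonpos_of_nonneg_of_nonpos h0 (Real.log_nonpos h0 h1)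
  unfold entFn
  linarith

theorem mul_log_aux {r : ℝ} (h0 : 0 ≤ r) (a : ℝ) :
    -(r * Real.log r) ≤ a * r + Real.exp (-a) - r := by
  rcases h0.eq_or_lt with h | h
  · subst h
    simp [Real.exp_nonneg]
  · have k := Real.add_one_le_exp (-a - Real.log r)
    rw [Real.exp_sub, Real.exp_log h, le_div_iff₀ h] at k
    linarith

theorem entFn_bound_aux {r : ℝ} (h0 : 0 ≤ r) (h1 : r ≤ 1) (a : ℝ) :
    -entFn r ≤ a * r + Real.exp (-a) := by
  have k := mul_log_aux h0 a
  have l := mul_log_aux (sub_nonneg.2 h1) 0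
  simp at l
  unfold entFn
  linarith

theorem gauss_aux (N : ℕ) {b : ℝ} (hb : 0 < b) :
    Integrable (fun v : Evec N => Real.exp (-(b * ‖v‖ ^ 2))) volume := by
  have h := (GaussianFourier.integrable_cexp_neg_mul_sq_norm_add (b := (b : ℂ)) (by simpa using hb)
    0 (0 : Evec N)).norm
  refine h.congr (Eventually.of_forall fun v => ?_)
  simp only [Complex.norm_exp]
  congr 1
  simp [← Complex.ofReal_pow]

/-- **Entropy control (Lemma 3.1).** For `ε ∈ (0,1)` there is `C_ε > 0` such that
`0 ≤ -S(g) ≤ ε E(g) + C_ε` for every measurable `g : ℝ^N → [0,1]` with finite kinetic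
energy; in particular `v ↦ s(g(v))` is integrable. -/
theorem entropy_control
    (N : ℕ) (hN : 1 ≤ N) (ε : ℝ) (hε : ε ∈ Set.Ioo (0 : ℝ) 1) :
    ∃ C : ℝ, 0 < C ∧ ∀ g : Evec N → ℝ, Measurable g →
      (∀ᵐ v : Evec N ∂volume, 0 ≤ g v ∧ g v ≤ 1) →
      Integrable (fun v : Evec N => ‖v‖ ^ 2 * g v) volume →
      Integrable (fun v : Evec N => entFn (g v)) volume ∧
      0 ≤ -Sent N g ∧ -Sent N g ≤ ε * Ekin N g + C := by
  have hε0 : 0 < ε / 2 := by have := hε.1; linarith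
  have hG := gauss_aux N hε0
  have hG0 : 0 ≤ ∫ v : Evec N, Real.exp (-(ε / 2 * ‖v‖ ^ 2)) :=
    integral_nonneg fun v => Real.exp_nonneg _
  refine ⟨(∫ v : Evec N, Real.exp (-(ε / 2 * ‖v‖ ^ 2))) + 1, by linarith, ?_⟩
  intro g hg h01 hE
  have hE' := hE.const_mul (ε / 2)
  have hpos : ∀ᵐ v : Evec N ∂volume, 0 ≤ -entFn (g v) := by
    filter_upwards [h01] with v hv using entFn_nonpos_aux hv.1 hv.2
  have hle : ∀ᵐ v : Evec N ∂volume, -entFn (g v) ≤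
      ε / 2 * (‖v‖ ^ 2 * g v) + Real.exp (-(ε / 2 * ‖v‖ ^ 2)) := by
    filter_upwards [h01] with v hv
    have := entFn_bound_aux hv.1 hv.2 (ε / 2 * ‖v‖ ^ 2)
    linarith
  have hm : Measurable (fun v : Evec N => entFn (g v)) := by
    unfold entFn
    fun_prop
  have hI : Integrable (fun v : Evec N => entFn (g v)) volume := by
    refine (hE'.add hG).mono' hm.aestronglyMeasurable ?_
    filter_upwards [hpos, hle] with v h1 h2
    rw [Real.norm_eq_abs, abs_of_nonpos (by linarith)]
    exact h2
  refine ⟨hI, ?_, ?_⟩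
  · unfold Sent
    rw [← integral_neg]
    exact integral_nonneg_of_ae hpos
  · unfold Sent Ekin
    rw [← integral_neg]
    have k := integral_mono_ae hI.neg (hE'.add hG) hle
    simp only [Pi.add_apply, Pi.neg_apply] at k
    rw [integral_add hE' hG, integral_const_mul] at k
    linarith
end
end

section
/- Let N ≥ 1, 1 ≤ q ≤ p ≤ ∞, m ≥ 0 and k ∈ ℕ. Then there exists a constant C > 0, depending only on N, p, q, m and k, such that for every t > 0, every f ∈ L^q_m(ℝ^N) and every multi-index α ∈ ℕ^N with |α| = k, ‖∂^α_v 𝓕(t)[f]‖_{L^p_m} ≤ C e^{(N(1 − 1/p) + k)t} ν(t)^{−(N/2)(1/q − 1/p) − k/2} ‖f‖_{L^q_m}, where ν(t) := e^{2t} − 1. -/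
open MeasureTheory Real Filter
open scoped ENNReal NNReal Topology

noncomputable section


/-- Iterated partial derivatives `∂^α_v` in the coordinate directions listed in `l`;
a multi-index `α` with `|α| = k` corresponds to such a list of length `k`. -/
noncomputable def partialDerivSeq (N : ℕ) : List (Fin N) → (Evec N → ℝ) → Evec N → ℝ
  | [], g => g
  | i :: l, g => fun v =>
      fderiv ℝ (partialDerivSeq N l g) v (EuclideanSpace.single i 1)

def gE (N : ℕ) (x : Evec N) : ℝ := exp (-‖x‖ ^ 2 / 2)

lemma gE_pos (N : ℕ) (x : Evec N) : 0 < gE N x := exp_pos _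

lemma gE_hasFDerivAt (N : ℕ) (x : Evec N) :
    HasFDerivAt (gE N) (-(gE N x) • innerSL ℝ x) x := by
  have h1 : HasFDerivAt (fun x : Evec N => ‖x‖ ^ 2) (2 • innerSL ℝ x) x :=
    (hasStrictFDerivAt_norm_sq x).hasFDerivAt
  have h2 : HasFDerivAt (fun x : Evec N => -‖x‖ ^ 2 / 2) ((-(1/2 : ℝ)) • (2 • innerSL ℝ x)) x := by
    have := h1.const_mul (-(1/2 : ℝ))
    refine this.congr_of_eventuallyEq (Eventually.of_forall fun y => ?_)
    simp only; ring
  have h3 := h2.exp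
  refine h3.congr_fderiv ?_
  ext y
  simp [gE]

lemma gE_contDiff (N : ℕ) : ContDiff ℝ ⊤ (gE N) := by
  unfold gE
  have : ContDiff ℝ ⊤ (fun x : Evec N => ‖x‖ ^ 2) := contDiff_norm_sq ℝ
  exact ((this.neg).div_const 2).exp

lemma htg_fderiv {N : ℕ} {Q : Evec N → ℝ} (h : Q.HasTemperateGrowth) :
    (fderiv ℝ Q).HasTemperateGrowth := by
  refine ⟨h.1.fderiv_right (by simp), fun n => ?_⟩
  obtain ⟨k, C, hk⟩ := h.2 (n + 1)
  refine ⟨k, C, fun x => ?_⟩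
  rw [norm_iteratedFDeriv_fderiv]
  exact hk x

lemma htg_bound {N : ℕ} {F : Type*} [NormedAddCommGroup F] [NormedSpace ℝ F] {Q : Evec N → F}
    (h : Q.HasTemperateGrowth) : ∃ (k : ℕ) (C : ℝ), 0 ≤ C ∧ ∀ x, ‖Q x‖ ≤ C * (1 + ‖x‖) ^ k := by
  obtain ⟨k, C, hC, hk⟩ := h.norm_iteratedFDeriv_le_uniform 0
  exact ⟨k, C, hC, fun x => by simpa using hk 0 le_rfl x⟩

lemma hasFDerivAt_mul_gE {N : ℕ} {Q : Evec N → ℝ} (hQ : Q.HasTemperateGrowth) (x : Evec N) :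
    HasFDerivAt (fun x => Q x * gE N x)
      (Q x • (-(gE N x) • innerSL ℝ x) + gE N x • fderiv ℝ Q x) x := by
  have h1 : HasFDerivAt Q (fderiv ℝ Q x) x :=
    ((hQ.1.differentiable (by simp)) x).hasFDerivAt
  exact h1.mul (gE_hasFDerivAt N x)

lemma pds_gE (N : ℕ) (l : List (Fin N)) :
    ∃ Q : Evec N → ℝ, Q.HasTemperateGrowth ∧
      partialDerivSeq N l (gE N) = fun x => Q x * gE N x := by
  induction l with
  | nil => exact ⟨fun _ => 1, .const 1, by simp [partialDerivSeq]⟩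
  | cons i l ih =>
    obtain ⟨Q, hQ, h⟩ := ih
    refine ⟨fun x => fderiv ℝ Q x (EuclideanSpace.single i 1) -
      inner ℝ x (EuclideanSpace.single i 1) * Q x, ?_, ?_⟩
    · have h1 : (fun x => fderiv ℝ Q x (EuclideanSpace.single i 1)).HasTemperateGrowth :=
        ((ContinuousLinearMap.apply ℝ ℝ
          (EuclideanSpace.single i (1:ℝ) : Evec N)).hasTemperateGrowth).comp (htg_fderiv hQ)
      have h2 := (Function.hasTemperateGrowth_inner_left
        (EuclideanSpace.single i (1:ℝ) : Evec N)).mul hQ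
      exact h1.sub h2
    · funext x
      simp only [partialDerivSeq]
      rw [h, (hasFDerivAt_mul_gE hQ x).fderiv]
      simp only [_root_.add_apply, _root_.smul_apply,
        innerSL_apply_apply, smul_eq_mul]
      ring

lemma gE_decay (N : ℕ) (M : ℕ) : ∃ C : ℝ, 0 < C ∧ ∀ x, (1 + ‖x‖) ^ M * gE N x ≤ C := by
  refine ⟨M.factorial * exp (3/2), by positivity, fun x => ?_⟩
  have h1 := Real.pow_div_factorial_le_exp (1 + ‖x‖) (by positivity) M
  rw [div_le_iff₀ (by positivity)] at h1
  calc _ ≤ (exp (1 + ‖x‖) * M.factorial) * gE N x := by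
        gcongr; exact (gE_pos N x).le
    _ = M.factorial * exp (1 + ‖x‖ + -‖x‖^2/2) := by rw [gE, Real.exp_add (1 + ‖x‖)]; ring
    _ ≤ _ := by
      gcongr
      nlinarith [sq_nonneg (‖x‖ - 1)]

lemma pds_gE_props (N : ℕ) (l : List (Fin N)) (M : ℕ) :
    ContDiff ℝ 1 (partialDerivSeq N l (gE N)) ∧
    ∃ C : ℝ, 0 < C ∧ ∀ x, |partialDerivSeq N l (gE N) x| ≤ C * ((1 + ‖x‖) ^ M)⁻¹ ∧
      ‖fderiv ℝ (partialDerivSeq N l (gE N)) x‖ ≤ C * ((1 + ‖x‖) ^ M)⁻¹ := by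
  obtain ⟨Q, hQ, h⟩ := pds_gE N l
  rw [h]
  refine ⟨((hQ.1.of_le (by simp)).mul ((gE_contDiff N).of_le (by simp))), ?_⟩
  obtain ⟨k1, C1, hC1, h1⟩ := htg_bound hQ
  obtain ⟨k2, C2, hC2, h2⟩ := htg_bound (htg_fderiv hQ)
  obtain ⟨D1, hD1, d1⟩ := gE_decay N (M + k1 + 1)
  obtain ⟨D2, hD2, d2⟩ := gE_decay N (M + k2)
  refine ⟨C1 * D1 + C2 * D2 + 1, by positivity, fun x => ?_⟩
  have hx : 0 ≤ ‖x‖ := norm_nonneg x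
  have hg := gE_pos N x
  have hp : 0 < (1 + ‖x‖) ^ M := by positivity
  rw [(hasFDerivAt_mul_gE hQ x).fderiv, ← div_eq_mul_inv, le_div_iff₀ hp, le_div_iff₀ hp]
  have a1 : |Q x| * gE N x * (1 + ‖x‖) * (1 + ‖x‖) ^ M ≤ C1 * D1 := by
    calc _ ≤ (C1 * (1 + ‖x‖) ^ k1) * gE N x * (1 + ‖x‖) * (1 + ‖x‖) ^ M := by
          gcongr; exact h1 x
      _ = C1 * ((1 + ‖x‖) ^ (M + k1 + 1) * gE N x) := by ring
      _ ≤ _ := by gcongr; exact d1 x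
  have a2 : ‖fderiv ℝ Q x‖ * gE N x * (1 + ‖x‖) ^ M ≤ C2 * D2 := by
    calc _ ≤ (C2 * (1 + ‖x‖) ^ k2) * gE N x * (1 + ‖x‖) ^ M := by
          gcongr; exact h2 x
      _ = C2 * ((1 + ‖x‖) ^ (M + k2) * gE N x) := by ring
      _ ≤ _ := by gcongr; exact d2 x
  have a3 : 0 ≤ |Q x| * gE N x * (1 + ‖x‖) ^ M := by positivity
  have a4 : 0 ≤ |Q x| * gE N x * (1 + ‖x‖) ^ M * ‖x‖ := by positivity
  have a5 : 0 ≤ C1 * D1 := by positivity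
  have a6 : 0 ≤ C2 * D2 := by positivity
  constructor
  · rw [abs_mul, abs_of_pos hg]
    nlinarith
  · have : ‖Q x • (-(gE N x) • innerSL ℝ x) + gE N x • fderiv ℝ Q x‖ ≤
        |Q x| * gE N x * ‖x‖ + gE N x * ‖fderiv ℝ Q x‖ := by
      refine (norm_add_le _ _).trans ?_
      rw [norm_smul, norm_smul, norm_smul, innerSL_apply_norm, norm_neg, Real.norm_eq_abs,
        Real.norm_eq_abs, abs_of_pos hg, mul_assoc]
    calc _ ≤ (|Q x| * gE N x * ‖x‖ + gE N x * ‖fderiv ℝ Q x‖) * (1 + ‖x‖) ^ M := by gcongr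
      _ ≤ _ := by nlinarith

open Module in
lemma eLpNorm_dil (N : ℕ) (p : ℝ≥0∞) {ε : Type*} [TopologicalSpace ε] [ContinuousENorm ε]
    (f : Evec N → ε) {r : ℝ} (hr : 0 < r) :
    eLpNorm (fun v => f (r • v)) p volume =
      ENNReal.ofReal (r ^ (-(N : ℝ) * (1 / p).toReal)) * eLpNorm f p volume := by
  have he : MeasurableEmbedding (fun v : Evec N => r • v) := measurableEmbedding_const_smul₀ hr.ne'
  have h1 := he.eLpNorm_map_measure (g := f) (p := p) (μ := volume)
  rw [Measure.map_addHaar_smul _ hr.ne', eLpNorm_smul_measure_of_ne_zero] at h1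
  · have h2 : (f ∘ fun v : Evec N => r • v) = fun v => f (r • v) := rfl
    rw [h2] at h1
    rw [← h1, smul_eq_mul, ENNReal.ofReal_rpow_of_pos (by positivity)]
    congr 2
    rw [abs_of_pos (by positivity), finrank_euclideanSpace, Fintype.card_fin, ← Real.rpow_natCast,
      ← Real.rpow_neg hr.le, ← Real.rpow_mul hr.le]
  · simp only [ne_eq, ENNReal.ofReal_eq_zero, not_le]
    positivity

lemma jensen_conv {N : ℕ} {q : ℝ≥0∞} (hq : 1 ≤ q) {Ψ : Evec N → ℝ≥0∞} (hΨ : Measurable Ψ)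
    {B : ℝ≥0∞} (hΨB : ∫⁻ y, Ψ y ≤ B) {g : Evec N → ℝ}
    (hg : AEStronglyMeasurable g volume) :
    ∫⁻ y, Ψ y * ‖g y‖ₑ ≤ B ^ (1 - 1 / q.toReal) * eLpNorm g q (volume.withDensity Ψ) := by
  have hac : volume.withDensity Ψ ≪ volume := withDensity_absolutelyContinuous _ _
  have h := eLpNorm_le_eLpNorm_mul_rpow_measure_univ hq (hg.mono_ac hac)
  rw [eLpNorm_one_eq_lintegral_enorm, lintegral_withDensity_eq_lintegral_mul₀ hΨ.aemeasurable hg.enorm] at h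
  refine h.trans ?_
  rw [mul_comm]
  have hexp : 0 ≤ 1 - 1 / q.toReal := by
    rcases eq_or_ne q ⊤ with rfl | hqt
    · simp
    · have : 1 ≤ q.toReal := by
        rw [← ENNReal.toReal_one]; exact ENNReal.toReal_mono hqt hq
      rw [sub_nonneg, div_le_one (by linarith)]; exact this
  simp only [ENNReal.toReal_one, div_one] at *
  gcongr
  simpa using hΨB

lemma sup_conv {N : ℕ} {q : ℝ≥0∞} (hq : 1 ≤ q) {Ψ : Evec N → ℝ≥0∞} (hΨ : Measurable Ψ)
    (hΨ1 : ∀ x, Ψ x ≤ 1)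
    {B : ℝ≥0∞} (hB : 1 ≤ B) (hΨB : ∫⁻ y, Ψ y ≤ B) {g : Evec N → ℝ}
    (hg : AEStronglyMeasurable g volume) :
    ∫⁻ y, Ψ y * ‖g y‖ₑ ≤ B * eLpNorm g q volume := by
  refine (jensen_conv hq hΨ hΨB hg).trans ?_
  gcongr
  · calc B ^ (1 - 1 / q.toReal) ≤ B ^ (1:ℝ) := by
          apply ENNReal.rpow_le_rpow_of_exponent_le hB
          have : 0 ≤ 1 / q.toReal := by positivity
          linarith
      _ = B := ENNReal.rpow_one B
  · calc volume.withDensity Ψ ≤ volume.withDensity 1 := withDensity_mono (Eventually.of_forall hΨ1)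
      _ = volume := withDensity_one

lemma young_qq {N : ℕ} {q : ℝ≥0∞} (hq : 1 ≤ q) (hqt : q ≠ ⊤) {Φ : Evec N → ℝ≥0∞} (hΦ : Measurable Φ)
    {B : ℝ≥0∞} (hB : 1 ≤ B) (hBt : B ≠ ⊤) (hΦB : ∫⁻ y, Φ y ≤ B) {g : Evec N → ℝ}
    (hg : AEStronglyMeasurable g volume) :
    ∫⁻ u, (∫⁻ y, Φ (u - y) * ‖g y‖ₑ) ^ q.toReal ≤ (B * eLpNorm g q volume) ^ q.toReal := by
  have hq1 : 1 ≤ q.toReal := by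
    rw [← ENNReal.toReal_one]; exact ENNReal.toReal_mono hqt hq
  have hq0 : q ≠ 0 := by rintro rfl; simp at hq
  set r := q.toReal with hr
  have hmeas : ∀ u, Measurable (fun y => Φ (u - y)) := fun u => hΦ.comp (by fun_prop)
  have hint : ∀ u, ∫⁻ y, Φ (u - y) ≤ B := fun u => by
    rw [lintegral_sub_left_eq_self]; exact hΦB
  have hac : ∀ u, volume.withDensity (fun y => Φ (u - y)) ≪ (volume : Measure (Evec N)) :=
    fun u => withDensity_absolutelyContinuous _ _
  have key : ∀ u, (∫⁻ y, Φ (u - y) * ‖g y‖ₑ) ^ r ≤ B ^ (r - 1) * ∫⁻ y, Φ (u - y) * ‖g y‖ₑ ^ r := by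
    intro u
    have h := jensen_conv hq (hmeas u) (hint u) hg
    rw [eLpNorm_eq_lintegral_rpow_enorm_toReal hq0 hqt, ← hr,
      lintegral_withDensity_eq_lintegral_mul₀ (hmeas u).aemeasurable (hg.enorm.pow_const r)] at h
    calc _ ≤ (_) ^ r := ENNReal.rpow_le_rpow h (by linarith)
      _ = _ := by
        rw [ENNReal.mul_rpow_of_nonneg _ _ (by linarith), ← ENNReal.rpow_mul, ← ENNReal.rpow_mul]
        have e1 : (1 - 1 / r) * r = r - 1 := by field_simp
        have e2 : 1 / r * r = 1 := by field_simp
        rw [e1, e2, ENNReal.rpow_one]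
        rfl
  calc _ ≤ ∫⁻ u, B ^ (r - 1) * ∫⁻ y, Φ (u - y) * ‖g y‖ₑ ^ r := lintegral_mono key
    _ = B ^ (r - 1) * ∫⁻ u, ∫⁻ y, Φ (u - y) * ‖g y‖ₑ ^ r := by
        rw [lintegral_const_mul' _ _ (ENNReal.rpow_ne_top_of_nonneg (by linarith) hBt)]
    _ = B ^ (r - 1) * ∫⁻ y, ∫⁻ u, Φ (u - y) * ‖g y‖ₑ ^ r := by
        rw [lintegral_lintegral_swap]
        apply AEMeasurable.mul
        · exact (hΦ.comp (measurable_fst.sub measurable_snd)).aemeasurable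
        · exact (hg.enorm.pow_const r).comp_snd
    _ = B ^ (r - 1) * ∫⁻ y, (∫⁻ u, Φ u) * ‖g y‖ₑ ^ r := by
        congr 2; funext y
        rw [lintegral_mul_const _ (show Measurable (fun u => Φ (u - y)) from hΦ.comp (by fun_prop)),
          lintegral_sub_right_eq_self]
    _ ≤ B ^ (r - 1) * ∫⁻ y, B * ‖g y‖ₑ ^ r := by gcongr
    _ = B ^ (r - 1) * (B * ∫⁻ y, ‖g y‖ₑ ^ r) := by rw [lintegral_const_mul' _ _ hBt]
    _ = _ := by
        rw [eLpNorm_eq_lintegral_rpow_enorm_toReal hq0 hqt, ← hr,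
          ENNReal.mul_rpow_of_nonneg _ _ (by linarith), ← ENNReal.rpow_mul]
        have e2 : 1 / r * r = 1 := by field_simp
        rw [e2, ENNReal.rpow_one, ← mul_assoc]
        congr 1
        nth_rewrite 2 [← ENNReal.rpow_one B]
        rw [← ENNReal.rpow_add_of_nonneg _ _ (by linarith) (by linarith)]
        congr 1; ring

lemma young {N : ℕ} {p q : ℝ≥0∞} (hq : 1 ≤ q) (hqp : q ≤ p) {Φ : Evec N → ℝ≥0∞} (hΦ : Measurable Φ)
    (hΦ1 : ∀ x, Φ x ≤ 1)
    {B : ℝ≥0∞} (hB : 1 ≤ B) (hBt : B ≠ ⊤) (hΦB : ∫⁻ y, Φ y ≤ B) {g : Evec N → ℝ}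
    (hg : AEStronglyMeasurable g volume) :
    eLpNorm (fun u => ∫⁻ y, Φ (u - y) * ‖g y‖ₑ) p volume ≤ B * eLpNorm g q volume := by
  have hsup : ∀ u, ∫⁻ y, Φ (u - y) * ‖g y‖ₑ ≤ B * eLpNorm g q volume := fun u =>
    sup_conv hq (show Measurable (fun y => Φ (u - y)) from hΦ.comp (by fun_prop)) (fun y => hΦ1 _) hB
      (by rw [lintegral_sub_left_eq_self]; exact hΦB) hg
  rcases eq_or_ne p ⊤ with rfl | hpt
  · rw [eLpNorm_exponent_top]
    exact essSup_le_of_ae_le _ (Eventually.of_forall fun u => by simpa using hsup u)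
  have hqt : q ≠ ⊤ := ne_top_of_le_ne_top hpt hqp
  have hq1 : 1 ≤ q.toReal := by
    rw [← ENNReal.toReal_one]; exact ENNReal.toReal_mono hqt hq
  have hqpr : q.toReal ≤ p.toReal := ENNReal.toReal_mono hpt hqp
  have hp0 : p ≠ 0 := by rintro rfl; simp at hqp; simp [hqp] at hq
  have hY := young_qq hq hqt hΦ hB hBt hΦB hg
  set A := B * eLpNorm g q volume
  rw [eLpNorm_eq_lintegral_rpow_enorm_toReal hp0 hpt]
  simp only [enorm_eq_self]
  rcases eq_or_ne A ⊤ with hA | hA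
  · rw [hA]; exact le_top
  have : ∫⁻ u, (∫⁻ y, Φ (u - y) * ‖g y‖ₑ) ^ p.toReal ≤ A ^ p.toReal := by
    calc _ ≤ ∫⁻ u, A ^ (p.toReal - q.toReal) * (∫⁻ y, Φ (u - y) * ‖g y‖ₑ) ^ q.toReal := by
          apply lintegral_mono
          intro u
          have e : p.toReal = (p.toReal - q.toReal) + q.toReal := by ring
          simp only
          nth_rewrite 1 [e]
          rw [ENNReal.rpow_add_of_nonneg _ _ (by linarith) (by linarith)]
          gcongr
          exact hsup u
      _ = A ^ (p.toReal - q.toReal) * ∫⁻ u, (∫⁻ y, Φ (u - y) * ‖g y‖ₑ) ^ q.toReal := by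
          rw [lintegral_const_mul' _ _ (ENNReal.rpow_ne_top_of_nonneg (by linarith) hA)]
      _ ≤ A ^ (p.toReal - q.toReal) * A ^ q.toReal := by gcongr
      _ = _ := by
          rw [← ENNReal.rpow_add_of_nonneg _ _ (by linarith) (by linarith)]
          congr 1; ring
  calc _ ≤ (A ^ p.toReal) ^ (1 / p.toReal) := ENNReal.rpow_le_rpow this (by positivity)
    _ = A := by
      rw [← ENNReal.rpow_mul, mul_one_div_cancel (by linarith), ENNReal.rpow_one]

def Jd (N : ℕ) (x : Evec N) : ℝ := ((1 + ‖x‖) ^ (N + 1))⁻¹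

lemma Jd_pos (N : ℕ) (x : Evec N) : 0 < Jd N x := by unfold Jd; positivity

lemma Jd_le_one (N : ℕ) (x : Evec N) : Jd N x ≤ 1 := by
  unfold Jd
  apply inv_le_one_of_one_le₀
  exact one_le_pow₀ (by linarith [norm_nonneg x])

lemma Jd_cont (N : ℕ) : Continuous (Jd N) := by
  unfold Jd
  apply Continuous.inv₀ (by fun_prop)
  intro x; positivity

lemma Jd_integrable (N : ℕ) : Integrable (Jd N) := by
  have := integrable_one_add_norm (E := Evec N) (μ := volume) (r := (N : ℝ) + 1) (by simp)
  refine this.congr (Eventually.of_forall fun x => ?_)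
  simp only [Jd]
  rw [Real.rpow_neg (by positivity), ← Real.rpow_natCast]
  push_cast; rfl

lemma Jd_shift (N : ℕ) (x y : Evec N) : Jd N x ≤ (1 + ‖x - y‖) ^ (N + 1) * Jd N y := by
  unfold Jd
  rw [← div_eq_mul_inv, le_div_iff₀ (by positivity), inv_mul_le_iff₀ (by positivity), ← mul_pow]
  gcongr
  have h1 : ‖y‖ ≤ ‖x‖ + ‖x - y‖ := by
    have := norm_sub_le x (x - y); simpa using this
  nlinarith [norm_nonneg x, norm_nonneg (x - y), mul_nonneg (norm_nonneg x) (norm_nonneg (x - y))]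

lemma Jd_aff_integrable (N : ℕ) (u : Evec N) {b : ℝ} (hb : b ≠ 0) :
    Integrable (fun w => Jd N (u - b • w)) := by
  have h1 : Integrable (fun w => Jd N (u - w)) := (Jd_integrable N).comp_sub_left u
  exact h1.comp_smul hb

lemma Jd_mul_integrable {N : ℕ} {q : ℝ≥0∞} (hq : 1 ≤ q) (u : Evec N) {b : ℝ} (hb : b ≠ 0)
    {f : Evec N → ℝ} (hf : AEStronglyMeasurable f volume) (hfq : eLpNorm f q volume < ⊤) :
    Integrable (fun w => Jd N (u - b • w) * f w) := by
  have hc : Continuous (fun w => Jd N (u - b • w)) := (Jd_cont N).comp (by fun_prop)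
  refine ⟨hc.aestronglyMeasurable.mul hf, ?_⟩
  have hi := (Jd_aff_integrable N u hb).2
  unfold HasFiniteIntegral at hi ⊢
  simp only [enorm_mul]
  refine (sup_conv (B := 1 + ∫⁻ w, ‖Jd N (u - b • w)‖ₑ) hq hc.measurable.enorm
    (fun w => ?_) le_self_add le_add_self hf).trans_lt ?_
  · rw [Real.enorm_eq_ofReal (Jd_pos _ _).le]
    simpa using Jd_le_one N _
  · exact ENNReal.mul_lt_top (by simpa using hi) hfq

lemma conv_hasFDerivAt {N : ℕ} {q : ℝ≥0∞} (hq : 1 ≤ q) (a : ℝ) {b : ℝ} (hb : b ≠ 0)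
    {f : Evec N → ℝ} (hf : AEStronglyMeasurable f volume) (hfq : eLpNorm f q volume < ⊤)
    {φ : Evec N → ℝ} (hφ : ContDiff ℝ 1 φ) {C : ℝ} (hC : 0 < C)
    (h0 : ∀ x, |φ x| ≤ C * Jd N x) (h1 : ∀ x, ‖fderiv ℝ φ x‖ ≤ C * Jd N x) (v₀ e : Evec N) :
    fderiv ℝ (fun v => ∫ w, φ (a • v - b • w) * f w) v₀ e =
      a * ∫ w, fderiv ℝ φ (a • v₀ - b • w) e * f w ∧
    DifferentiableAt ℝ (fun v => ∫ w, φ (a • v - b • w) * f w) v₀ := by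
  set F' : Evec N → Evec N → (Evec N →L[ℝ] ℝ) :=
    fun v w => (f w * a) • fderiv ℝ φ (a • v - b • w) with hF'
  set bound : Evec N → ℝ := fun w =>
    (|a| * C * (1 + |a|) ^ (N + 1)) * ‖Jd N (a • v₀ - b • w) * f w‖ with hbd
  have hbi : Integrable bound := (Jd_mul_integrable hq (a • v₀) hb hf hfq).norm.const_mul _
  have hdc : Continuous (fderiv ℝ φ) := hφ.continuous_fderiv (by simp)
  have hm : ∀ v, AEStronglyMeasurable (fun w => φ (a • v - b • w) * f w) volume := fun v =>
    (hφ.continuous.comp (by fun_prop : Continuous fun w : Evec N => a • v - b • w)).aestronglyMeasurable.mul hf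
  have hm' : AEStronglyMeasurable (F' v₀) volume :=
    (hf.mul_const a).smul
      (hdc.comp (by fun_prop : Continuous fun w : Evec N => a • v₀ - b • w)).aestronglyMeasurable
  have hb' : ∀ w, ∀ v ∈ Metric.ball v₀ 1, ‖F' v w‖ ≤ bound w := by
    intro w v hv
    rw [mem_ball_iff_norm] at hv
    simp only [hF', hbd, norm_smul, norm_mul, Real.norm_eq_abs, abs_of_pos (Jd_pos _ _)]
    have k1 := h1 (a • v - b • w)
    have k2 := Jd_shift N (a • v - b • w) (a • v₀ - b • w)
    have k3 : ‖a • v - b • w - (a • v₀ - b • w)‖ ≤ |a| := by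
      rw [sub_sub_sub_cancel_right, ← smul_sub, norm_smul, Real.norm_eq_abs]
      exact mul_le_of_le_one_right (abs_nonneg a) hv.le
    have k4 : Jd N (a • v - b • w) ≤ (1 + |a|) ^ (N + 1) * Jd N (a • v₀ - b • w) := by
      refine k2.trans ?_
      gcongr
      exact (Jd_pos _ _).le
    calc |f w| * |a| * ‖fderiv ℝ φ (a • v - b • w)‖
        ≤ |f w| * |a| * (C * ((1 + |a|) ^ (N + 1) * Jd N (a • v₀ - b • w))) := by
          gcongr; exact k1.trans (by gcongr)
      _ = _ := by ring
  have hFi : Integrable (fun w => φ (a • v₀ - b • w) * f w) := by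
    refine ((Jd_mul_integrable hq (a • v₀) hb hf hfq).norm.const_mul C).mono' (hm v₀)
      (Eventually.of_forall fun w => ?_)
    rw [norm_mul, norm_mul, Real.norm_eq_abs (Jd _ _), abs_of_pos (Jd_pos _ _), ← mul_assoc]
    gcongr
    exact h0 _
  have hD : ∀ w, ∀ v ∈ Metric.ball v₀ (1:ℝ),
      HasFDerivAt (fun v => φ (a • v - b • w) * f w) (F' v w) v := by
    intro w v _
    have d1 : HasFDerivAt φ (fderiv ℝ φ (a • v - b • w)) (a • v - b • w) :=
      (hφ.differentiable (by simp) _).hasFDerivAt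
    have d2 : HasFDerivAt (fun v : Evec N => a • v - b • w)
        (a • ContinuousLinearMap.id ℝ (Evec N)) v :=
      ((hasFDerivAt_id v).const_smul a).sub_const _
    have d3 := (d1.comp v d2).mul_const (f w)
    refine d3.congr_fderiv ?_
    ext y
    simp [hF']; ring
  have key := hasFDerivAt_integral_of_dominated_of_fderiv_le (μ := volume) (𝕜 := ℝ)
    (Metric.ball_mem_nhds v₀ one_pos) (Eventually.of_forall hm) hFi hm'
    (Eventually.of_forall hb') hbi (Eventually.of_forall hD)
  have hF'i : Integrable (F' v₀) := hbi.mono' hm'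
    (Eventually.of_forall fun w => hb' w v₀ (Metric.mem_ball_self one_pos))
  refine ⟨?_, key.differentiableAt⟩
  rw [key.fderiv, ContinuousLinearMap.integral_apply hF'i, ← integral_const_mul]
  congr 1; funext w
  simp [hF']; ring

lemma pds_conv {N : ℕ} {q : ℝ≥0∞} (hq : 1 ≤ q) (c a : ℝ) {b : ℝ} (hb : b ≠ 0)
    {f : Evec N → ℝ} (hf : AEStronglyMeasurable f volume) (hfq : eLpNorm f q volume < ⊤)
    (l : List (Fin N)) :
    partialDerivSeq N l (fun v => c * ∫ w, gE N (a • v - b • w) * f w) =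
      fun v => c * a ^ l.length * ∫ w, partialDerivSeq N l (gE N) (a • v - b • w) * f w := by
  induction l with
  | nil => simp [partialDerivSeq]
  | cons i l ih =>
    obtain ⟨hcd, C, hC, hx⟩ := pds_gE_props N l (N + 1)
    funext v
    have := conv_hasFDerivAt hq a hb hf hfq hcd hC (fun x => (hx x).1) (fun x => (hx x).2) v
      (EuclideanSpace.single i 1)
    simp only [partialDerivSeq]
    rw [ih, fderiv_const_mul this.2, _root_.smul_apply, this.1, smul_eq_mul, List.length_cons]
    ring

lemma weight_ineq {m : ℝ} (hm : 0 ≤ m) {V X W : ℝ} (hV : 0 ≤ V) (hX : 0 ≤ X) (hW : 0 ≤ W)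
    (h : V ≤ X + W) : 1 + V ^ m ≤ 2 * (1 + X) ^ m * (1 + W ^ m) := by
  have hWm : 0 ≤ W ^ m := Real.rpow_nonneg hW m
  have h1 : 1 ≤ (1 + X) ^ m := Real.one_le_rpow (by linarith) hm
  have h2 : V ≤ (1 + X) * max 1 W := by
    have a1 := le_max_left 1 W
    have a2 := le_max_right 1 W
    nlinarith
  have h3 : V ^ m ≤ (1 + X) ^ m * (1 + W ^ m) := by
    calc V ^ m ≤ ((1 + X) * max 1 W) ^ m := Real.rpow_le_rpow hV h2 hm
      _ = (1 + X) ^ m * (max 1 W) ^ m := Real.mul_rpow (by linarith) (by positivity)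
      _ ≤ _ := by
        gcongr
        rcases max_cases 1 W with h | h <;> rw [h.1]
        · simp [hWm]
        · linarith
  nlinarith

lemma unif_bound (N k M : ℕ) : ∃ K : ℝ, 0 < K ∧ ∀ l : List (Fin N), l.length = k →
    ∀ x, |partialDerivSeq N l (gE N) x| ≤ K * ((1 + ‖x‖) ^ M)⁻¹ := by
  choose C hC hx using fun l => (pds_gE_props N l M).2
  obtain ⟨K, hK⟩ := ((List.finite_length_eq (Fin N) k).image C).bddAbove
  refine ⟨max K 1, by positivity, fun l hl x => ((hx l x).1).trans ?_⟩
  gcongr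
  exact (hK ⟨l, hl, rfl⟩).trans (le_max_left _ _)

lemma FPkernel_eq (N : ℕ) (t L : ℝ) (hL : exp (2 * t) - 1 = exp (2 * L)) (v w : Evec N) :
    FPkernel N t v w = exp ((N : ℝ) * t) * (2 * π * (exp (2 * t) - 1)) ^ (-(N : ℝ) / 2) *
      gE N (exp (t - L) • v - exp (-L) • w) := by
  unfold FPkernel gE
  have h : exp (t - L) • v - exp (-L) • w = exp (-L) • (exp t • v - w) := by
    rw [smul_sub, smul_smul, ← Real.exp_add]; congr 3; ring
  rw [h, norm_smul, Real.norm_eq_abs, abs_of_pos (exp_pos _), mul_pow, hL]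
  congr 2
  have : exp (-L) ^ 2 = (exp (2 * L))⁻¹ := by
    rw [← Real.exp_neg, ← Real.exp_nat_mul]; congr 1; push_cast; ring
  rw [this]
  field_simp

lemma const_eq (N k : ℕ) (t L P Q K B : ℝ) :
    (exp ((N : ℝ) * t) * (2 * π * exp (2 * L)) ^ (-(N : ℝ) / 2) * exp (t - L) ^ k * (2 * K) *
      exp (-L) ^ (-(N : ℝ) * 1)) * (exp (t - L) ^ (-(N : ℝ) * P) * (B * exp L ^ (-(N : ℝ) * Q))) =
    (2 * K * B * (2 * π) ^ (-(N : ℝ) / 2)) * exp (((N : ℝ) * (1 - P) + k) * t) *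
      exp (2 * L) ^ (-((N : ℝ) / 2) * (Q - P) - (k : ℝ) / 2) := by
  rw [Real.mul_rpow (by positivity) (by positivity)]
  simp only [← Real.exp_mul, ← Real.exp_nat_mul]
  have e : exp (((N : ℝ) * (1 - P) + k) * t) *
      exp (2 * L * (-((N : ℝ) / 2) * (Q - P) - (k : ℝ) / 2)) =
      exp (N * t) * exp (2 * L * (-(N:ℝ)/2)) * exp (k * (t - L)) * exp (-L * (-(N:ℝ) * 1)) *
      exp ((t - L) * (-(N:ℝ) * P)) * exp (L * (-(N:ℝ) * Q)) := by
    simp only [← Real.exp_add]; congr 1; ring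
  rw [mul_assoc _ (exp _) (exp _), e]
  ring

/-- **`L^p_m`-bounds for the Fokker-Planck kernel (Proposition A.1).** For `1 ≤ q ≤ p ≤ ∞`,
`m ≥ 0` and any multi-index `α` with `|α| = k`, for `t > 0` and `f ∈ L^q_m(ℝ^N)`:
`‖∂^α 𝓕(t)[f]‖_{L^p_m} ≤ C e^{(N/p' + k)t} ν(t)^{-(N/2)(1/q - 1/p) - k/2} ‖f‖_{L^q_m}`,
where `ν(t) = e^{2t} - 1`. -/
theorem FPkernel_derivative_bounds
    (N : ℕ) (hN : 1 ≤ N) (p q : ℝ≥0∞) (hq1 : 1 ≤ q) (hqp : q ≤ p)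
    (m : ℝ) (hm : 0 ≤ m) (k : ℕ) :
    ∃ C : ℝ, 0 < C ∧ ∀ t : ℝ, 0 < t → ∀ f : Evec N → ℝ,
      AEStronglyMeasurable f volume → wLpNorm N q m f < ⊤ →
      ∀ l : List (Fin N), l.length = k →
        wLpNorm N p m
            (partialDerivSeq N l (fun v => ∫ w : Evec N, FPkernel N t v w * f w)) ≤
          ENNReal.ofReal
            (C * exp (((N : ℝ) * (1 - (1 / p).toReal) + k) * t) *
              (exp (2 * t) - 1) ^
                (-((N : ℝ) / 2) * ((1 / q).toReal - (1 / p).toReal) - (k : ℝ) / 2)) *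
          wLpNorm N q m f := by
  obtain ⟨K, hK, hφ⟩ := unif_bound N k (N + 1 + ⌈m⌉₊)
  have hJi : ∫⁻ y, ENNReal.ofReal (Jd N y) ≠ ⊤ := by
    have := (Jd_integrable N).2
    rw [hasFiniteIntegral_iff_ofReal (Eventually.of_forall fun x => (Jd_pos N x).le)] at this
    exact this.ne
  set B₀ : ℝ := 1 + (∫⁻ y, ENNReal.ofReal (Jd N y)).toReal with hB₀
  have hB₀1 : 1 ≤ B₀ := by rw [hB₀]; linarith [ENNReal.toReal_nonneg (a := ∫⁻ y, ENNReal.ofReal (Jd N y))]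
  have hBJ : ∫⁻ y, ENNReal.ofReal (Jd N y) ≤ ENNReal.ofReal B₀ := by
    rw [← ENNReal.ofReal_toReal hJi]
    exact ENNReal.ofReal_le_ofReal (by rw [hB₀]; linarith)
  refine ⟨2 * K * B₀ * (2 * π) ^ (-(N : ℝ) / 2), by positivity, ?_⟩
  intro t ht f hf hfm l hl
  have hν : 0 < exp (2 * t) - 1 := by
    have := Real.one_lt_exp_iff.2 (show 0 < 2 * t by linarith); linarith
  obtain ⟨L, hL⟩ : ∃ L, exp (2 * t) - 1 = exp (2 * L) :=
    ⟨Real.log (exp (2 * t) - 1) / 2, by rw [mul_div_cancel₀ _ two_ne_zero, Real.exp_log hν]⟩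
  have hLt : L ≤ t := by
    have : exp (2 * L) ≤ exp (2 * t) := by linarith
    have := Real.exp_le_exp.1 this; linarith
  set g : Evec N → ℝ := fun w => (1 + ‖w‖ ^ m) * f w with hg
  have hwpos : ∀ w : Evec N, 0 ≤ ‖w‖ ^ m := fun w => Real.rpow_nonneg (norm_nonneg w) m
  have hwm : Measurable (fun w : Evec N => (1 + ‖w‖ ^ m)) := by fun_prop
  have hgm : AEStronglyMeasurable g volume := hwm.aestronglyMeasurable.mul hf
  have hfq : eLpNorm f q volume < ⊤ := by
    refine lt_of_le_of_lt (eLpNorm_mono (fun w => ?_)) hfm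
    rw [norm_mul, Real.norm_eq_abs (1 + _), abs_of_pos (by linarith [hwpos w])]
    exact le_mul_of_one_le_left (norm_nonneg _) (by linarith [hwpos w])
  set c : ℝ := exp ((N : ℝ) * t) * (2 * π * (exp (2 * t) - 1)) ^ (-(N : ℝ) / 2) with hc
  have hc0 : 0 < c := by positivity
  have hker : (fun v => ∫ w : Evec N, FPkernel N t v w * f w) =
      fun v => c * ∫ w, gE N (exp (t - L) • v - exp (-L) • w) * f w := by
    funext v
    rw [← integral_const_mul]
    congr 1; funext w
    rw [FPkernel_eq N t L hL, mul_assoc]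
  rw [hker, pds_conv hq1 c _ (exp_pos (-L)).ne' hf hfq l, hl]
  set φ := partialDerivSeq N l (gE N) with hφd
  set H : Evec N → ℝ≥0∞ := fun u => ∫⁻ y, ENNReal.ofReal (Jd N (u - y)) * ‖g (exp L • y)‖ₑ with hH
  -- change of variables in w
  have hcv : ∀ u, ∫⁻ w, ENNReal.ofReal (Jd N (u - exp (-L) • w)) * ‖g w‖ₑ =
      ENNReal.ofReal (exp (-L) ^ (-(N : ℝ) * 1)) * H u := by
    intro u
    have := eLpNorm_dil N 1 (fun y => ENNReal.ofReal (Jd N (u - y)) * ‖g (exp L • y)‖ₑ)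
      (exp_pos (-L))
    simp only [eLpNorm_one_eq_lintegral_enorm, enorm_eq_self, smul_smul, ← Real.exp_add,
      add_neg_cancel, Real.exp_zero, one_smul, div_one, ENNReal.toReal_one] at this
    exact this
  have hpt : ∀ v w : Evec N, ‖(1 + ‖v‖ ^ m)‖ₑ * ‖φ (exp (t - L) • v - exp (-L) • w) * f w‖ₑ ≤
      ENNReal.ofReal (2 * K) *
        (ENNReal.ofReal (Jd N (exp (t - L) • v - exp (-L) • w)) * ‖g w‖ₑ) := by
    intro v w
    set x := exp (t - L) • v - exp (-L) • w with hx
    have hvx : ‖v‖ ≤ ‖x‖ + ‖w‖ := by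
      have e1 : v = exp (L - t) • x + exp (-t) • w := by
        rw [hx, smul_sub, smul_smul, smul_smul, ← Real.exp_add, ← Real.exp_add]
        have e2 : L - t + (t - L) = 0 := by ring
        have e3 : L - t + -L = -t := by ring
        rw [e2, e3]; simp
      calc ‖v‖ = ‖exp (L - t) • x + exp (-t) • w‖ := by rw [← e1]
        _ ≤ exp (L - t) * ‖x‖ + exp (-t) * ‖w‖ := by
          refine (norm_add_le _ _).trans (le_of_eq ?_)
          rw [norm_smul, norm_smul, Real.norm_eq_abs, Real.norm_eq_abs, abs_of_pos (exp_pos _),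
            abs_of_pos (exp_pos _)]
        _ ≤ 1 * ‖x‖ + 1 * ‖w‖ := by
          gcongr
          · exact Real.exp_le_one_iff.2 (by linarith)
          · exact Real.exp_le_one_iff.2 (by linarith)
        _ = _ := by ring
    have hwt := weight_ineq hm (norm_nonneg v) (norm_nonneg x) (norm_nonneg w) hvx
    have hb := hφ l hl x
    have hx1 : 1 ≤ 1 + ‖x‖ := by linarith [norm_nonneg x]
    have hceil : (1 + ‖x‖) ^ m ≤ (1 + ‖x‖) ^ ⌈m⌉₊ := by
      rw [← Real.rpow_natCast]
      exact Real.rpow_le_rpow_of_exponent_le hx1 (Nat.le_ceil m)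
    rw [← Real.enorm_eq_ofReal (by positivity : 0 ≤ 2 * K), ← Real.enorm_eq_ofReal (Jd_pos N x).le,
      ← enorm_mul, ← enorm_mul, ← enorm_mul]
    refine enorm_le_iff_norm_le.2 ?_
    simp only [hg, norm_mul, Real.norm_eq_abs, abs_of_pos (Jd_pos N x), abs_of_pos hK, abs_two]
    rw [abs_of_pos (by linarith [hwpos v] : 0 < 1 + ‖v‖ ^ m),
      abs_of_pos (by linarith [hwpos w] : 0 < 1 + ‖w‖ ^ m)]
    calc (1 + ‖v‖ ^ m) * (|φ x| * |f w|)
        ≤ (2 * (1 + ‖x‖) ^ ⌈m⌉₊ * (1 + ‖w‖ ^ m)) *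
          ((K * ((1 + ‖x‖) ^ (N + 1 + ⌈m⌉₊))⁻¹) * |f w|) := by
          have hw1 : 0 ≤ 1 + ‖w‖ ^ m := by linarith [hwpos w]
          gcongr
          refine hwt.trans ?_
          gcongr
      _ = _ := by
          unfold Jd
          rw [pow_add _ (N + 1)]
          field_simp
  have hD0 : 0 ≤ c * exp (t - L) ^ k * (2 * K) * exp (-L) ^ (-(N : ℝ) * 1) := by positivity
  have hptv : ∀ v, ‖(1 + ‖v‖ ^ m) * (c * exp (t - L) ^ k *
      ∫ w, φ (exp (t - L) • v - exp (-L) • w) * f w)‖ₑ ≤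
      ((c * exp (t - L) ^ k * (2 * K) * exp (-L) ^ (-(N : ℝ) * 1)).toNNReal : ℝ≥0∞) *
        ‖H (exp (t - L) • v)‖ₑ := by
    intro v
    have hck : 0 ≤ c * exp (t - L) ^ k := by positivity
    rw [enorm_eq_self, enorm_mul, enorm_mul, Real.enorm_eq_ofReal hck]
    calc _ ≤ ‖(1 + ‖v‖ ^ m)‖ₑ * (ENNReal.ofReal (c * exp (t - L) ^ k) *
          ∫⁻ w, ‖φ (exp (t - L) • v - exp (-L) • w) * f w‖ₑ) := by
          gcongr; exact enorm_integral_le_lintegral_enorm _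
      _ = ENNReal.ofReal (c * exp (t - L) ^ k) *
          ∫⁻ w, ‖(1 + ‖v‖ ^ m)‖ₑ * ‖φ (exp (t - L) • v - exp (-L) • w) * f w‖ₑ := by
          rw [lintegral_const_mul' _ _ enorm_ne_top]; ring
      _ ≤ ENNReal.ofReal (c * exp (t - L) ^ k) * ∫⁻ w, ENNReal.ofReal (2 * K) *
        (ENNReal.ofReal (Jd N (exp (t - L) • v - exp (-L) • w)) * ‖g w‖ₑ) := by
          exact mul_le_mul_right (lintegral_mono fun w => hpt v w) _
      _ = _ := by
          rw [lintegral_const_mul' _ _ ENNReal.ofReal_ne_top, hcv, ← mul_assoc, ← mul_assoc,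
            ← ENNReal.ofReal_mul hck, ← ENNReal.ofReal_mul (by positivity)]
          rfl
  have step1 := eLpNorm_le_nnreal_smul_eLpNorm_of_ae_le_mul' (μ := volume)
    (Eventually.of_forall hptv) p
  have hgs : AEStronglyMeasurable (fun y => g (exp L • y)) volume := by
    refine hgm.comp_quasiMeasurePreserving ⟨by fun_prop, ?_⟩
    rw [Measure.map_addHaar_smul _ (exp_pos L).ne']
    exact Measure.smul_absolutelyContinuous
  have step2 : eLpNorm H p volume ≤
      ENNReal.ofReal B₀ * eLpNorm (fun y => g (exp L • y)) q volume :=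
    young (Φ := fun x => ENNReal.ofReal (Jd N x)) hq1 hqp
      (Jd_cont N).measurable.ennreal_ofReal (fun x => by simpa using Jd_le_one N x)
      (by simpa using hB₀1) ENNReal.ofReal_ne_top hBJ hgs
  rw [eLpNorm_dil N q g (exp_pos L)] at step2
  unfold wLpNorm
  refine step1.trans ?_
  rw [eLpNorm_dil N p H (exp_pos _), ENNReal.smul_def, smul_eq_mul]
  refine (mul_le_mul_right (mul_le_mul_right step2 _) _).trans (le_of_eq ?_)
  change ENNReal.ofReal _ * _ = _
  rw [hL, ← const_eq N k t L, ← hL, ← hc, ENNReal.ofReal_mul hD0,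
    ENNReal.ofReal_mul (p := exp (t - L) ^ (-(N : ℝ) * (1 / p).toReal)) (by positivity),
    ENNReal.ofReal_mul (p := B₀) (by positivity)]
  simp only [mul_assoc]
  rfl
end
end
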